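/- arXiv:1104.2371 — 3 statements merged into one kernel-verified Lean document; each statement's English description precedes it below -/
import Mathlib

section
/- Suppose k ≥ 1 and n + l ≥ 2, and fix y ∈ Y and distinct a, b ∈ X ∪ Z. For each integer m ≥ 1 let φ_m : ℤ² → K_{n,k,l} be the group homomorphism sending (1,0) to C_{y,a}^m · C_{b,y} · C_{y,a}^{-m} and (0,1) to C_{a,y} · C_{b,y} (these elements commute). Then for every nonzero class c ∈ H_2(ℤ²; ℚ), the family of abelian cycles μ_m = (φ_m)_*(c) ∈ H_2(K_{n,k,l}; ℚ), m ≥ 1, is linearly independent over ℚ. -/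
namespace Birman

/-- The generating set of the free group `F_{n,k,l}`: `X ∪ Y ∪ Z`. -/
abbrev Gen (n k l : ℕ) := Fin n ⊕ (Fin k ⊕ Fin l)

/-- The free group `F_{n,k,l}` on `X ∪ Y ∪ Z`. -/
abbrev FG (n k l : ℕ) := FreeGroup (Gen n k l)

variable {n k l : ℕ}

/-- The generator `x_i`. -/
def xg (n k l : ℕ) (i : Fin n) : Gen n k l := Sum.inl i
/-- The generator `y_j`. -/
def yg (n k l : ℕ) (j : Fin k) : Gen n k l := Sum.inr (Sum.inl j)
/-- The generator `z_m`. -/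
def zg (n k l : ℕ) (m : Fin l) : Gen n k l := Sum.inr (Sum.inr m)

/-- `A_{n,k,l}`: automorphisms sending each generator in `Y ∪ Z` to a conjugate of itself. -/
def A (n k l : ℕ) : Subgroup (MulAut (FG n k l)) where
  carrier := {f | ∀ s : Fin k ⊕ Fin l,
    IsConj (FreeGroup.of (Sum.inr s : Gen n k l)) (f (FreeGroup.of (Sum.inr s)))}
  one_mem' := by
    intro s
    rw [MulAut.one_apply]
  mul_mem' := by
    intro f g hf hg s
    rw [MulAut.mul_apply]
    exact (hf s).trans (f.toMonoidHom.map_isConj (hg s))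
  inv_mem' := by
    intro f hf s
    have h := (f⁻¹ : MulAut (FG n k l)).toMonoidHom.map_isConj (hf s)
    simp only [MulEquiv.toMonoidHom_eq_coe, MonoidHom.coe_coe] at h
    have h2 : (f⁻¹ : MulAut (FG n k l)) (f (FreeGroup.of (Sum.inr s))) = FreeGroup.of (Sum.inr s) :=
      MulAut.inv_apply_self _ f _
    rw [h2] at h
    exact h.symm

/-- The projection `F_{n,k,l} → F_{n,0,l}` killing the generators in `Y`. -/
def proj (n k l : ℕ) : FG n k l →* FG n 0 l :=
  FreeGroup.lift fun g => match g with
    | Sum.inl i => FreeGroup.of (Sum.inl i)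
    | Sum.inr (Sum.inl _) => 1
    | Sum.inr (Sum.inr m) => FreeGroup.of (Sum.inr (Sum.inr m))

/-- Automorphisms commuting with the projection to `F_{n,0,l}`, i.e. inducing the identity
on `F_{n,k,l}/N ≅ F_{n,0,l}`. -/
def fixProj (n k l : ℕ) : Subgroup (MulAut (FG n k l)) where
  carrier := {f | ∀ w : FG n k l, proj n k l (f w) = proj n k l w}
  one_mem' := by intro w; simp
  mul_mem' := by
    intro f g hf hg w
    rw [MulAut.mul_apply]
    exact (hf (g w)).trans (hg w)
  inv_mem' := by
    intro f hf w
    have h := hf ((f⁻¹ : MulAut (FG n k l)) w)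
    rw [MulAut.apply_inv_self] at h
    exact h.symm

/-- `K_{n,k,l}`, the kernel of `ρ : A_{n,k,l} → A_{n,0,l}`: those elements of `A_{n,k,l}`
that induce the identity automorphism of `F_{n,k,l}/N ≅ F_{n,0,l}`. -/
def K (n k l : ℕ) : Subgroup (MulAut (FG n k l)) := A n k l ⊓ fixProj n k l

/-- `f` is the automorphism `M_{v,w}` : `v ↦ w v`, fixing all other generators. -/
def IsMul (f : MulAut (FG n k l)) (v w : Gen n k l) : Prop :=
  f (FreeGroup.of v) = FreeGroup.of w * FreeGroup.of v ∧
    ∀ u : Gen n k l, u ≠ v → f (FreeGroup.of u) = FreeGroup.of u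

/-- `f` is the automorphism `M_{v⁻¹,w}` : `v ↦ v w⁻¹`, fixing all other generators. -/
def IsMulInv (f : MulAut (FG n k l)) (v w : Gen n k l) : Prop :=
  f (FreeGroup.of v) = FreeGroup.of v * (FreeGroup.of w)⁻¹ ∧
    ∀ u : Gen n k l, u ≠ v → f (FreeGroup.of u) = FreeGroup.of u

/-- `f` is the automorphism `C_{v,w}` : `v ↦ w v w⁻¹`, fixing all other generators. -/
def IsConjGen (f : MulAut (FG n k l)) (v w : Gen n k l) : Prop :=
  f (FreeGroup.of v) = FreeGroup.of w * FreeGroup.of v * (FreeGroup.of w)⁻¹ ∧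
    ∀ u : Gen n k l, u ≠ v → f (FreeGroup.of u) = FreeGroup.of u

end Birman

namespace GroupH2

variable (G : Type*) [Group G]

noncomputable def d2 : ((G × G) →₀ ℚ) →ₗ[ℚ] (G →₀ ℚ) :=
  Finsupp.lift (G →₀ ℚ) ℚ (G × G) fun p =>
    Finsupp.single p.2 (1 : ℚ) - Finsupp.single (p.1 * p.2) 1 + Finsupp.single p.1 1

noncomputable def d3 : ((G × G × G) →₀ ℚ) →ₗ[ℚ] ((G × G) →₀ ℚ) :=
  Finsupp.lift ((G × G) →₀ ℚ) ℚ (G × G × G) fun t =>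
    Finsupp.single (t.2.1, t.2.2) (1 : ℚ) - Finsupp.single (t.1 * t.2.1, t.2.2) 1
      + Finsupp.single (t.1, t.2.1 * t.2.2) 1 - Finsupp.single (t.1, t.2.1) 1

noncomputable def Z2 : Submodule ℚ ((G × G) →₀ ℚ) := LinearMap.ker (d2 G)

noncomputable def B2 : Submodule ℚ ↥(Z2 G) :=
  Submodule.comap (Z2 G).subtype (LinearMap.range (d3 G))

noncomputable def H2 := ↥(Z2 G) ⧸ B2 G

noncomputable instance : AddCommGroup (H2 G) := by unfold H2; infer_instance
noncomputable instance : Module ℚ (H2 G) := by unfold H2; infer_instance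

variable {G} {H : Type*} [Group H] (φ : G →* H)

noncomputable def cmap1 : (G →₀ ℚ) →ₗ[ℚ] (H →₀ ℚ) := Finsupp.lmapDomain ℚ ℚ φ

noncomputable def cmap2 : ((G × G) →₀ ℚ) →ₗ[ℚ] ((H × H) →₀ ℚ) :=
  Finsupp.lmapDomain ℚ ℚ (Prod.map φ φ)

noncomputable def cmap3 : ((G × G × G) →₀ ℚ) →ₗ[ℚ] ((H × H × H) →₀ ℚ) :=
  Finsupp.lmapDomain ℚ ℚ (Prod.map φ (Prod.map φ φ))

theorem d2_comm : (d2 H).comp (cmap2 φ) = (cmap1 φ).comp (d2 G) := by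
  apply Finsupp.lhom_ext
  intro p q
  simp only [LinearMap.comp_apply, cmap2, Finsupp.lmapDomain_apply,
    Finsupp.mapDomain_single, Prod.map_apply]
  simp only [d2, Finsupp.lift_apply, Finsupp.sum_single_index, zero_smul]
  simp only [cmap1, map_smul, map_sub, map_add, Finsupp.lmapDomain_apply,
    Finsupp.mapDomain_single, map_mul, Prod.map_fst, Prod.map_snd]

theorem d3_comm : (d3 H).comp (cmap3 φ) = (cmap2 φ).comp (d3 G) := by
  apply Finsupp.lhom_ext
  intro p q
  simp only [LinearMap.comp_apply, cmap3, Finsupp.lmapDomain_apply,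
    Finsupp.mapDomain_single, Prod.map_apply]
  simp only [d3, Finsupp.lift_apply, Finsupp.sum_single_index, zero_smul]
  simp only [cmap2, map_smul, map_sub, map_add, Finsupp.lmapDomain_apply,
    Finsupp.mapDomain_single, map_mul, Prod.map_apply, Prod.map_fst, Prod.map_snd]

theorem cmap2_cycles : ∀ x ∈ Z2 G, cmap2 φ x ∈ Z2 H := by
  intro x hx
  have h := congrArg (fun (f : ((G × G) →₀ ℚ) →ₗ[ℚ] (H →₀ ℚ)) => f x) (d2_comm φ)
  simp only [LinearMap.comp_apply] at h
  simp only [Z2, LinearMap.mem_ker] at hx ⊢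
  rw [h, hx, map_zero]

theorem cmap2_boundaries :
    B2 G ≤ Submodule.comap ((cmap2 φ).restrict (cmap2_cycles φ)) (B2 H) := by
  rintro ⟨x, hx⟩ hmem
  obtain ⟨t, ht⟩ := hmem
  refine ⟨cmap3 φ t, ?_⟩
  have h := congrArg (fun (f : ((G × G × G) →₀ ℚ) →ₗ[ℚ] ((H × H) →₀ ℚ)) => f t) (d3_comm φ)
  simp only [LinearMap.comp_apply] at h
  simp only [Submodule.subtype_apply] at ht
  show d3 H (cmap3 φ t) = _
  rw [h, ht]
  rfl

/-- Functoriality of `H₂(-; ℚ)`. -/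
noncomputable def H2map : H2 G →ₗ[ℚ] H2 H :=
  Submodule.mapQ (B2 G) (B2 H) ((cmap2 φ).restrict (cmap2_cycles φ)) (cmap2_boundaries φ)

end GroupH2

namespace Birman

open GroupH2

/-- The generator of `F_{n,k,l}` corresponding to an element of `X ∪ Z`. -/
def xzg (n k l : ℕ) (s : Fin n ⊕ Fin l) : Gen n k l :=
  match s with
  | Sum.inl i => Sum.inl i
  | Sum.inr m => Sum.inr (Sum.inr m)

end Birman

namespace GroupH2

section Eval

variable {G : Type*} [Group G] {V : Type*} [AddCommGroup V] [Module ℚ V]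

/-- The 2-cocycle condition (trivial coefficients). -/
def IsCocycle (σ : G × G → V) : Prop :=
  ∀ f g h : G, σ (g, h) - σ (f * g, h) + σ (f, g * h) - σ (f, g) = 0

/-- Evaluation of a 2-cocycle on `H₂`. -/
noncomputable def ev (σ : G × G → V) (hσ : IsCocycle σ) : H2 G →ₗ[ℚ] V :=
  (B2 G).liftQ ((Finsupp.linearCombination ℚ σ).comp (Z2 G).subtype) (by
    rintro ⟨x, hx⟩ ⟨t, ht⟩
    simp only [Submodule.subtype_apply] at ht
    subst ht
    simp only [LinearMap.mem_ker, LinearMap.comp_apply, Submodule.subtype_apply]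
    clear hx
    rw [← LinearMap.comp_apply]
    have : (Finsupp.linearCombination ℚ σ).comp (d3 G) = 0 := by
      apply Finsupp.lhom_ext
      rintro ⟨f, g, h⟩ q
      simp only [LinearMap.comp_apply, d3, Finsupp.lift_apply, Finsupp.sum_single_index, zero_smul,
        map_smul, map_sub, map_add, Finsupp.linearCombination_single, one_smul,
        LinearMap.zero_apply]
      rw [hσ f g h, smul_zero]
    rw [this]; rfl)

theorem ev_mk (σ : G × G → V) (hσ : IsCocycle σ) (z : Z2 G) :
    ev σ hσ (Submodule.Quotient.mk z : ↥(Z2 G) ⧸ B2 G) = Finsupp.linearCombination ℚ σ z.1 := rfl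

theorem ev_map {H : Type*} [Group H] (φ : H →* G) (σ : G × G → V) (hσ : IsCocycle σ) (z : Z2 H) :
    ev σ hσ (H2map φ (Submodule.Quotient.mk z : ↥(Z2 H) ⧸ B2 H))
      = Finsupp.linearCombination ℚ (fun p => σ (φ p.1, φ p.2)) z.1 := by
  change Finsupp.linearCombination ℚ σ (Finsupp.mapDomain (Prod.map φ φ) z.1) = _
  rw [Finsupp.linearCombination_mapDomain]
  rfl

/-- Coboundaries vanish on cycles. -/
theorem cobdry_eval (lam : G → V) (z : Z2 G) :
    Finsupp.linearCombination ℚ (fun p : G × G => lam p.2 - lam (p.1 * p.2) + lam p.1) z.1 = 0 := by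
  have : Finsupp.linearCombination ℚ (fun p : G × G => lam p.2 - lam (p.1 * p.2) + lam p.1)
      = (Finsupp.linearCombination ℚ lam).comp (d2 G) := by
    apply Finsupp.lhom_ext
    rintro ⟨g, h⟩ q
    simp [d2, Finsupp.sum_single_index]
  rw [this, LinearMap.comp_apply, show d2 G z.1 = 0 from z.2, map_zero]

/-- The central extension attached to a 2-cocycle. -/
structure Ext (σ : G × G → V) where
  r : V
  g : G

variable (σ : G × G → V)

theorem Ext.ext' {σ : G × G → V} {x y : Ext σ} (h : x.r = y.r) (h' : x.g = y.g) : x = y := by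
  cases x; cases y; simp_all

instance : Mul (Ext σ) := ⟨fun x y => ⟨x.r + y.r + σ (x.g, y.g), x.g * y.g⟩⟩
instance : One (Ext σ) := ⟨⟨-σ (1, 1), 1⟩⟩
instance : Inv (Ext σ) := ⟨fun x => ⟨-x.r - σ (x.g⁻¹, x.g) - σ (1, 1), x.g⁻¹⟩⟩

theorem Ext.mul_r (x y : Ext σ) : (x * y).r = x.r + y.r + σ (x.g, y.g) := rfl
theorem Ext.mul_g (x y : Ext σ) : (x * y).g = x.g * y.g := rfl
theorem Ext.one_r : (1 : Ext σ).r = -σ (1, 1) := rfl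
theorem Ext.one_g : (1 : Ext σ).g = 1 := rfl
theorem Ext.inv_r (x : Ext σ) : (x⁻¹).r = -x.r - σ (x.g⁻¹, x.g) - σ (1, 1) := rfl
theorem Ext.inv_g (x : Ext σ) : (x⁻¹).g = x.g⁻¹ := rfl

/-- The group structure. -/
@[reducible] def Ext.group (hσ : IsCocycle σ) : Group (Ext σ) :=
  Group.ofLeftAxioms
    (by
      intro x y z
      apply Ext.ext'
      · simp only [Ext.mul_r, Ext.mul_g]
        have := hσ x.g y.g z.g
        rw [← sub_eq_zero, ← neg_eq_zero, ← this]; abel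
      · simp only [Ext.mul_g, mul_assoc])
    (by
      intro x
      apply Ext.ext'
      · simp only [Ext.mul_r, Ext.one_r, Ext.one_g]
        have := hσ 1 1 x.g
        simp only [one_mul, mul_one] at this
        rw [← sub_eq_zero, ← this]; abel
      · simp only [Ext.mul_g, Ext.one_g, one_mul])
    (by
      intro x
      apply Ext.ext'
      · simp only [Ext.mul_r, Ext.inv_r, Ext.inv_g, Ext.one_r]
        abel
      · simp only [Ext.mul_g, Ext.inv_g, Ext.one_g, inv_mul_cancel])

end Eval

theorem comm_pow {E : Type*} [Group E] (X Y Z : E) (hZ : ∀ w, Z * w = w * Z)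
    (h : Y * X = X * Y * Z) (i j : ℤ) : Y ^ j * X ^ i = X ^ i * Y ^ j * Z ^ (i * j) := by
  have hZi : ∀ (i : ℤ) w, Commute (Z ^ i) w := fun i w => Commute.zpow_left (hZ w) i
  have h1 : Y * X * Y⁻¹ = X * Z := by rw [h, mul_assoc X, ← hZ Y]; group
  have h2 : Y * X ^ i * Y⁻¹ = X ^ i * Z ^ i := by
    rw [← conj_zpow, h1, Commute.mul_zpow (hZ X).symm]
  have h3 : (X ^ i)⁻¹ * Y * X ^ i = Y * Z ^ i := by
    have : Y * X ^ i = X ^ i * Z ^ i * Y := by rw [← h2]; group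
    rw [mul_assoc, this, mul_assoc (X ^ i), (hZi i Y).eq]; group
  have h4 : (X ^ i)⁻¹ * Y ^ j * X ^ i = Y ^ j * Z ^ (i * j) := by
    have := conj_zpow (i := j) (a := (X ^ i)⁻¹) (b := Y)
    rw [inv_inv] at this
    rw [← this, h3, Commute.mul_zpow (hZi i Y).symm, zpow_mul]
  rw [mul_assoc, ← h4]; group

/-- `ℤ²`. -/
abbrev ZZ := Multiplicative (ℤ × ℤ)

/-- classification of cocycles on `ℤ²` -/
theorem cocycle_ZZ (σ : ZZ × ZZ → ℚ) (hσ : IsCocycle σ) :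
    ∃ (lam : ZZ → ℚ) (κ : ℚ), ∀ g h : ZZ, σ (g, h) =
      lam h - lam (g * h) + lam g + κ * ((g.toAdd.2 : ℚ) * (h.toAdd.1 : ℚ)) := by
  let _ := Ext.group σ hσ
  let pr : Ext σ →* ZZ := { toFun := Ext.g, map_one' := rfl, map_mul' := fun _ _ => rfl }
  let inc : ℚ → Ext σ := fun r => ⟨r - σ (1, 1), 1⟩
  have e1 : ∀ x : ZZ, σ (1, x) = σ (1, 1) := by
    intro x
    have := hσ 1 1 x
    simp only [one_mul] at this
    linarith
  have e2 : ∀ x : ZZ, σ (x, 1) = σ (1, 1) := by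
    intro x
    have := hσ x 1 1
    simp only [mul_one] at this
    linarith
  have hinc : ∀ r s, inc r * inc s = inc (r + s) := by
    intro r s
    apply Ext.ext'
    · simp only [inc, Ext.mul_r]; ring
    · simp only [inc, Ext.mul_g, one_mul]
  have hincr : ∀ (r : ℚ) (w : Ext σ), w * inc r = ⟨w.r + r, w.g⟩ := by
    intro r w
    apply Ext.ext'
    · simp only [inc, Ext.mul_r, e2]; ring
    · simp only [inc, Ext.mul_g, mul_one]
  have hincl : ∀ (r : ℚ) (w : Ext σ), inc r * w = w * inc r := by
    intro r w
    rw [hincr]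
    apply Ext.ext'
    · simp only [inc, Ext.mul_r, e1]; ring
    · simp only [inc, Ext.mul_g, one_mul]
  let incH : Multiplicative ℚ →* Ext σ :=
    { toFun := fun r => inc r.toAdd, map_one' := by
        apply Ext.ext'
        · simp only [inc, Ext.one_r, toAdd_one]; ring
        · rfl
      map_mul' := fun r s => (hinc _ _).symm }
  have hincz : ∀ (r : ℚ) (i : ℤ), inc r ^ i = inc (i * r) := by
    intro r i
    have := map_zpow incH (Multiplicative.ofAdd r) i
    change inc _ = inc r ^ i at this
    rw [← this]
    simp
  let X : Ext σ := ⟨0, Multiplicative.ofAdd (1, 0)⟩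
  let Y : Ext σ := ⟨0, Multiplicative.ofAdd (0, 1)⟩
  let κ : ℚ := (Y * X).r - (X * Y).r
  have hYX : Y * X = X * Y * inc κ := by
    rw [hincr]
    apply Ext.ext'
    · simp only [κ]; ring
    · simp only [Ext.mul_g]; exact mul_comm _ _
  have key := comm_pow X Y (inc κ) (hincl κ) hYX
  let s : ZZ → Ext σ := fun g => X ^ g.toAdd.1 * Y ^ g.toAdd.2
  have hsg : ∀ g, (s g).g = g := by
    intro g
    change pr (s g) = g
    simp only [s, map_mul, map_zpow]
    change (Multiplicative.ofAdd ((1 : ℤ), (0 : ℤ))) ^ _ * (Multiplicative.ofAdd ((0 : ℤ), (1 : ℤ))) ^ _ = g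
    apply Multiplicative.toAdd.injective
    rw [toAdd_mul, toAdd_zpow, toAdd_zpow, toAdd_ofAdd, toAdd_ofAdd]
    ext <;> simp
  have hss : ∀ g h, s g * s h = s (g * h) * inc (κ * (g.toAdd.2 * h.toAdd.1)) := by
    intro g h
    have k2 := key h.toAdd.1 g.toAdd.2
    have hc : ∀ (r : ℚ) (w : Ext σ), Commute (inc r) w := hincl
    rw [hincz] at k2
    simp only [s, toAdd_mul, Prod.fst_add, Prod.snd_add, zpow_add]
    calc X ^ g.toAdd.1 * Y ^ g.toAdd.2 * (X ^ h.toAdd.1 * Y ^ h.toAdd.2)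
        = X ^ g.toAdd.1 * (Y ^ g.toAdd.2 * X ^ h.toAdd.1) * Y ^ h.toAdd.2 := by group
      _ = X ^ g.toAdd.1 * X ^ h.toAdd.1 * Y ^ g.toAdd.2 *
            (inc (((h.toAdd.1 * g.toAdd.2 : ℤ) : ℚ) * κ) * Y ^ h.toAdd.2) := by rw [k2]; group
      _ = _ := by
        rw [hincl]
        have : ((h.toAdd.1 * g.toAdd.2 : ℤ) : ℚ) * κ = κ * (g.toAdd.2 * h.toAdd.1) := by
          push_cast; ring
        rw [this]; group
  refine ⟨fun g => -(s g).r, κ, fun g h => ?_⟩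
  have h1 := congrArg Ext.r (hss g h)
  rw [hincr, Ext.mul_r, hsg, hsg] at h1
  simp only at h1
  linarith

/-- The basic functional on `H₂(ℤ²)`. -/
theorem omega_ne {z : Z2 ZZ}
    (hz : (Submodule.Quotient.mk z : ↥(Z2 ZZ) ⧸ B2 ZZ) ≠ 0) :
    Finsupp.linearCombination ℚ
      (fun p : ZZ × ZZ => (p.1.toAdd.2 : ℚ) * (p.2.toAdd.1 : ℚ)) z.1 ≠ 0 := by
  intro h0
  apply hz
  rw [Submodule.Quotient.mk_eq_zero]
  by_contra hB
  have hB' : z.1 ∉ LinearMap.range (d3 ZZ) := hB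
  obtain ⟨L, hL, hLB⟩ := Submodule.exists_le_ker_of_notMem hB'
  let σ : ZZ × ZZ → ℚ := fun p => L (Finsupp.single p 1)
  have hσ : IsCocycle σ := by
    intro f g h
    have : L (d3 ZZ (Finsupp.single (f, g, h) 1)) = 0 := hLB ⟨_, rfl⟩
    simpa [d3, Finsupp.sum_single_index, σ] using this
  have hLσ : L = Finsupp.linearCombination ℚ σ := by
    apply Finsupp.lhom_ext'
    intro p
    ext
    simp [σ]
  obtain ⟨lam, κ, hlam⟩ := cocycle_ZZ σ hσ
  apply hL
  rw [hLσ]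
  have : σ = (fun p : ZZ × ZZ => lam p.2 - lam (p.1 * p.2) + lam p.1) +
      κ • (fun p : ZZ × ZZ => (p.1.toAdd.2 : ℚ) * (p.2.toAdd.1 : ℚ)) := by
    funext p
    exact hlam p.1 p.2
  rw [this, Finsupp.linearCombination_apply]
  have e1 := cobdry_eval lam z
  rw [Finsupp.linearCombination_apply] at e1 h0
  simp only [Finsupp.sum, Pi.add_apply, Pi.smul_apply, smul_add, Finset.sum_add_distrib] at e1 h0 ⊢
  simp only [smul_comm _ κ, ← Finset.smul_sum]
  rw [h0]
  simpa [smul_add, Finset.sum_add_distrib] using e1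

/-- A product cocycle on `ℤ²`. -/
theorem prod_eval {R : Type*} [CommRing R] [Algebra ℚ R] (α β : ZZ → R)
    (hα : ∀ g h, α (g * h) = α g + α h) (hβ : ∀ g h, β (g * h) = β g + β h) (z : Z2 ZZ) :
    Finsupp.linearCombination ℚ (fun p : ZZ × ZZ => α p.1 * β p.2) z.1 =
      (Finsupp.linearCombination ℚ
        (fun p : ZZ × ZZ => (p.1.toAdd.2 : ℚ) * (p.2.toAdd.1 : ℚ)) z.1) •
      (α (Multiplicative.ofAdd (0, 1)) * β (Multiplicative.ofAdd (1, 0))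
        - α (Multiplicative.ofAdd (1, 0)) * β (Multiplicative.ofAdd (0, 1))) := by
  have lin : ∀ α : ZZ → R, (∀ g h, α (g * h) = α g + α h) → ∀ g, α g =
      (g.toAdd.1 : ℚ) • α (Multiplicative.ofAdd (1, 0))
        + (g.toAdd.2 : ℚ) • α (Multiplicative.ofAdd (0, 1)) := by
    intro α hα g
    let A : ZZ →* Multiplicative R := MonoidHom.mk' (fun g => Multiplicative.ofAdd (α g))
      (fun g h => by rw [hα]; rfl)
    have hg : g = (Multiplicative.ofAdd ((1 : ℤ), (0 : ℤ))) ^ g.toAdd.1 *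
        (Multiplicative.ofAdd ((0 : ℤ), (1 : ℤ))) ^ g.toAdd.2 := by
      apply Multiplicative.toAdd.injective
      rw [toAdd_mul, toAdd_zpow, toAdd_zpow, toAdd_ofAdd, toAdd_ofAdd]
      ext <;> simp
    have := congrArg A hg
    rw [map_mul, map_zpow, map_zpow] at this
    have := congrArg Multiplicative.toAdd this
    rw [toAdd_mul, toAdd_zpow, toAdd_zpow] at this
    simp only [Int.cast_smul_eq_zsmul]
    exact this
  set α1 := α (Multiplicative.ofAdd (1, 0)) with hα1
  set α2 := α (Multiplicative.ofAdd (0, 1)) with hα2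
  set β1 := β (Multiplicative.ofAdd (1, 0)) with hβ1
  set β2 := β (Multiplicative.ofAdd (0, 1)) with hβ2
  let lam : ZZ → R := fun g =>
    (-((g.toAdd.1 : ℚ) ^ 2 / 2)) • (α1 * β1) + (-((g.toAdd.2 : ℚ) ^ 2 / 2)) • (α2 * β2)
      + (-((g.toAdd.1 : ℚ) * g.toAdd.2)) • (α1 * β2)
  have e : (fun p : ZZ × ZZ => α p.1 * β p.2) =
      fun p => (lam p.2 - lam (p.1 * p.2) + lam p.1) +
        ((p.1.toAdd.2 : ℚ) * (p.2.toAdd.1 : ℚ)) • (α2 * β1 - α1 * β2) := by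
    funext p
    rw [lin α hα p.1, lin β hβ p.2, ← hα1, ← hα2, ← hβ1, ← hβ2]
    simp only [lam, toAdd_mul, Prod.fst_add, Prod.snd_add, Int.cast_add, Algebra.smul_def,
      map_mul, map_add, map_neg, div_eq_mul_inv, map_pow]
    have h2 : algebraMap ℚ R 2⁻¹ * 2 = 1 := by
      rw [← map_ofNat (algebraMap ℚ R) 2, ← map_mul]; norm_num
    generalize algebraMap ℚ R 2⁻¹ = hf at h2
    linear_combination (-(algebraMap ℚ R p.1.toAdd.1 * algebraMap ℚ R p.2.toAdd.1 * α1 * β1) -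
      (algebraMap ℚ R p.1.toAdd.2 * algebraMap ℚ R p.2.toAdd.2 * α2 * β2)) * h2
  have e1 := cobdry_eval lam z
  rw [e]
  rw [Finsupp.linearCombination_apply] at e1 ⊢
  rw [Finsupp.linearCombination_apply]
  simp only [Finsupp.sum, smul_add] at e1 ⊢
  rw [Finset.sum_add_distrib]
  rw [e1, zero_add, Finset.sum_smul]
  simp only [smul_assoc, smul_eq_mul, mul_smul]

end GroupH2

namespace Birman

section Fox

variable {R : Type*} [CommRing R]

/-- The affine group `R ⋊ Rˣ`, written multiplicatively. -/
@[ext] structure Aff (R : Type*) [CommRing R] where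
  u : Rˣ
  r : R

namespace Aff

instance : Mul (Aff R) := ⟨fun x y => ⟨x.u * y.u, x.r + x.u * y.r⟩⟩
instance : One (Aff R) := ⟨⟨1, 0⟩⟩
instance : Inv (Aff R) := ⟨fun x => ⟨x.u⁻¹, -((x.u⁻¹ : Rˣ) * x.r)⟩⟩

theorem mul_u (x y : Aff R) : (x * y).u = x.u * y.u := rfl
theorem mul_r (x y : Aff R) : (x * y).r = x.r + x.u * y.r := rfl
theorem one_u : (1 : Aff R).u = 1 := rfl
theorem one_r : (1 : Aff R).r = 0 := rfl
theorem inv_u (x : Aff R) : (x⁻¹).u = x.u⁻¹ := rfl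
theorem inv_r (x : Aff R) : (x⁻¹).r = -((x.u⁻¹ : Rˣ) * x.r) := rfl

instance : Group (Aff R) :=
  Group.ofLeftAxioms
    (by intro x y z
        ext
        · simp only [mul_u, mul_assoc]
        · simp only [mul_u, mul_r, Units.val_mul]; ring)
    (by intro x
        ext
        · simp only [mul_u, one_u, one_mul]
        · simp only [mul_r, one_u, one_r, Units.val_one]; ring)
    (by intro x
        ext
        · simp only [mul_u, one_u, inv_u, inv_mul_cancel]
        · simp only [mul_r, one_r, inv_u, inv_r]; ring)

/-- Projection to the unit part. -/
def uHom : Aff R →* Rˣ := { toFun := Aff.u, map_one' := rfl, map_mul' := fun _ _ => rfl }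

end Aff

variable {ι : Type*}

/-- A Fox derivation over the character `π`. -/
def IsDer (π : FreeGroup ι →* Rˣ) (E : FreeGroup ι → R) : Prop :=
  ∀ g h, E (g * h) = E g + π g * E h

theorem IsDer.one {π : FreeGroup ι →* Rˣ} {E : FreeGroup ι → R} (hE : IsDer π E) : E 1 = 0 := by
  have := hE 1 1
  simpa using this

theorem IsDer.inv {π : FreeGroup ι →* Rˣ} {E : FreeGroup ι → R} (hE : IsDer π E)
    (g : FreeGroup ι) : E g⁻¹ = -((π g⁻¹ : Rˣ) * E g) := by
  have := hE g⁻¹ g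
  rw [inv_mul_cancel, hE.one] at this
  linear_combination -this

theorem IsDer.conj {π : FreeGroup ι →* Rˣ} {E : FreeGroup ι → R} (hE : IsDer π E)
    (g h : FreeGroup ι) : E (g * h * g⁻¹) = (1 - π h) * E g + π g * E h := by
  have : ((π g : Rˣ) : R) * ((π g)⁻¹ : Rˣ) = 1 := by simp
  rw [hE, hE, hE.inv, map_mul, map_inv, Units.val_mul]
  linear_combination (-(π h : R) * E g) * this

theorem IsDer.ext {π : FreeGroup ι →* Rˣ} {E E' : FreeGroup ι → R} (hE : IsDer π E)
    (hE' : IsDer π E') (h : ∀ i, E (.of i) = E' (.of i)) (w : FreeGroup ι) : E w = E' w := by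
  induction w using FreeGroup.induction_on with
  | C1 => rw [hE.one, hE'.one]
  | of i => exact h i
  | inv_of i hi => rw [hE.inv, hE'.inv, hi]
  | mul x y hx hy => rw [hE, hE', hx, hy]

open Classical in
/-- The Fox derivative `∂/∂y` as a homomorphism to the affine group. -/
noncomputable def foxHom (p : ι → Rˣ) (y : ι) : FreeGroup ι →* Aff R :=
  FreeGroup.lift fun i => ⟨p i, if i = y then 1 else 0⟩

/-- The Fox derivative. -/
noncomputable def fox (p : ι → Rˣ) (y : ι) (w : FreeGroup ι) : R := (foxHom p y w).r

theorem foxHom_u (p : ι → Rˣ) (y : ι) (w : FreeGroup ι) :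
    (foxHom p y w).u = FreeGroup.lift p w := by
  have : Aff.uHom.comp (foxHom p y) = FreeGroup.lift p := by
    ext i
    simp [foxHom, Aff.uHom]
  rw [← this]; rfl

theorem fox_der (p : ι → Rˣ) (y : ι) : IsDer (FreeGroup.lift p) (fox p y) := by
  intro g h
  rw [fox, map_mul, Aff.mul_r, foxHom_u]
  rfl

theorem fox_self (p : ι → Rˣ) (y : ι) : fox p y (.of y) = 1 := by simp [fox, foxHom]
theorem fox_ne (p : ι → Rˣ) (y i : ι) (h : i ≠ y) : fox p y (.of i) = 0 := by
  simp [fox, foxHom, h]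

end Fox

section KK

variable {R : Type*} [CommRing R] {n k l : ℕ}

/-- The section of `proj`. -/
def sec (n k l : ℕ) : FG n 0 l →* FG n k l :=
  FreeGroup.lift fun g => match g with
    | Sum.inl i => FreeGroup.of (Sum.inl i)
    | Sum.inr (Sum.inl j) => j.elim0
    | Sum.inr (Sum.inr m) => FreeGroup.of (Sum.inr (Sum.inr m))

theorem pi_sec (p : Gen n k l → Rˣ) (hp : ∀ j, p (yg n k l j) = 1) (w : FG n k l) :
    FreeGroup.lift p (sec n k l (proj n k l w)) = FreeGroup.lift p w := by
  have : ((FreeGroup.lift p).comp (sec n k l)).comp (proj n k l) = FreeGroup.lift p := by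
    ext i
    rcases i with i | j | m
    · simp [sec, proj]
    · have := hp j
      rw [yg] at this
      simp [proj, this]
    · simp [sec, proj]
  exact DFunLike.congr_fun this w

theorem pi_K (p : Gen n k l → Rˣ) (hp : ∀ j, p (yg n k l j) = 1) (f : K n k l) (w : FG n k l) :
    FreeGroup.lift p (f.1 w) = FreeGroup.lift p w := by
  rw [← pi_sec p hp (f.1 w), f.2.2 w, pi_sec p hp]

theorem der_sec (p : Gen n k l → Rˣ) (hp : ∀ j, p (yg n k l j) = 1) (E : FG n k l → R)
    (hE : IsDer (FreeGroup.lift p) E) (hy : ∀ j, E (.of (yg n k l j)) = 0) (w : FG n k l) :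
    E (sec n k l (proj n k l w)) = E w := by
  refine IsDer.ext (π := FreeGroup.lift p) (E := fun w => E (sec n k l (proj n k l w))) ?_ hE ?_ w
  · intro g h
    simp only [map_mul]
    rw [hE, pi_sec p hp]
  · intro i
    rcases i with i | j | m
    · simp [sec, proj]
    · have := hy j
      rw [yg] at this
      simp [proj, this, hE.one]
    · simp [sec, proj]

/-- chain rule -/
theorem fox_chain (p : Gen n k l → Rˣ) (hp : ∀ j, p (yg n k l j) = 1) (y : Fin k)
    (f h : K n k l) (w : FG n k l) :
    fox p (yg n k l y) (f.1 (h.1 w)) =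
      fox p (yg n k l y) (f.1 w) + fox p (yg n k l y) (f.1 (.of (yg n k l y))) *
        (fox p (yg n k l y) (h.1 w) - fox p (yg n k l y) w) := by
  set D := fox p (yg n k l y) with hD
  have dD : IsDer (FreeGroup.lift p) D := fox_der _ _
  set q := D (f.1 (.of (yg n k l y)))
  let E : FG n k l → R := fun w => D (f.1 w) - q * D w
  have hE : IsDer (FreeGroup.lift p) E := by
    intro g h
    simp only [E, map_mul]
    rw [dD, dD, pi_K p hp]
    ring
  have hy : ∀ j, E (.of (yg n k l j)) = 0 := by
    intro j
    by_cases hj : yg n k l j = yg n k l y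
    · rw [hj]
      simp only [E]
      rw [hD, fox_self]
      simp only [q, hD]; ring
    · simp only [E]
      obtain ⟨g, hg⟩ := isConj_iff.1 (f.2.1 (Sum.inl j))
      change g * .of (yg n k l j) * g⁻¹ = f.1 (.of (yg n k l j)) at hg
      rw [← hg, dD.conj, FreeGroup.lift_apply_of, hp, hD, fox_ne _ _ _ hj]
      simp
  have h1 := der_sec p hp E hE hy w
  have h2 := der_sec p hp E hE hy (h.1 w)
  rw [h.2.2 w, h1] at h2
  simp only [E] at h2
  linear_combination -h2

theorem q_eq (p : Gen n k l → Rˣ) (hp : ∀ j, p (yg n k l j) = 1) (y : Fin k)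
    (f : K n k l) : ∃ g : FG n k l, ∀ p : Gen n k l → Rˣ, (∀ j, p (yg n k l j) = 1) →
      fox p (yg n k l y) (f.1 (.of (yg n k l y))) = FreeGroup.lift p g := by
  obtain ⟨g, hg⟩ := isConj_iff.1 (f.2.1 (Sum.inl y))
  change g * .of (yg n k l y) * g⁻¹ = f.1 (.of (yg n k l y)) at hg
  refine ⟨g, fun p hp => ?_⟩
  rw [← hg, (fox_der _ _).conj, FreeGroup.lift_apply_of, hp, fox_self]
  simp

theorem q_inv (p : Gen n k l → Rˣ) (hp : ∀ j, p (yg n k l j) = 1) (y : Fin k)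
    (f : K n k l) : fox p (yg n k l y) (f.1 (.of (yg n k l y))) *
      fox p⁻¹ (yg n k l y) (f.1 (.of (yg n k l y))) = 1 := by
  obtain ⟨g, hg⟩ := q_eq p hp y f
  rw [hg p hp, hg p⁻¹ (by intro j; simp [hp j])]
  have : FreeGroup.lift p⁻¹ g = (FreeGroup.lift p g)⁻¹ := by
    have : FreeGroup.lift p⁻¹ = (FreeGroup.lift p)⁻¹ := by ext i; simp
    rw [this]; rfl
  rw [this]
  simp

open GroupH2

/-- The cup product cocycle. -/
noncomputable def cup (p : Gen n k l → Rˣ) (y : Fin k) (a b : Gen n k l) :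
    K n k l × K n k l → R := fun x =>
  fox p (yg n k l y) (x.1.1 (.of a)) * (fox p⁻¹ (yg n k l y) (x.1.1 (.of (yg n k l y))) *
    fox p⁻¹ (yg n k l y) (x.2.1 (.of b)))

theorem cup_cocycle (p : Gen n k l → Rˣ) (hp : ∀ j, p (yg n k l j) = 1) (y : Fin k)
    (a b : Gen n k l) (ha : a ≠ yg n k l y) (hb : b ≠ yg n k l y) :
    IsCocycle (cup p y a b) := by
  intro f g h
  have hp' : ∀ j, p⁻¹ (yg n k l j) = 1 := by intro j; simp [hp j]
  simp only [cup, Subgroup.coe_mul, MulAut.mul_apply]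
  have e1 := fox_chain p hp y f g (.of a)
  have e2 := fox_chain p⁻¹ hp' y g h (.of b)
  have e3 := fox_chain p⁻¹ hp' y f g (.of (yg n k l y))
  rw [fox_ne _ _ _ ha, sub_zero] at e1
  rw [fox_ne _ _ _ hb, sub_zero] at e2
  rw [fox_self] at e3
  rw [e1, e2, e3]
  have := q_inv p hp y f
  set q := fox p (yg n k l y) (f.1 (.of (yg n k l y)))
  set q' := fox p⁻¹ (yg n k l y) (f.1 (.of (yg n k l y)))
  linear_combination (-(fox p (yg n k l y) (g.1 (.of a)) *
    fox p⁻¹ (yg n k l y) (g.1 (.of (yg n k l y))) * fox p⁻¹ (yg n k l y) (h.1 (.of b)))) * this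

end KK

open GroupH2

theorem eval_phi {R : Type*} [CommRing R] [Algebra ℚ R] {n k l : ℕ}
    (p : Gen n k l → Rˣ) (hp : ∀ j, p (yg n k l j) = 1) (y : Fin k)
    (a b : Gen n k l) (ha : a ≠ yg n k l y) (hb : b ≠ yg n k l y)
    (φ : ZZ →* K n k l) (U V : K n k l) (hU : φ (Multiplicative.ofAdd (1, 0)) = U)
    (hV : φ (Multiplicative.ofAdd (0, 1)) = V)
    (hUy : U.1 (.of (yg n k l y)) = .of (yg n k l y))
    (hVy : V.1 (.of (yg n k l y)) = .of (yg n k l y)) (z : Z2 ZZ) :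
    ev (cup p y a b) (cup_cocycle p hp y a b ha hb)
      (H2map φ (Submodule.Quotient.mk z : ↥(Z2 ZZ) ⧸ B2 ZZ)) =
    (Finsupp.linearCombination ℚ
        (fun p : ZZ × ZZ => (p.1.toAdd.2 : ℚ) * (p.2.toAdd.1 : ℚ)) z.1) •
      (fox p (yg n k l y) (V.1 (.of a)) * fox p⁻¹ (yg n k l y) (U.1 (.of b)) -
       fox p (yg n k l y) (U.1 (.of a)) * fox p⁻¹ (yg n k l y) (V.1 (.of b))) := by
  have hp' : ∀ j, p⁻¹ (yg n k l j) = 1 := by intro j; simp [hp j]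
  have hfix : ∀ g : ZZ, (φ g).1 (.of (yg n k l y)) = .of (yg n k l y) := by
    intro g
    let S : Subgroup (MulAut (FG n k l)) := MulAction.stabilizer _ (FreeGroup.of (yg n k l y))
    have hUS : U.1 ∈ S := hUy
    have hVS : V.1 ∈ S := hVy
    have hg : g = (Multiplicative.ofAdd ((1 : ℤ), (0 : ℤ))) ^ g.toAdd.1 *
        (Multiplicative.ofAdd ((0 : ℤ), (1 : ℤ))) ^ g.toAdd.2 := by
      apply Multiplicative.toAdd.injective
      rw [toAdd_mul, toAdd_zpow, toAdd_zpow, toAdd_ofAdd, toAdd_ofAdd]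
      ext <;> simp
    have : (φ g).1 ∈ S := by
      rw [hg, map_mul, map_zpow, map_zpow, hU, hV]
      exact S.mul_mem (S.zpow_mem hUS _) (S.zpow_mem hVS _)
    exact this
  rw [ev_map]
  subst hU hV
  rw [← prod_eval (fun g => fox p (yg n k l y) ((φ g).1 (.of a)))
    (fun g => fox p⁻¹ (yg n k l y) ((φ g).1 (.of b)))]
  · congr 2
    funext x
    simp only [cup]
    rw [hfix, fox_self, one_mul]
  · intro g h
    rw [map_mul, Subgroup.coe_mul, MulAut.mul_apply, fox_chain p hp, hfix, fox_self,
      fox_ne _ _ _ ha]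
    ring
  · intro g h
    rw [map_mul, Subgroup.coe_mul, MulAut.mul_apply, fox_chain p⁻¹ hp', hfix, fox_self,
      fox_ne _ _ _ hb]
    ring

theorem conj_pow_apply {n k l : ℕ} (f : MulAut (FG n k l)) (v w : Gen n k l) (hvw : w ≠ v)
    (hf : IsConjGen f v w) (m : ℕ) :
    (f ^ m) (.of v) = FreeGroup.of w ^ m * .of v * (FreeGroup.of w ^ m)⁻¹ ∧
      ∀ u : Gen n k l, u ≠ v → (f ^ m) (.of u) = .of u := by
  induction m with
  | zero => simp
  | succ m ih =>
    refine ⟨?_, fun u hu => ?_⟩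
    · rw [pow_succ, MulAut.mul_apply, hf.1, map_mul, map_mul, map_inv, ih.1, ih.2 w hvw, pow_succ']
      group
    · rw [pow_succ, MulAut.mul_apply, hf.2 u hu, ih.2 u hu]

theorem exists_field : ∃ (R : Type) (_ : Field R) (_ : Algebra ℚ R) (t : R), t ≠ 0 ∧
    LinearIndependent ℚ (fun m : ℕ => t ^ (m + 1)) := by
  let alg : Algebra ℚ (RatFunc ℚ) := RatFunc.instAlgebraOfPolynomial ℚ ℚ
  refine ⟨RatFunc ℚ, inferInstance, alg, RatFunc.X, RatFunc.X_ne_zero, ?_⟩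
  have h1 : LinearIndependent ℚ (fun m : ℕ => (Polynomial.X : Polynomial ℚ) ^ m) := by
    have := (Polynomial.basisMonomials ℚ).linearIndependent
    convert this using 2 with m
    simp [Polynomial.X_pow_eq_monomial]
  have h2 := h1.comp (fun m : ℕ => m + 1) (add_left_injective 1)
  have h3 := h2.map' (IsScalarTower.toAlgHom ℚ (Polynomial ℚ) (RatFunc ℚ)).toLinearMap
    (LinearMap.ker_eq_bot.2 (RatFunc.algebraMap_injective ℚ))
  have e : (⇑(IsScalarTower.toAlgHom ℚ (Polynomial ℚ) (RatFunc ℚ)).toLinearMap ∘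
      (fun m => Polynomial.X ^ m) ∘ fun m => m + 1) =
      fun m : ℕ => (RatFunc.X : RatFunc ℚ) ^ (m + 1) := by
    funext m
    simp
  rw [e] at h3
  exact h3

/-- **Linear independence of the abelian cycles `μ_m`.**  Suppose `k ≥ 1` and `n + l ≥ 2`; fix
`y ∈ Y` and distinct `a, b ∈ X ∪ Z`.  For `m ≥ 1` let `φ_m : ℤ² → K_{n,k,l}` be the
homomorphism sending `(1,0)` to `C_{y,a}^m C_{b,y} C_{y,a}^{-m}` and `(0,1)` to
`C_{a,y} C_{b,y}` (these elements commute).  Then for every nonzero `c ∈ H₂(ℤ²; ℚ)`, the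
abelian cycles `μ_m = (φ_m)_*(c) ∈ H₂(K_{n,k,l}; ℚ)`, `m ≥ 1`, are linearly independent
over `ℚ`.  (Here the family is indexed by `m - 1 ∈ ℕ`.) -/
theorem abelian_cycles_linearly_independent (n k l : ℕ) (hk : 1 ≤ k) (hnl : 2 ≤ n + l)
    (y : Fin k) (a b : Fin n ⊕ Fin l) (hab : a ≠ b)
    (Cya Cby Cay : MulAut (FG n k l))
    (hCya : IsConjGen Cya (yg n k l y) (xzg n k l a))
    (hCby : IsConjGen Cby (xzg n k l b) (yg n k l y))
    (hCay : IsConjGen Cay (xzg n k l a) (yg n k l y))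
    (u : ℕ → ↥(K n k l)) (v : ↥(K n k l))
    (hu : ∀ m : ℕ, (u m : MulAut (FG n k l)) = Cya ^ (m + 1) * Cby * (Cya ^ (m + 1))⁻¹)
    (hv : (v : MulAut (FG n k l)) = Cay * Cby)
    (φ : ℕ → (Multiplicative (ℤ × ℤ) →* ↥(K n k l)))
    (hφ : ∀ m : ℕ, φ m (Multiplicative.ofAdd (1, 0)) = u m ∧
                   φ m (Multiplicative.ofAdd (0, 1)) = v)
    (c : H2 (Multiplicative (ℤ × ℤ))) (hc : c ≠ 0) :
    LinearIndependent ℚ (fun m : ℕ => H2map (φ m) c) := by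
  set Y := yg n k l y with hY
  set a' := xzg n k l a with ha'
  set b' := xzg n k l b with hb'
  have hay : a' ≠ Y := by rcases a with a | a <;> simp [ha', hY, xzg, yg]
  have hby : b' ≠ Y := by rcases b with b | b <;> simp [hb', hY, xzg, yg]
  have hab' : a' ≠ b' := by
    rcases a with a | a <;> rcases b with b | b <;> simp_all [xzg]
  have hyj : ∀ j, yg n k l j ≠ a' ∧ yg n k l j ≠ b' := by
    intro j
    rcases a with a | a <;> rcases b with b | b <;> simp [ha', hb', xzg, yg]
  classical
  obtain ⟨R, _, _, T, hT0, hT⟩ := exists_field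
  let t : Rˣ := Units.mk0 T hT0
  let p : Gen n k l → Rˣ := fun g => if g = a' then t⁻¹ else if g = b' then -1 else 1
  have hp : ∀ j, p (yg n k l j) = 1 := by
    intro j
    simp [p, (hyj j).1, (hyj j).2]
  have hpY : p Y = 1 := hp y
  have hpa : p a' = t⁻¹ := by simp [p]
  have hpb : p b' = -1 := by simp [p, hab'.symm]
  have powY := fun m => conj_pow_apply Cya Y a' hay hCya m
  have invFix : ∀ m (g : Gen n k l), g ≠ Y → (Cya ^ m)⁻¹ (.of g) = .of g := by
    intro m g hg
    rw [MulAut.inv_apply, MulEquiv.symm_apply_eq, (powY m).2 g hg]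
  have invY : ∀ m, (Cya ^ m)⁻¹ (.of Y) =
      (FreeGroup.of a' ^ m)⁻¹ * .of Y * FreeGroup.of a' ^ m := by
    intro m
    rw [MulAut.inv_apply, MulEquiv.symm_apply_eq, map_mul, map_mul, map_inv, map_pow,
      (powY m).2 a' hay, (powY m).1]
    group
  have uY : ∀ m, (u m).1 (.of Y) = .of Y := by
    intro m
    rw [hu, MulAut.mul_apply, MulAut.mul_apply, invY]
    simp only [map_mul, map_inv, map_pow]
    rw [hCby.2 _ hby.symm, hCby.2 _ hab', (powY _).1, (powY _).2 _ hay]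
    group
  have ua : ∀ m, (u m).1 (.of a') = .of a' := by
    intro m
    rw [hu, MulAut.mul_apply, MulAut.mul_apply, invFix _ _ hay, hCby.2 _ hab', (powY _).2 _ hay]
  have ub : ∀ m, (u m).1 (.of b') =
      (FreeGroup.of a' ^ (m + 1) * .of Y * (FreeGroup.of a' ^ (m + 1))⁻¹) * .of b' *
      (FreeGroup.of a' ^ (m + 1) * .of Y * (FreeGroup.of a' ^ (m + 1))⁻¹)⁻¹ := by
    intro m
    rw [hu, MulAut.mul_apply, MulAut.mul_apply, invFix _ _ hby, hCby.1, map_mul, map_mul, map_inv,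
      (powY _).1, (powY _).2 _ hby]
  have vY : v.1 (.of Y) = .of Y := by
    rw [hv, MulAut.mul_apply, hCby.2 _ hby.symm, hCay.2 _ hay.symm]
  have va : v.1 (.of a') = .of Y * .of a' * (.of Y)⁻¹ := by
    rw [hv, MulAut.mul_apply, hCby.2 _ hab', hCay.1]
  obtain ⟨z, rfl⟩ : ∃ z : Z2 ZZ, (Submodule.Quotient.mk z : ↥(Z2 ZZ) ⧸ B2 ZZ) = c :=
    Submodule.Quotient.mk_surjective _ c
  have hω := omega_ne hc
  set ω := Finsupp.linearCombination ℚ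
    (fun p : ZZ × ZZ => (p.1.toAdd.2 : ℚ) * (p.2.toAdd.1 : ℚ)) z.1 with hωd
  apply LinearIndependent.of_comp (ev (cup p y a' b') (cup_cocycle p hp y a' b' hay hby))
  have tx : (t : R) = T := rfl
  have hval : (⇑(ev (cup p y a' b') (cup_cocycle p hp y a' b' hay hby)) ∘
      fun m : ℕ => H2map (φ m) (Submodule.Quotient.mk z : ↥(Z2 ZZ) ⧸ B2 ZZ)) =
      fun m : ℕ => LinearMap.mulLeft ℚ (ω • ((1 - T⁻¹) * 2))
        (T ^ (m + 1)) := by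
    funext m
    have hE := eval_phi p hp y a' b' hay hby (φ m) (u m) v (hφ m).1 (hφ m).2 (uY m) vY z
    refine hE.trans ?_
    rw [← hωd, ← hY, va, ua, ub, (fox_der p Y).conj, (fox_der p⁻¹ Y).conj, (fox_der p⁻¹ Y).conj,
      fox_self, fox_self, fox_ne _ _ _ hay, fox_ne _ _ _ hby]
    simp only [FreeGroup.lift_apply_of, map_mul, map_pow, map_inv, Pi.inv_apply, hpY, hpa, hpb,
      LinearMap.mulLeft_apply, inv_one, Units.val_one, inv_inv, Units.val_pow_eq_pow_val, tx,
      Units.val_inv_eq_inv_val, inv_neg, Units.val_neg, smul_mul_assoc]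
    congr 1
    ring
  rw [hval]
  refine hT.map' _ (LinearMap.ker_eq_bot.2 ?_)
  apply mul_right_injective₀
  have hT1 : T ≠ 1 := by
    rintro rfl
    have := hT.injective (a₁ := 0) (a₂ := 1) (by simp)
    exact absurd this (by norm_num)
  have h2 : (2 : R) ≠ 0 := by
    have := algebraRat.charZero R
    exact two_ne_zero
  refine smul_ne_zero hω (mul_ne_zero ?_ h2)
  intro h0
  rw [sub_eq_zero] at h0
  exact hT1 (inv_eq_one.1 h0.symm)

end Birman
end

section
/- If n = 0, k ≥ 1 and l ≥ 0, then the abelianization H_1(K_{0,k,l}; ℤ) of K_{0,k,l} is a free abelian group of rank 2kl + k(k−1), i.e. isomorphic to ℤ^{2kl + k(k−1)}. -/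
namespace BirmanAux
set_option linter.unusedSectionVars false
set_option linter.unusedSimpArgs false
section Generic
variable {α : Type*} [DecidableEq α]

/-- the endomorphism `a ↦ w a w⁻¹` -/
def conjHom (a : α) (w : FreeGroup α) : FreeGroup α →* FreeGroup α :=
  FreeGroup.lift fun x => if x = a then w * FreeGroup.of x * w⁻¹ else FreeGroup.of x

lemma conjHom_of (a : α) (w : FreeGroup α) (x : α) : conjHom a w (FreeGroup.of x) =
    if x = a then w * FreeGroup.of x * w⁻¹ else FreeGroup.of x := by
  simp [conjHom]

/-- the automorphism `C_{a,b}` -/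
def C (a b : α) : MulAut (FreeGroup α) :=
  MonoidHom.toMulEquiv (conjHom a (FreeGroup.of b)) (conjHom a (FreeGroup.of b)⁻¹)
    (by
      apply FreeGroup.ext_hom
      intro x
      by_cases h : x = a <;> by_cases h' : b = a <;> simp [conjHom_of, h, h', mul_assoc])
    (by
      apply FreeGroup.ext_hom
      intro x
      by_cases h : x = a <;> by_cases h' : b = a <;> simp [conjHom_of, h, h', mul_assoc])

lemma C_of (a b x : α) : C a b (FreeGroup.of x) =
    if x = a then FreeGroup.of b * FreeGroup.of x * (FreeGroup.of b)⁻¹ else FreeGroup.of x :=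
  conjHom_of _ _ _

lemma Cinv_of (a b x : α) : (C a b)⁻¹ (FreeGroup.of x) =
    if x = a then (FreeGroup.of b)⁻¹ * FreeGroup.of x * (FreeGroup.of b) else FreeGroup.of x := by
  have := conjHom_of a (FreeGroup.of b)⁻¹ x
  rw [inv_inv] at this
  exact this

lemma aut_ext {f g : MulAut (FreeGroup α)} (h : ∀ x, f (FreeGroup.of x) = g (FreeGroup.of x)) :
    f = g := by
  have : f.toMonoidHom = g.toMonoidHom := FreeGroup.ext_hom _ _ h
  ext w
  exact DFunLike.congr_fun this w

lemma C_comm {a b c d : α} (h1 : a ≠ c) (h2 : a ≠ d) (h3 : c ≠ b) : Commute (C a b) (C c d) := by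
  apply aut_ext
  intro x
  simp only [MulAut.mul_apply, C_of]
  by_cases hx : x = a
  · subst hx
    simp [C_of, h1, h3.symm]
  · by_cases hx' : x = c
    · subst hx'
      simp [C_of, hx, h2.symm]
    · simp [C_of, hx, hx']

lemma C_rel {a b c : α} (h1 : a ≠ b) (h2 : a ≠ c) (h3 : b ≠ c) :
    Commute (C a c * C b c) (C a b) := by
  apply aut_ext
  intro x
  by_cases hx : x = a
  · subst hx
    simp [C_of, h1, h2, h3, h1.symm, h2.symm, h3.symm, mul_assoc]
  · by_cases hx' : x = b
    · subst hx'
      simp [C_of, hx, h2.symm, h3.symm, Ne.symm hx]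
    · simp [C_of, hx, hx']

/-- The set S. -/
def genS (P : α → Prop) : Set (MulAut (FreeGroup α)) :=
  {f | ∃ a b, a ≠ b ∧ (P a ∨ P b) ∧ f = C a b}

/-- The set T. -/
def genT (P : α → Prop) : Set (MulAut (FreeGroup α)) :=
  {f | ∃ a b, a ≠ b ∧ ¬ P a ∧ ¬ P b ∧ f = C a b}

lemma conj_eq_of_commute {G : Type*} [Group G] {c d s : G} (h : Commute (c * d) s) (h' : Commute c d) :
    c * s * c⁻¹ = d⁻¹ * s * d ∧ c⁻¹ * s * c = d * s * d⁻¹ := by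
  have h1 : c * d * s = s * (c * d) := h
  have h2 : c * d = d * c := h'
  constructor
  · rw [mul_inv_eq_iff_eq_mul, mul_assoc, mul_assoc, eq_inv_mul_iff_mul_eq, ← h2, ← h1, h2, mul_assoc]
  · rw [eq_mul_inv_iff_mul_eq, mul_assoc, mul_assoc, inv_mul_eq_iff_eq_mul, ← h1, mul_assoc]

lemma conj_mem (P : α → Prop) (a b : α) (hab : a ≠ b) (ha : ¬ P a) (hb : ¬ P b)
    (s : MulAut (FreeGroup α)) (hs : s ∈ genS P) :
    C a b * s * (C a b)⁻¹ ∈ Subgroup.closure (genS P) ∧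
    (C a b)⁻¹ * s * C a b ∈ Subgroup.closure (genS P) := by
  obtain ⟨u, v, huv, hP, rfl⟩ := hs
  have mem : ∀ {u v : α}, u ≠ v → (P u ∨ P v) → C u v ∈ Subgroup.closure (genS P) :=
    fun h h' => Subgroup.subset_closure ⟨_, _, h, h', rfl⟩
  have hcomm : ∀ {s t}, Commute s t → t ∈ Subgroup.closure (genS P) →
      s * t * s⁻¹ ∈ Subgroup.closure (genS P) ∧ s⁻¹ * t * s ∈ Subgroup.closure (genS P) := by
    intro s t h ht
    constructor
    · rwa [h.eq, mul_inv_cancel_right]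
    · rwa [mul_assoc, ← h.eq, inv_mul_cancel_left]
  have hconj : ∀ {s t d}, Commute (s * d) t → Commute s d → t ∈ Subgroup.closure (genS P) →
      d ∈ Subgroup.closure (genS P) →
      s * t * s⁻¹ ∈ Subgroup.closure (genS P) ∧ s⁻¹ * t * s ∈ Subgroup.closure (genS P) := by
    intro s t d h h' ht hd
    obtain ⟨e1, e2⟩ := conj_eq_of_commute h h'
    rw [e1, e2]
    exact ⟨mul_mem (mul_mem (inv_mem hd) ht) hd, mul_mem (mul_mem hd ht) (inv_mem hd)⟩
  have h0 := mem huv hP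
  by_cases hu : P u
  · have hua : a ≠ u := by rintro rfl; exact ha hu
    have hub : b ≠ u := by rintro rfl; exact hb hu
    by_cases hva : v = a
    · subst hva
      refine hconj (d := C u b) ?_ ?_ h0 (mem hub.symm (Or.inl hu))
      · have h1 := C_rel hua.symm hub.symm hab
        have h2 : Commute (C v b) (C u b) := C_comm hua hab hub.symm
        rw [h2.eq]; exact h1
      · exact C_comm hua hab hub.symm
    · exact hcomm (C_comm hua (Ne.symm hva) hub.symm) h0
  · have hv : P v := by tauto
    have hva : a ≠ v := by rintro rfl; exact ha hv
    have hvb : b ≠ v := by rintro rfl; exact hb hv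
    have key : C a b * C a v * (C a b)⁻¹ ∈ Subgroup.closure (genS P) ∧
        (C a b)⁻¹ * C a v * C a b ∈ Subgroup.closure (genS P) :=
      hconj (d := C v b) (C_rel hva hab hvb.symm) (C_comm hva hab hvb.symm)
        (mem hva (Or.inr hv)) (mem hvb.symm (Or.inl hv))
    by_cases hua : u = a
    · subst hua
      exact key
    · by_cases hub : u = b
      · subst hub
        have h1 : Commute (C a v * C u v) (C a u) := C_rel hab hva hvb
        have hm := mul_mem (mem hva (Or.inr hv)) h0
        obtain ⟨q1, q2⟩ := hcomm h1.symm hm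
        constructor
        · have := mul_mem (inv_mem key.1) q1
          convert this using 1
          group
        · have := mul_mem (inv_mem key.2) q2
          convert this using 1
          group
      · exact hcomm (C_comm (Ne.symm hua) hva hub) h0

lemma T_le_normalizer (P : α → Prop) :
    Subgroup.closure (genT P) ≤ Subgroup.normalizer (Subgroup.closure (genS P) : Set _) := by
  rw [Subgroup.closure_le]
  rintro _ ⟨a, b, hab, ha, hb, rfl⟩
  have h1 : ∀ h ∈ Subgroup.closure (genS P), C a b * h * (C a b)⁻¹ ∈ Subgroup.closure (genS P) := by
    intro h hh
    have : Subgroup.closure (genS P) ≤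
      (Subgroup.closure (genS P)).comap (MulAut.conj (C a b)).toMonoidHom := by
      rw [Subgroup.closure_le]
      intro s hs
      exact (conj_mem P a b hab ha hb s hs).1
    exact this hh
  have h2 : ∀ h ∈ Subgroup.closure (genS P), (C a b)⁻¹ * h * (C a b) ∈ Subgroup.closure (genS P) := by
    intro h hh
    have : Subgroup.closure (genS P) ≤
      (Subgroup.closure (genS P)).comap (MulAut.conj (C a b)⁻¹).toMonoidHom := by
      rw [Subgroup.closure_le]
      intro s hs
      simpa using (conj_mem P a b hab ha hb s hs).2
    simpa using this hh
  rw [SetLike.mem_coe, Subgroup.mem_normalizer_iff]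
  intro h
  refine ⟨h1 h, fun hh => ?_⟩
  have := h2 _ hh
  convert this using 1
  group

end Generic
end BirmanAux

namespace BirmanAux
section Red
variable {α : Type*} [DecidableEq α]
open FreeGroup hiding map_mul map_inv map_one
set_option linter.unusedSectionVars false
set_option linter.unusedSimpArgs false

/-- index of head is not `i` -/
def NoHead (i : α) (L : List (α × Bool)) : Prop := ∀ p ∈ L.head?, p.1 ≠ i

lemma isReduced_cons_of_noHead {i : α} {e : Bool} {L : List (α × Bool)} (hL : FreeGroup.IsReduced L)
    (h : NoHead i L) : FreeGroup.IsReduced ((i, e) :: L) := by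
  cases L with
  | nil => exact FreeGroup.IsReduced.singleton
  | cons p L =>
    rw [isReduced_cons_cons]
    refine ⟨fun h' => absurd h'.symm (h p (by simp)), hL⟩

lemma toWord_mk_of_isReduced {L : List (α × Bool)} (h : FreeGroup.IsReduced L) : (FreeGroup.mk L).toWord = L := by
  rw [toWord_mk, h.reduce_eq]

lemma isReduced_invRev {L : List (α × Bool)} (h : FreeGroup.IsReduced L) : FreeGroup.IsReduced (invRev L) := by
  rw [isReduced_iff_reduce_eq] at h ⊢
  rw [reduce_invRev, h]

/-- common prefix decomposition -/
lemma common_prefix (p q : List (α × Bool)) : ∃ c p' q', p = c ++ p' ∧ q = c ++ q' ∧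
    ∀ a ∈ p'.head?, ∀ b ∈ q'.head?, a ≠ b := by
  induction p generalizing q with
  | nil => exact ⟨[], [], q, by simp⟩
  | cons a p ih =>
    cases q with
    | nil => exact ⟨[], a :: p, [], by simp⟩
    | cons b q =>
      by_cases h : a = b
      · subst h
        obtain ⟨c, p', q', h1, h2, h3⟩ := ih q
        exact ⟨a :: c, p', q', by simp [h1], by simp [h2], h3⟩
      · exact ⟨[], a :: p, b :: q, by simp, by simp, by simpa using h⟩

lemma invRev_getLast? (L : List (α × Bool)) (x : α × Bool) (hx : x ∈ (invRev L).getLast?) :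
    (x.1, !x.2) ∈ L.head? := by
  cases L with
  | nil => simp [invRev] at hx
  | cons a L =>
    simp [invRev] at hx
    simp [← hx]

lemma invRev_head? (L : List (α × Bool)) (x : α × Bool) (hx : x ∈ (invRev L).head?) :
    (x.1, !x.2) ∈ L.getLast? := by
  have := invRev_getLast? (invRev L) (x.1, !x.2)
  simp only [invRev_invRev, Bool.not_not] at this
  rw [Option.mem_def] at hx ⊢
  rcases List.eq_nil_or_concat L with rfl | ⟨L', a, rfl⟩
  · simp [invRev] at hx
  · simp [invRev] at hx
    simp [← hx]

lemma key (g h : FreeGroup α) (i : α) (hg : ∀ p ∈ g.toWord.getLast?, p.1 ≠ i)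
    (hh : ∀ (e : Bool) r, h.toWord ≠ g.toWord ++ (i, e) :: r) :
    NoHead i (g⁻¹ * h).toWord := by
  obtain ⟨c, p, q, h1, h2, h3⟩ := common_prefix g.toWord h.toWord
  have hp : FreeGroup.IsReduced p := (isReduced_toWord (x := g)).infix ⟨c, [], by simp [h1]⟩
  have hq : FreeGroup.IsReduced q := (isReduced_toWord (x := h)).infix ⟨c, [], by simp [h2]⟩
  have hred : FreeGroup.IsReduced (invRev p ++ q) := by
    rw [FreeGroup.IsReduced, List.isChain_append]
    refine ⟨isReduced_invRev hp, hq, ?_⟩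
    intro x hx y hy hxy
    have := h3 _ (invRev_getLast? _ _ hx) _ hy
    obtain ⟨x1, x2⟩ := x
    obtain ⟨y1, y2⟩ := y
    simp at hxy
    subst hxy
    cases x2 <;> cases y2 <;> simp_all
  have e : g⁻¹ * h = FreeGroup.mk (invRev p ++ q) := by
    rw [← mk_toWord (x := g), ← mk_toWord (x := h), h1, h2, ← mul_mk, ← mul_mk, ← mul_mk, ← inv_mk]
    group
  rw [e, toWord_mk_of_isReduced hred]
  intro x hx hxi
  by_cases hpn : p = []
  · subst hpn
    simp [invRev] at hx
    simp at h1
    cases q with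
    | nil => simp at hx
    | cons y q =>
      simp at hx
      apply hh x.2 q
      rw [h1, h2, ← hxi, hx]
  · have hx' : x ∈ (invRev p).head? := by
      have : invRev p ≠ [] := by simpa [invRev] using hpn
      rwa [List.head?_append_of_ne_nil _ this] at hx
    have := invRev_head? _ _ hx'
    apply hg (x.1, !x.2) _ hxi
    rw [h1, List.getLast?_append_of_ne_nil _ hpn]
    exact this

variable (f : MulAut (FreeGroup α)) (g : α → FreeGroup α)

lemma head_claim (hf : ∀ i, f (of i) = g i * of i * (g i)⁻¹)
    (h1 : ∀ i, ∀ p ∈ (g i).toWord.getLast?, p.1 ≠ i)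
    (h2 : ∀ i j, i ≠ j → ∀ (e : Bool) r, (g j).toWord ≠ (g i).toWord ++ (i, e) :: r)
    (W : List (α × Bool)) (i : α) (e : Bool) (hW : FreeGroup.IsReduced ((i, e) :: W)) :
    ((i, e) : α × Bool) ∈ ((g i)⁻¹ * f (FreeGroup.mk ((i, e) :: W))).toWord.head? := by
  have hfe : ∀ i e, f (FreeGroup.mk [(i, e)]) = g i * FreeGroup.mk [(i, e)] * (g i)⁻¹ := by
    intro i e
    cases e with
    | true => exact hf i
    | false =>
      have : (FreeGroup.mk [(i, false)]) = (of i)⁻¹ := by simp [of, inv_mk, invRev]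
      rw [this, map_inv, hf]
      group
  induction W generalizing i e with
  | nil =>
    rw [hfe]
    have : (g i)⁻¹ * (g i * FreeGroup.mk [(i, e)] * (g i)⁻¹) =
        FreeGroup.mk ((i, e) :: (g i)⁻¹.toWord) := by
      rw [← List.singleton_append (l := (g i)⁻¹.toWord), ← mul_mk, mk_toWord]
      group
    rw [this, toWord_mk_of_isReduced]
    · simp
    · apply isReduced_cons_of_noHead isReduced_toWord
      rw [toWord_inv]
      intro x hx
      exact h1 i (x.1, !x.2) (invRev_head? _ _ hx)
  | cons p W ih =>
    obtain ⟨j, e'⟩ := p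
    rw [isReduced_cons_cons] at hW
    have ih' := ih j e' hW.2
    set R := (g j)⁻¹ * f (FreeGroup.mk ((j, e') :: W)) with hR
    have e1 : (g i)⁻¹ * f (FreeGroup.mk ((i, e) :: (j, e') :: W)) =
        FreeGroup.mk [(i, e)] * ((g i)⁻¹ * g j) * R := by
      rw [← List.singleton_append, ← mul_mk, map_mul, hfe, hR]
      group
    have hhead : ∃ R', R.toWord = (j, e') :: R' := by
      cases hh : R.toWord with
      | nil => simp [hh] at ih'
      | cons a L => simp [hh] at ih'; exact ⟨L, by rw [ih']⟩
    obtain ⟨R', hR'⟩ := hhead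
    by_cases hij : i = j
    · subst hij
      have : e = e' := hW.1 rfl
      subst this
      have e2 : FreeGroup.mk [(i, e)] * ((g i)⁻¹ * g i) * R = FreeGroup.mk ((i, e) :: R.toWord) := by
        conv_lhs => rw [← mk_toWord (x := R)]
        rw [← List.singleton_append (l := R.toWord), ← mul_mk]
        group
      rw [e1, e2, toWord_mk_of_isReduced]
      · simp
      · have := isReduced_toWord (x := R)
        rw [hR'] at this ⊢
        rw [isReduced_cons_cons]
        exact ⟨fun _ => rfl, this⟩
    · set U := (g i)⁻¹ * g j with hU
      have k1 : NoHead i U.toWord := key _ _ _ (h1 i) (h2 i j hij)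
      have k2 : NoHead j U⁻¹.toWord := by
        have : U⁻¹ = (g j)⁻¹ * g i := by rw [hU]; group
        rw [this]
        exact key _ _ _ (h1 j) (h2 j i (Ne.symm hij))
      have r1 : FreeGroup.IsReduced (U.toWord ++ R.toWord) := by
        rw [FreeGroup.IsReduced, List.isChain_append]
        refine ⟨isReduced_toWord, isReduced_toWord, ?_⟩
        intro x hx y hy hxy
        exfalso
        rw [hR'] at hy
        simp at hy
        rw [← inv_inv U, toWord_inv] at hx
        have := invRev_getLast? _ _ hx
        apply k2 _ this
        rw [← hy] at hxy
        exact hxy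
      have r2 : FreeGroup.IsReduced ((i, e) :: (U.toWord ++ R.toWord)) := by
        apply isReduced_cons_of_noHead r1
        by_cases hn : U.toWord = []
        · rw [hn, hR']
          intro x hx
          simp at hx
          rw [← hx]
          exact Ne.symm hij
        · intro x hx
          rw [List.head?_append_of_ne_nil _ hn] at hx
          exact k1 _ hx
      have e2 : FreeGroup.mk [(i, e)] * U * R = FreeGroup.mk ((i, e) :: (U.toWord ++ R.toWord)) := by
        conv_lhs => rw [← mk_toWord (x := R), ← mk_toWord (x := U)]
        rw [← List.singleton_append (l := U.toWord ++ R.toWord), ← mul_mk, ← mul_mk]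
        group
      rw [e1, e2, toWord_mk_of_isReduced r2]
      simp

lemma base_case (hf : ∀ i, f (of i) = g i * of i * (g i)⁻¹)
    (h1 : ∀ i, ∀ p ∈ (g i).toWord.getLast?, p.1 ≠ i)
    (h2 : ∀ i j, i ≠ j → ∀ (e : Bool) r, (g j).toWord ≠ (g i).toWord ++ (i, e) :: r) :
    f = 1 := by
  apply aut_ext
  intro s
  suffices g s = 1 by rw [hf, this]; simp
  obtain ⟨w, hw⟩ := f.surjective (of s)
  have hred := isReduced_toWord (x := w)
  cases hwW : w.toWord with
  | nil =>
    rw [toWord_eq_nil_iff] at hwW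
    rw [hwW, map_one] at hw
    exact absurd hw (one_ne_of s)
  | cons p W =>
    obtain ⟨i, e⟩ := p
    rw [hwW] at hred
    have := head_claim f g hf h1 h2 W i e hred
    rw [← hwW, mk_toWord, hw] at this
    by_contra hne
    apply key (g i) (of s) i (h1 i) _ _ this rfl
    intro e r hr
    rw [toWord_of] at hr
    have hl := congrArg List.length hr
    simp at hl
    have hgi : (g i).toWord = [] := by
      rw [← List.length_eq_zero_iff]; omega
    rw [hgi] at hr
    simp at hr
    obtain ⟨⟨rfl, _⟩, _⟩ := hr
    exact hne (toWord_eq_nil_iff.mp hgi)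

lemma mk_true_false (i : α) (e : Bool) : FreeGroup.mk [(i, e)] = of i ∨ FreeGroup.mk [(i, e)] = (of i)⁻¹ := by
  cases e with
  | true => left; rfl
  | false => right; simp [of, inv_mk, invRev]

theorem pure_gen [Fintype α] (N : ℕ) : ∀ (f : MulAut (FreeGroup α)) (g : α → FreeGroup α),
    (∀ i, f (of i) = g i * of i * (g i)⁻¹) → ∑ i, (g i).norm = N →
    f ∈ Subgroup.closure {c | ∃ a b : α, a ≠ b ∧ c = C a b} := by
  induction N using Nat.strong_induction_on with
  | _ N ih =>
    intro f g hf hN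
    have upd : ∀ (j : α) (x : FreeGroup α), x.norm < (g j).norm →
        ∑ i, ((Function.update g j x) i).norm < N := by
      intro j x hx
      rw [← hN]
      apply Finset.sum_lt_sum
      · intro i _
        by_cases h : i = j
        · subst h; simp [hx.le]
        · simp [h]
      · exact ⟨j, Finset.mem_univ _, by simp [hx]⟩
    by_cases h1 : ∀ i, ∀ p ∈ (g i).toWord.getLast?, p.1 ≠ i
    · by_cases h2 : ∀ i j, i ≠ j → ∀ (e : Bool) r, (g j).toWord ≠ (g i).toWord ++ (i, e) :: r
      · rw [base_case f g hf h1 h2]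
        exact one_mem _
      · push Not at h2
        obtain ⟨i, j, hij, e, r, hr⟩ := h2
        have hgj : g j = g i * FreeGroup.mk [(i, e)] * FreeGroup.mk r := by
          rw [← mk_toWord (x := g j), hr, ← List.singleton_append (l := r), ← mul_mk, ← mul_mk,
            mk_toWord, mul_assoc]
        have hx : (g i * FreeGroup.mk r).norm < (g j).norm := by
          refine lt_of_le_of_lt (norm_mul_le _ _) ?_
          have := norm_mk_le (L₁ := r)
          simp only [FreeGroup.norm] at this ⊢
          rw [hr]
          simp only [List.length_append, List.length_cons]
          omega
        have hc : C j i ∈ Subgroup.closure {c | ∃ a b : α, a ≠ b ∧ c = C a b} :=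
          Subgroup.subset_closure ⟨j, i, hij.symm, rfl⟩
        rcases mk_true_false i e with he | he
        · rw [he] at hgj
          have := ih _ (upd j _ hx) (f * (C j i)⁻¹) _ ?_ rfl
          · simpa using mul_mem this hc
          · intro m
            rw [MulAut.mul_apply, Cinv_of]
            by_cases hm : m = j
            · subst hm
              simp only [if_true, map_mul, map_inv, hf, Function.update_self]
              rw [hgj]
              group
            · simp [hm, hf]
        · rw [he] at hgj
          have := ih _ (upd j _ hx) (f * C j i) _ ?_ rfl
          · simpa using mul_mem this (inv_mem hc)
          · intro m
            rw [MulAut.mul_apply, C_of]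
            by_cases hm : m = j
            · subst hm
              simp only [if_true, map_mul, map_inv, hf, Function.update_self]
              rw [hgj]
              group
            · simp [hm, hf]
    · push Not at h1
      obtain ⟨i, ⟨i', e⟩, hp, hi⟩ := h1
      simp only at hi
      subst hi
      rcases List.eq_nil_or_concat (g i').toWord with hnil | ⟨L, a, hL⟩
      · simp [hnil] at hp
      · have ha : a = (i', e) := by simpa [hL] using hp
        subst ha
        have hgi : g i' = FreeGroup.mk L * FreeGroup.mk [(i', e)] := by
          have hL' : (g i').toWord = L ++ [(i', e)] := by rw [hL]; simp
          rw [mul_mk, ← hL', mk_toWord]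
        refine ih _ (upd i' (FreeGroup.mk L) ?_) f _ ?_ rfl
        · have := norm_mk_le (L₁ := L)
          simp only [FreeGroup.norm] at this ⊢
          rw [hL]
          simp at this ⊢
          omega
        · intro m
          by_cases hm : m = i'
          · subst hm
            rw [hf, Function.update_self, hgi]
            rcases mk_true_false m e with he | he <;> rw [he] <;> group
          · simp [hm, hf]

end Red
end BirmanAux

namespace BirmanAux
section Main
set_option linter.unusedSectionVars false
set_option linter.unusedSimpArgs false
variable {α : Type*} [DecidableEq α]
open FreeGroup hiding map_mul map_inv map_one

/-- retraction killing `P` -/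
def ret (P : α → Prop) [DecidablePred P] : FreeGroup α →* FreeGroup α :=
  FreeGroup.lift fun x => if P x then 1 else of x

lemma ret_of (P : α → Prop) [DecidablePred P] (x : α) :
    ret P (of x) = if P x then 1 else of x := by simp [ret]

lemma T_comm (P : α → Prop) [DecidablePred P] {t : MulAut (FreeGroup α)}
    (ht : t ∈ Subgroup.closure (genT P)) :
    (∀ w, ret P (t w) = t (ret P w)) ∧ ∀ y, P y → t (of y) = of y := by
  induction ht using Subgroup.closure_induction with
  | mem x hx =>
    obtain ⟨a, b, hab, ha, hb, rfl⟩ := hx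
    constructor
    · intro w
      have : (ret P).comp (C a b).toMonoidHom = (C a b).toMonoidHom.comp (ret P) := by
        apply FreeGroup.ext_hom
        intro x
        by_cases hx : x = a
        · subst hx
          simp [C_of, ret_of, ha, hb]
        · by_cases hx' : P x <;> simp [C_of, ret_of, hx, hx']
      exact DFunLike.congr_fun this w
    · intro y hy
      have : y ≠ a := by rintro rfl; exact ha hy
      simp [C_of, this]
  | one => simp
  | mul x y _ _ hx hy =>
    refine ⟨fun w => ?_, fun w hw => ?_⟩
    · rw [MulAut.mul_apply, hx.1, hy.1, MulAut.mul_apply]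
    · rw [MulAut.mul_apply, hy.2 w hw, hx.2 w hw]
  | inv x _ hx =>
    refine ⟨fun w => ?_, fun w hw => ?_⟩
    · have := hx.1 (x⁻¹ w)
      rw [MulAut.apply_inv_self] at this
      rw [this, MulAut.inv_apply_self]
    · conv_lhs => rw [← hx.2 w hw]
      rw [MulAut.inv_apply_self]

theorem K_gen [Fintype α] (P : α → Prop) [DecidablePred P] (f : MulAut (FreeGroup α))
    (hA : ∀ a, IsConj (of a) (f (of a))) (hK : ∀ w, ret P (f w) = ret P w) :
    f ∈ Subgroup.closure (genS P) := by
  have h0 : f ∈ Subgroup.closure {c | ∃ a b : α, a ≠ b ∧ c = C a b} := by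
    choose g hg using fun a => isConj_iff.mp (hA a)
    exact pure_gen _ f g (fun i => (hg i).symm) rfl
  have h1 : f ∈ Subgroup.closure (genS P) ⊔ Subgroup.closure (genT P) := by
    refine (Subgroup.closure_le _).mpr ?_ h0
    rintro _ ⟨a, b, hab, rfl⟩
    by_cases h : P a ∨ P b
    · exact Subgroup.mem_sup_left (Subgroup.subset_closure ⟨a, b, hab, h, rfl⟩)
    · push Not at h
      exact Subgroup.mem_sup_right (Subgroup.subset_closure ⟨a, b, hab, h.1, h.2, rfl⟩)
  have h2 := Subgroup.coe_mul_of_right_le_normalizer_left _ _ (T_le_normalizer P)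
  rw [← SetLike.mem_coe, h2] at h1
  obtain ⟨s, hs, t, ht, rfl⟩ := h1
  have hs' : ∀ w, ret P (s w) = ret P w := by
    have : Subgroup.closure (genS P) ≤
      ({ carrier := {f | ∀ w, ret P (f w) = ret P w}
         one_mem' := by intro w; simp
         mul_mem' := by
          intro f g hf hg w
          rw [MulAut.mul_apply]
          exact (hf (g w)).trans (hg w)
         inv_mem' := by
          intro f hf w
          have h := hf (f⁻¹ w)
          rw [MulAut.apply_inv_self] at h
          exact h.symm } : Subgroup (MulAut (FreeGroup α))) := by
      rw [Subgroup.closure_le]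
      rintro _ ⟨a, b, hab, h, rfl⟩ w
      have : (ret P).comp (C a b).toMonoidHom = ret P := by
        apply FreeGroup.ext_hom
        intro x
        by_cases hx : x = a
        · subst hx
          by_cases hx : P x
          · simp [C_of, ret_of, hx]
          · simp [C_of, ret_of, hx, h.resolve_left hx]
        · simp [C_of, ret_of, hx]
      exact DFunLike.congr_fun this w
    exact this hs
  have ht' : ∀ w, ret P (t w) = ret P w := by
    intro w
    rw [← hs' (t w)]
    exact hK w
  have : t = 1 := by
    apply aut_ext
    intro x
    obtain ⟨c1, c2⟩ := T_comm P ht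
    by_cases hx : P x
    · rw [c2 x hx]; rfl
    · have h3 := (c1 (of x)).symm.trans (ht' (of x))
      simpa [ret_of, hx] using h3
  rw [this]
  simpa using hs

/-- exponent sum of `b` -/
def expo (b : α) : FreeGroup α →* Multiplicative ℤ :=
  FreeGroup.lift fun x => if x = b then Multiplicative.ofAdd 1 else 1

/-- translation -/
def trans1 : Equiv.Perm (ℤ × ℤ) where
  toFun p := (p.1 + 1, p.2)
  invFun p := (p.1 - 1, p.2)
  left_inv p := by simp
  right_inv p := by simp

/-- shear -/
def shear : Equiv.Perm (ℤ × ℤ) where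
  toFun p := (p.1, p.2 + p.1)
  invFun p := (p.1, p.2 - p.1)
  left_inv p := by simp
  right_inv p := by simp

/-- Heisenberg representation -/
def heis (a b : α) : FreeGroup α →* Equiv.Perm (ℤ × ℤ) :=
  FreeGroup.lift fun x => if x = a then trans1 else if x = b then shear else 1

lemma heis_spec (a b : α) (hab : a ≠ b) (u : FreeGroup α) : ∃ d c : ℤ, ∀ x y : ℤ,
    heis a b u (x, y) = (x + d, y + (expo b u).toAdd * x + c) := by
  have hgen : ∀ i, heis a b (of i) = if i = a then trans1 else if i = b then shear else 1 := by
    intro i; simp [heis]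
  have hexp : ∀ i, expo b (of i) = if i = b then Multiplicative.ofAdd 1 else 1 := by
    intro i; simp [expo]
  induction u using FreeGroup.induction_on with
  | C1 => exact ⟨0, 0, by simp⟩
  | of i =>
    rw [hgen, hexp]
    by_cases h : i = a
    · subst h
      exact ⟨1, 0, by simp [trans1, hab]⟩
    · by_cases h' : i = b
      · subst h'
        exact ⟨0, 0, by simp [shear, h]⟩
      · exact ⟨0, 0, by simp [h, h']⟩
  | inv_of i ih =>
    obtain ⟨d, c, h⟩ := ih
    refine ⟨-d, (expo b (of i)).toAdd * d - c, fun x y => ?_⟩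
    rw [map_inv, map_inv, Equiv.Perm.inv_eq_iff_eq, h]
    simp only [toAdd_inv, Prod.mk.injEq]
    constructor <;> ring
  | mul u v hu hv =>
    obtain ⟨d, c, h⟩ := hu
    obtain ⟨d', c', h'⟩ := hv
    refine ⟨d' + d, c' + (expo b u).toAdd * d' + c, fun x y => ?_⟩
    rw [map_mul, map_mul, Equiv.Perm.mul_apply, h', h]
    simp only [toAdd_mul, Prod.mk.injEq]
    constructor <;> ring

lemma expo_of_commute (a b : α) (hab : a ≠ b) (u : FreeGroup α) (h : Commute u (of a)) :
    expo b u = 1 := by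
  obtain ⟨d, c, hu⟩ := heis_spec a b hab u
  have h1 := congrArg (fun w => (heis a b w (0, 0)).2) h.eq
  have : heis a b (of a) = trans1 := by simp [heis]
  simp only [map_mul, Equiv.Perm.mul_apply, this, hu] at h1
  simp only [trans1, Equiv.coe_fn_mk, hu] at h1
  simp at h1
  exact h1

lemma expo_wd (a b : α) (hab : a ≠ b) (u v : FreeGroup α)
    (h : u * of a * u⁻¹ = v * of a * v⁻¹) : expo b u = expo b v := by
  have hc : Commute (v⁻¹ * u) (of a) := by
    show v⁻¹ * u * of a = of a * (v⁻¹ * u)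
    rw [mul_inv_eq_iff_eq_mul] at h
    rw [mul_assoc, h]
    group
  have := expo_of_commute a b hab _ hc
  rw [map_mul, map_inv, inv_mul_eq_one] at this
  exact this.symm

lemma expo_aut (b : α) (f : MulAut (FreeGroup α)) (hf : ∀ a, IsConj (of a) (f (of a)))
    (w : FreeGroup α) : expo b (f w) = expo b w := by
  have : (expo b).comp f.toMonoidHom = expo b := by
    apply FreeGroup.ext_hom
    intro x
    obtain ⟨c, hc⟩ := isConj_iff.mp (hf x)
    simp [← hc]
  exact DFunLike.congr_fun this w

/-- index set -/
abbrev Idx (P : α → Prop) := {p : α × α // p.1 ≠ p.2 ∧ (P p.1 ∨ P p.2)}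

/-- The crossed exponent homomorphism. -/
noncomputable def phi (P : α → Prop) (H : Subgroup (MulAut (FreeGroup α)))
    (hH : ∀ f ∈ H, ∀ a, IsConj (of a) (f (of a))) : H →* Multiplicative (Idx P → ℤ) :=
  MonoidHom.mk' (fun f => Multiplicative.ofAdd fun p =>
    (expo p.1.2 (Classical.choose (isConj_iff.mp (hH f.1 f.2 p.1.1)))).toAdd) (by
    intro f g
    apply Multiplicative.toAdd.injective
    funext p
    have hf := Classical.choose_spec (isConj_iff.mp (hH f.1 f.2 p.1.1))
    have hg := Classical.choose_spec (isConj_iff.mp (hH g.1 g.2 p.1.1))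
    have hfg := Classical.choose_spec (isConj_iff.mp (hH (f * g).1 (f * g).2 p.1.1))
    set u := Classical.choose (isConj_iff.mp (hH f.1 f.2 p.1.1))
    set v := Classical.choose (isConj_iff.mp (hH g.1 g.2 p.1.1))
    set w := Classical.choose (isConj_iff.mp (hH (f * g).1 (f * g).2 p.1.1))
    have : expo p.1.2 w = expo p.1.2 (f.1 v * u) := by
      apply expo_wd p.1.1 p.1.2 p.2.1
      rw [hfg, Subgroup.coe_mul, MulAut.mul_apply, ← hg, map_mul, map_mul, map_inv, ← hf]
      group
    rw [map_mul, expo_aut p.1.2 f.1 (hH f.1 f.2)] at this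
    show (expo p.1.2 w).toAdd = (expo p.1.2 u).toAdd + (expo p.1.2 v).toAdd
    rw [this, toAdd_mul, add_comm])

lemma phi_apply (P : α → Prop) (H : Subgroup (MulAut (FreeGroup α)))
    (hH : ∀ f ∈ H, ∀ a, IsConj (of a) (f (of a))) (f : H) (p : Idx P) (u : FreeGroup α)
    (hu : u * of p.1.1 * u⁻¹ = f.1 (of p.1.1)) :
    (phi P H hH f).toAdd p = (expo p.1.2 u).toAdd := by
  have hf := Classical.choose_spec (isConj_iff.mp (hH f.1 f.2 p.1.1))
  exact congrArg Multiplicative.toAdd (expo_wd p.1.1 p.1.2 p.2.1 _ u (hf.trans hu.symm))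

lemma phi_C (P : α → Prop) (H : Subgroup (MulAut (FreeGroup α)))
    (hH : ∀ f ∈ H, ∀ a, IsConj (of a) (f (of a))) (q : Idx P) (hq : C q.1.1 q.1.2 ∈ H) :
    phi P H hH ⟨_, hq⟩ = Multiplicative.ofAdd (Pi.single q 1) := by
  apply Multiplicative.toAdd.injective
  funext p
  by_cases h : p.1.1 = q.1.1
  · rw [phi_apply P H hH _ p (of q.1.2) (by simp [C_of, h])]
    by_cases h' : q.1.2 = p.1.2
    · have : p = q := Subtype.ext (Prod.ext h h'.symm)
      subst this
      simp [expo]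
    · have : p ≠ q := by rintro rfl; exact h' rfl
      simp [expo, h', this]
  · have : p ≠ q := by rintro rfl; exact h rfl
    rw [phi_apply P H hH _ p 1 (by simp [C_of, h])]
    simp [this]

theorem abel_iso {G ι : Type*} [Group G] [Fintype ι] [DecidableEq ι] (s : ι → G)
    (hs : Subgroup.closure (Set.range s) = ⊤) (φ : G →* Multiplicative (ι → ℤ))
    (hφ : ∀ i, φ (s i) = Multiplicative.ofAdd (Pi.single i 1)) :
    Nonempty (Abelianization G ≃* Multiplicative (ι → ℤ)) := by
  let θ : Multiplicative (ι → ℤ) →* Abelianization G :=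
    MonoidHom.mk' (fun v => ∏ i, (Abelianization.of (s i)) ^ (v.toAdd i)) (by
      intro v w
      simp [zpow_add, Finset.prod_mul_distrib])
  have hθ : ∀ i, θ (Multiplicative.ofAdd (Pi.single i 1)) = Abelianization.of (s i) := by
    intro i
    show ∏ j, (Abelianization.of (s j)) ^ ((Pi.single i 1 : ι → ℤ) j) = _
    rw [Finset.prod_eq_single i]
    · simp
    · intro j _ hj; simp [hj]
    · simp
  refine ⟨MonoidHom.toMulEquiv (Abelianization.lift φ) θ ?_ ?_⟩
  · apply Abelianization.hom_ext
    apply MonoidHom.eq_of_eqOn_dense hs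
    rintro _ ⟨i, rfl⟩
    simp [hφ, hθ]
  · refine MonoidHom.ext fun v => ?_
    apply Multiplicative.toAdd.injective
    show Multiplicative.toAdd (Abelianization.lift φ (∏ i, (Abelianization.of (s i)) ^ (v.toAdd i))) = _
    simp only [map_prod, map_zpow, Abelianization.lift_apply_of, hφ]
    funext j
    simp [toAdd_prod, Finset.sum_apply, Pi.single_apply]

theorem main_generic [Fintype α] (P : α → Prop) [DecidablePred P] (H : Subgroup (MulAut (FreeGroup α)))
    (hH : ∀ f, f ∈ H ↔ (∀ a, IsConj (of a) (f (of a))) ∧ ∀ w, ret P (f w) = ret P w) :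
    Nonempty (Abelianization H ≃* Multiplicative (Idx P → ℤ)) := by
  have hC : ∀ q : Idx P, C q.1.1 q.1.2 ∈ H := by
    rintro ⟨⟨a, b⟩, hab, h⟩
    rw [hH]
    constructor
    · intro x
      rw [isConj_iff]
      by_cases hx : x = a
      · exact ⟨of b, by simp [C_of, hx]⟩
      · exact ⟨1, by simp [C_of, hx]⟩
    · intro w
      have : (ret P).comp (C a b).toMonoidHom = ret P := by
        apply FreeGroup.ext_hom
        intro x
        by_cases hx : x = a
        · subst hx
          by_cases hx : P x
          · simp [C_of, ret_of, hx]
          · simp [C_of, ret_of, hx, h.resolve_left hx]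
        · simp [C_of, ret_of, hx]
      exact DFunLike.congr_fun this w
  refine abel_iso (fun q : Idx P => (⟨_, hC q⟩ : H)) ?_ (phi P H fun f hf => ((hH f).mp hf).1)
    (fun q => phi_C P H _ q (hC q))
  rw [eq_top_iff]
  rintro ⟨f, hf⟩ -
  have h1 := K_gen P f ((hH f).mp hf).1 ((hH f).mp hf).2
  have h2 : (Subgroup.closure (Set.range (fun q : Idx P => (⟨_, hC q⟩ : H)))).map H.subtype =
      Subgroup.closure (genS P) := by
    rw [MonoidHom.map_closure]
    congr 1
    ext x
    constructor
    · rintro ⟨_, ⟨q, rfl⟩, rfl⟩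
      exact ⟨q.1.1, q.1.2, q.2.1, q.2.2, rfl⟩
    · rintro ⟨a, b, hab, h, rfl⟩
      exact ⟨_, ⟨⟨(a, b), hab, h⟩, rfl⟩, rfl⟩
  rw [← h2] at h1
  obtain ⟨y, hy, hyf⟩ := h1
  have : y = ⟨f, hf⟩ := Subtype.ext hyf
  rwa [← this]

/-- is a `Y` generator -/
def isY (k l : ℕ) : Fin 0 ⊕ (Fin k ⊕ Fin l) → Prop
  | Sum.inr (Sum.inl _) => True
  | _ => False

instance (k l : ℕ) : DecidablePred (isY k l)
  | Sum.inr (Sum.inl _) => isTrue trivial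
  | Sum.inr (Sum.inr _) => isFalse id
  | Sum.inl _ => isFalse id

/-- The index set in explicit form. -/
def idxEquiv (k l : ℕ) : Idx (isY k l) ≃ (Fin k × Fin l ⊕ Fin l × Fin k) ⊕ {p : Fin k × Fin k // p.1 ≠ p.2} where
  toFun
    | ⟨(Sum.inr (Sum.inl i), Sum.inr (Sum.inl j)), h⟩ => Sum.inr ⟨(i, j), fun e => h.1 (by simpa using e)⟩
    | ⟨(Sum.inr (Sum.inl i), Sum.inr (Sum.inr j)), _⟩ => Sum.inl (Sum.inl (i, j))
    | ⟨(Sum.inr (Sum.inr i), Sum.inr (Sum.inl j)), _⟩ => Sum.inl (Sum.inr (i, j))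
    | ⟨(Sum.inr (Sum.inr _), Sum.inr (Sum.inr _)), h⟩ => absurd h.2 (by simp [isY])
    | ⟨(Sum.inl i, _), _⟩ => i.elim0
    | ⟨(_, Sum.inl i), _⟩ => i.elim0
  invFun
    | Sum.inr p => ⟨(Sum.inr (Sum.inl p.1.1), Sum.inr (Sum.inl p.1.2)), by simpa using p.2, by simp [isY]⟩
    | Sum.inl (Sum.inl p) => ⟨(Sum.inr (Sum.inl p.1), Sum.inr (Sum.inr p.2)), by simp, by simp [isY]⟩
    | Sum.inl (Sum.inr p) => ⟨(Sum.inr (Sum.inr p.1), Sum.inr (Sum.inl p.2)), by simp, by simp [isY]⟩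
  left_inv := by
    rintro ⟨⟨i | i | i, j | j | j⟩, h⟩
    all_goals first | rfl | exact i.elim0 | exact j.elim0 | exact absurd h.2 (by simp [isY])
  right_inv := by
    rintro ((p | p) | p) <;> rfl

lemma card_idx (k l : ℕ) : Fintype.card (Idx (isY k l)) = 2 * k * l + k * (k - 1) := by
  have h : Fintype.card {p : Fin k × Fin k // p.1 ≠ p.2} = k * (k - 1) := by
    rw [Fintype.card_subtype]
    have : (Finset.univ.filter fun p : Fin k × Fin k => p.1 ≠ p.2) = (Finset.univ : Finset (Fin k)).offDiag := by
      ext p; simp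
    rw [this, Finset.offDiag_card]
    simp [Nat.mul_sub]
  rw [Fintype.card_congr (idxEquiv k l), Fintype.card_sum, Fintype.card_sum, h]
  simp
  ring

end Main
end BirmanAux

namespace Birman

/-- **Theorem D, case `n = 0`.**  For `k ≥ 1` and `l ≥ 0`, the abelianization
`H_1(K_{0,k,l}; ℤ)` of `K_{0,k,l}` is free abelian of rank `2kl + k(k-1)`. -/
theorem abelianization_K_n_eq_zero (k l : ℕ) (hk : 1 ≤ k) :
    Nonempty (Abelianization ↥(K 0 k l) ≃* Multiplicative (Fin (2*k*l + k*(k-1)) → ℤ)) := by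
  have hret : ∀ w, BirmanAux.ret (BirmanAux.isY k l) w =
      FreeGroup.map (fun x : Gen 0 0 l => (match x with
        | Sum.inl i => Sum.inl i
        | Sum.inr (Sum.inl i) => i.elim0
        | Sum.inr (Sum.inr m) => Sum.inr (Sum.inr m) : Gen 0 k l)) (proj 0 k l w) := by
    intro w
    rw [← MonoidHom.comp_apply]
    refine DFunLike.congr_fun (FreeGroup.ext_hom _ _ ?_) w
    rintro (i | i | i)
    · exact i.elim0
    · simp [BirmanAux.ret_of, proj, BirmanAux.isY]
    · simp [BirmanAux.ret_of, proj, BirmanAux.isY]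
  have hproj : ∀ w, proj 0 k l (BirmanAux.ret (BirmanAux.isY k l) w) = proj 0 k l w := by
    intro w
    rw [← MonoidHom.comp_apply]
    refine DFunLike.congr_fun (FreeGroup.ext_hom _ _ ?_) w
    rintro (i | i | i)
    · exact i.elim0
    · simp [BirmanAux.ret_of, proj, BirmanAux.isY]
    · simp [BirmanAux.ret_of, proj, BirmanAux.isY]
  obtain ⟨e⟩ := BirmanAux.main_generic (BirmanAux.isY k l) (K 0 k l) (by
    intro f
    constructor
    · rintro ⟨h1, h2⟩
      refine ⟨?_, fun w => ?_⟩
      · rintro (i | s)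
        · exact i.elim0
        · exact h1 s
      · rw [hret, hret, h2 w]
    · rintro ⟨h1, h2⟩
      refine ⟨fun s => h1 _, fun w => ?_⟩
      rw [← hproj, h2 w, hproj])
  let r : BirmanAux.Idx (BirmanAux.isY k l) ≃ Fin (2*k*l + k*(k-1)) :=
    Fintype.equivFinOfCardEq (BirmanAux.card_idx k l)
  exact ⟨e.trans (AddEquiv.toMultiplicative (LinearEquiv.funCongrLeft ℤ ℤ r.symm).toAddEquiv)⟩

end Birman
end

section
/- If n ≥ 1, k ≥ 1 and l ≥ 0, then the abelianization H_1(K_{n,k,l}; ℤ) of K_{n,k,l} is a free abelian group of rank 2kn + 2kl, i.e. isomorphic to ℤ^{2kn + 2kl}. -/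
namespace Nls
open FreeGroup (of)
set_option linter.unusedSectionVars false

/-- `g` is the automorphism `t ↦ a t b`, fixing the other generators. -/
def IsTw {S : Type} (g : MulAut (FreeGroup S)) (t : S) (a b : FreeGroup S) : Prop :=
  g (of t) = a * of t * b ∧ ∀ s, s ≠ t → g (of s) = of s

/-- The subgroup generated by the generators different from `t`. -/
def Fm {S : Type} (t : S) : Subgroup (FreeGroup S) :=
  Subgroup.closure (of '' {s | s ≠ t})

lemma of_mem_Fm {S : Type} {t s : S} (h : s ≠ t) : of s ∈ Fm t :=
  Subgroup.subset_closure ⟨s, h, rfl⟩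

/-- The endomorphism `t ↦ a t b`. -/
def twHom {S : Type} [DecidableEq S] (t : S) (a b : FreeGroup S) : FreeGroup S →* FreeGroup S :=
  FreeGroup.lift fun s => if s = t then a * of t * b else of s

lemma twHom_fix {S : Type} [DecidableEq S] (t : S) (a b w : FreeGroup S) (hw : w ∈ Fm t) :
    twHom t a b w = w := by
  induction hw using Subgroup.closure_induction with
  | mem x hx => obtain ⟨s, hs, rfl⟩ := hx; have hs' : s ≠ t := hs; simp [twHom, hs']
  | one => simp
  | mul x y _ _ hx hy => simp [hx, hy]
  | inv x _ hx => simp [hx]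

lemma twHom_self {S : Type} [DecidableEq S] (t : S) (a b : FreeGroup S) :
    twHom t a b (of t) = a * of t * b := by simp [twHom]

lemma twHom_inv {S : Type} [DecidableEq S] (t : S) (a b : FreeGroup S)
    (ha : a ∈ Fm t) (hb : b ∈ Fm t) :
    (twHom t a⁻¹ b⁻¹).comp (twHom t a b) = MonoidHom.id _ := by
  ext s
  by_cases h : s = t
  · subst h
    simp only [MonoidHom.comp_apply, twHom_self, map_mul, MonoidHom.id_apply]
    rw [twHom_fix _ _ _ _ ha, twHom_fix _ _ _ _ hb]
    group
  · simp only [MonoidHom.comp_apply, twHom_fix _ _ _ _ (of_mem_Fm h), MonoidHom.id_apply]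

/-- The automorphism `t ↦ a t b`. -/
def tw {S : Type} [DecidableEq S] (t : S) (a b : FreeGroup S)
    (ha : a ∈ Fm t) (hb : b ∈ Fm t) : MulAut (FreeGroup S) :=
  MonoidHom.toMulEquiv (twHom t a b) (twHom t a⁻¹ b⁻¹) (twHom_inv t a b ha hb)
    (by
      have := twHom_inv t a⁻¹ b⁻¹ (inv_mem ha) (inv_mem hb)
      simpa using this)

lemma tw_apply {S : Type} [DecidableEq S] (t : S) (a b : FreeGroup S)
    (ha : a ∈ Fm t) (hb : b ∈ Fm t) (w : FreeGroup S) : tw t a b ha hb w = twHom t a b w := rfl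

lemma isTw_tw {S : Type} [DecidableEq S] (t : S) (a b : FreeGroup S)
    (ha : a ∈ Fm t) (hb : b ∈ Fm t) : IsTw (tw t a b ha hb) t a b :=
  ⟨twHom_self t a b, fun _ hs => twHom_fix _ _ _ _ (of_mem_Fm hs)⟩

lemma aut_ext {S : Type} {f g : MulAut (FreeGroup S)} (h : ∀ s, f (of s) = g (of s)) : f = g := by
  have : f.toMonoidHom = g.toMonoidHom := FreeGroup.ext_hom _ _ (fun s => h s)
  ext w
  exact DFunLike.congr_fun this w

lemma IsTw.eq {S : Type} {f g : MulAut (FreeGroup S)} {t : S} {a b : FreeGroup S}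
    (hf : IsTw f t a b) (hg : IsTw g t a b) : f = g := by
  apply aut_ext
  intro s
  by_cases h : s = t
  · subst h; rw [hf.1, hg.1]
  · rw [hf.2 s h, hg.2 s h]

lemma IsTw.fix {S : Type} {g : MulAut (FreeGroup S)} {t : S} {a b w : FreeGroup S}
    (hg : IsTw g t a b) (hw : w ∈ Fm t) : g w = w := by
  induction hw using Subgroup.closure_induction with
  | mem x hx => obtain ⟨s, hs, rfl⟩ := hx; exact hg.2 s hs
  | one => simp
  | mul x y _ _ hx hy => simp [hx, hy]
  | inv x _ hx => simp [hx]

lemma IsTw.mul {S : Type} {g g' : MulAut (FreeGroup S)} {t : S} {a b a' b' : FreeGroup S}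
    (hg : IsTw g t a b) (hg' : IsTw g' t a' b') (ha : a' ∈ Fm t) (hb : b' ∈ Fm t) :
    IsTw (g * g') t (a' * a) (b * b') := by
  refine ⟨?_, fun s hs => ?_⟩
  · rw [MulAut.mul_apply, hg'.1, map_mul, map_mul, hg.fix ha, hg.fix hb, hg.1]; group
  · rw [MulAut.mul_apply, hg'.2 s hs, hg.2 s hs]

lemma IsTw.inv {S : Type} {g : MulAut (FreeGroup S)} {t : S} {a b : FreeGroup S}
    (hg : IsTw g t a b) (ha : a ∈ Fm t) (hb : b ∈ Fm t) :
    IsTw g⁻¹ t a⁻¹ b⁻¹ := by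
  refine ⟨?_, fun s hs => ?_⟩
  · apply g.injective
    rw [MulAut.apply_inv_self, map_mul, map_mul, map_inv, map_inv, hg.fix ha, hg.fix hb, hg.1]
    group
  · apply g.injective
    rw [MulAut.apply_inv_self, hg.2 s hs]

lemma IsTw.one {S : Type} (t : S) : IsTw (1 : MulAut (FreeGroup S)) t 1 1 := by
  simp [IsTw]

lemma IsTw.npow {S : Type} {g : MulAut (FreeGroup S)} {t : S} {a b : FreeGroup S}
    (hg : IsTw g t a b) (ha : a ∈ Fm t) (hb : b ∈ Fm t) (i : ℕ) :
    IsTw (g ^ i) t (a ^ i) (b ^ i) := by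
  induction i with
  | zero => simpa using IsTw.one t
  | succ i ih =>
    have := hg.mul ih (pow_mem ha _) (pow_mem hb _)
    rwa [← pow_succ', ← pow_succ, ← pow_succ'] at this

lemma IsTw.zpow {S : Type} {g : MulAut (FreeGroup S)} {t : S} {a b : FreeGroup S}
    (hg : IsTw g t a b) (ha : a ∈ Fm t) (hb : b ∈ Fm t) (i : ℤ) :
    IsTw (g ^ i) t (a ^ i) (b ^ i) := by
  cases i with
  | ofNat i => simpa using hg.npow ha hb i
  | negSucc i =>
    simpa [zpow_negSucc] using (hg.npow ha hb (i+1)).inv (pow_mem ha _) (pow_mem hb _)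

variable {X C : Type} [DecidableEq X] [DecidableEq C]

/-- Inversion of the generator `x`. -/
def IsInv (g : MulAut (FreeGroup (X ⊕ C))) (x : X) : Prop :=
  g (of (Sum.inl x)) = (of (Sum.inl x))⁻¹ ∧ ∀ s, s ≠ Sum.inl x → g (of s) = of s

/-- Permutation of the generators in `X`. -/
def IsPerm (g : MulAut (FreeGroup (X ⊕ C))) (e : Equiv.Perm X) : Prop :=
  (∀ x, g (of (Sum.inl x)) = of (Sum.inl (e x))) ∧ ∀ c, g (of (Sum.inr c)) = of (Sum.inr c)

/-- The elementary automorphisms. -/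
def GSet (X C : Type) : Set (MulAut (FreeGroup (X ⊕ C))) :=
  {g | (∃ x, IsInv g x) ∨ (∃ e, IsPerm g e) ∨
    (∃ x s, s ≠ Sum.inl x ∧ IsTw g (Sum.inl x) (of s) 1) ∨
    (∃ c s, s ≠ Sum.inr c ∧ IsTw g (Sum.inr c) (of s) (of s)⁻¹)}

/-- The group generated by elementary automorphisms. -/
def G (X C : Type) : Subgroup (MulAut (FreeGroup (X ⊕ C))) := Subgroup.closure (GSet X C)

lemma exists_inv (x : X) : ∃ g : MulAut (FreeGroup (X ⊕ C)), IsInv g x := by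
  let φ : FreeGroup (X ⊕ C) →* FreeGroup (X ⊕ C) :=
    FreeGroup.lift fun s => if s = Sum.inl x then (of (Sum.inl x))⁻¹ else of s
  have h1 : φ (of (Sum.inl x)) = (of (Sum.inl x))⁻¹ := by simp [φ]
  have h2 : ∀ s, s ≠ Sum.inl x → φ (of s) = of s := by intro s hs; simp [φ, hs]
  have h3 : φ.comp φ = MonoidHom.id _ := by
    ext s
    by_cases h : s = Sum.inl x
    · subst h; simp [h1]
    · simp [h2 s h]
  exact ⟨MonoidHom.toMulEquiv φ φ h3 h3, h1, h2⟩

lemma exists_inv_G (x : X) : ∃ g ∈ G X C, IsInv g x := by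
  obtain ⟨g, hg⟩ := exists_inv (C := C) x
  exact ⟨g, Subgroup.subset_closure (Or.inl ⟨x, hg⟩), hg⟩

lemma exists_L (x : X) (s : X ⊕ C) (hs : s ≠ Sum.inl x) :
    ∃ g ∈ G X C, IsTw g (Sum.inl x) (of s) 1 := by
  have h := isTw_tw (Sum.inl x) (of s) 1 (of_mem_Fm hs) (one_mem _)
  exact ⟨_, Subgroup.subset_closure (Or.inr (Or.inr (Or.inl ⟨x, s, hs, h⟩))), h⟩

lemma exists_Cj (c : C) (s : X ⊕ C) (hs : s ≠ Sum.inr c) :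
    ∃ g ∈ G X C, IsTw g (Sum.inr c) (of s) (of s)⁻¹ := by
  have h := isTw_tw (Sum.inr c) (of s) (of s)⁻¹ (of_mem_Fm hs) (inv_mem (of_mem_Fm hs))
  exact ⟨_, Subgroup.subset_closure (Or.inr (Or.inr (Or.inr ⟨c, s, hs, h⟩))), h⟩

lemma IsInv.fix {g : MulAut (FreeGroup (X ⊕ C))} {x : X} {w : FreeGroup (X ⊕ C)}
    (hg : IsInv g x) (hw : w ∈ Fm (Sum.inl x)) : g w = w := by
  induction hw using Subgroup.closure_induction with
  | mem x hx => obtain ⟨s, hs, rfl⟩ := hx; exact hg.2 s hs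
  | one => simp
  | mul x y _ _ hx hy => simp [hx, hy]
  | inv x _ hx => simp [hx]

lemma IsInv.inv_eq {g : MulAut (FreeGroup (X ⊕ C))} {x : X} (hg : IsInv g x) : g⁻¹ = g := by
  rw [inv_eq_iff_mul_eq_one]
  apply aut_ext
  intro s
  by_cases h : s = Sum.inl x
  · subst h; simp [hg.1]
  · simp [hg.2 s h]

lemma IsInv.conj {g h : MulAut (FreeGroup (X ⊕ C))} {x : X} {a : FreeGroup (X ⊕ C)}
    (hg : IsInv g x) (hh : IsTw h (Sum.inl x) a 1) (ha : a ∈ Fm (Sum.inl x)) :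
    IsTw (g * h * g⁻¹) (Sum.inl x) 1 a⁻¹ := by
  rw [hg.inv_eq]
  refine ⟨?_, fun s hs => ?_⟩
  · simp [hg.1, hh.1, hg.fix ha]
  · simp [hg.2 s hs, hh.2 s hs]

lemma exists_LR (x : X) (s : X ⊕ C) (hs : s ≠ Sum.inl x) (i j : ℤ) :
    ∃ g ∈ G X C, IsTw g (Sum.inl x) (of s ^ i) (of s ^ j) := by
  obtain ⟨g, hgG, hg⟩ := exists_L x s hs
  obtain ⟨v, hvG, hv⟩ := exists_inv_G (C := C) x
  have hm : of s ∈ Fm (Sum.inl x) := of_mem_Fm hs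
  have h1 := hg.zpow hm (one_mem _) i
  have h2 := ((hv.conj hg hm).zpow (one_mem _) (inv_mem hm) (-j))
  have h3 := h1.mul h2 (zpow_mem (one_mem _) _) (zpow_mem (inv_mem hm) _)
  refine ⟨_, mul_mem (zpow_mem hgG i)
    (zpow_mem (mul_mem (mul_mem hvG hgG) (inv_mem hvG)) (-j)), ?_⟩
  simpa using h3

lemma exists_CC (c : C) (s : X ⊕ C) (hs : s ≠ Sum.inr c) (i : ℤ) :
    ∃ g ∈ G X C, IsTw g (Sum.inr c) (of s ^ i) (of s ^ (-i)) := by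
  obtain ⟨g, hgG, hg⟩ := exists_Cj c s hs
  have hm : of s ∈ Fm (Sum.inr c) := of_mem_Fm hs
  exact ⟨_, zpow_mem hgG i, by simpa using hg.zpow hm (inv_mem hm) i⟩

lemma multi_aux [Finite X] [Finite C] (s : X ⊕ C) (i j : X ⊕ C → ℤ)
    (hij : ∀ c, j (Sum.inr c) = - i (Sum.inr c)) (Q : Finset (X ⊕ C)) (hQ : s ∉ Q) :
    ∃ h ∈ G X C, (∀ t ∈ Q, h (of t) = of s ^ i t * of t * of s ^ j t) ∧
      ∀ t, t ∉ Q → h (of t) = of t := by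
  induction Q using Finset.induction_on with
  | empty => exact ⟨1, one_mem _, by simp, by simp⟩
  | insert t Q ht ih =>
    simp only [Finset.mem_insert, not_or] at hQ
    obtain ⟨h, hG, h1, h2⟩ := ih hQ.2
    have : ∃ g ∈ G X C, IsTw g t (of s ^ i t) (of s ^ j t) := by
      cases t with
      | inl x => exact exists_LR x s hQ.1 _ _
      | inr c => rw [hij]; exact exists_CC c s hQ.1 _
    obtain ⟨g, hgG, hg⟩ := this
    refine ⟨h * g, mul_mem hG hgG, ?_, ?_⟩
    · intro r hr
      rw [MulAut.mul_apply]
      rcases Finset.mem_insert.1 hr with rfl | hr'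
      · rw [hg.1]; simp [h2 s hQ.2, h2 r ht]
      · rw [hg.2 r (by rintro rfl; exact ht hr'), h1 r hr']
    · intro r hr
      simp only [Finset.mem_insert, not_or] at hr
      rw [MulAut.mul_apply, hg.2 r hr.1, h2 r hr.2]

lemma multi [Fintype X] [Fintype C] (s : X ⊕ C) (i j : X ⊕ C → ℤ)
    (hij : ∀ c, j (Sum.inr c) = - i (Sum.inr c)) :
    ∃ h ∈ G X C, (∀ t, t ≠ s → h (of t) = of s ^ i t * of t * of s ^ j t) ∧ h (of s) = of s := by
  obtain ⟨h, hG, h1, h2⟩ := multi_aux s i j hij (Finset.univ.erase s) (by simp)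
  exact ⟨h, hG, fun t ht => h1 t (by simp [ht]), h2 s (by simp)⟩

end Nls

namespace Nls
open FreeGroup (of)
set_option linter.unusedSectionVars false

section initial_lemmas
variable {S : Type} [DecidableEq S]

/-- `r` is a prefix of `v`. -/
def Pre (r v : FreeGroup S) : Prop := r.toWord <+: v.toWord

/-- The element of the free group given by a letter. -/
abbrev lt (m : S × Bool) : FreeGroup S := FreeGroup.mk [m]

lemma toWord_mk_of_initial {w : List (S × Bool)} {v : FreeGroup S} (h : w <+: v.toWord) :
    (FreeGroup.mk w).toWord = w := by
  rw [FreeGroup.toWord_mk]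
  obtain ⟨r, hr⟩ := h
  have hv : FreeGroup.IsReduced v.toWord := FreeGroup.isReduced_toWord
  rw [← hr] at hv
  have hw : FreeGroup.IsReduced w := List.IsChain.left_of_append hv
  exact hw.reduce_eq

lemma Pre.refl (v : FreeGroup S) : Pre v v := List.prefix_refl _

lemma Pre.trans {u v w : FreeGroup S} (h : Pre u v) (h' : Pre v w) : Pre u w :=
  List.IsPrefix.trans h h'

lemma one_pre (v : FreeGroup S) : Pre 1 v := by simp [Pre]

lemma exists_parent {v : FreeGroup S} (hv : v ≠ 1) :
    ∃ (v' : FreeGroup S) (m : S × Bool), v = v' * lt m ∧ v'.toWord ++ [m] = v.toWord := by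
  have h : v.toWord ≠ [] := by simpa using hv
  obtain ⟨w, m, hw⟩ := List.eq_nil_or_concat' v.toWord |>.resolve_left h
  have h2 : (FreeGroup.mk w).toWord = w := toWord_mk_of_initial (v := v) (by rw [hw]; simp)
  refine ⟨FreeGroup.mk w, m, ?_, by rw [h2, hw]⟩
  rw [FreeGroup.mul_mk, ← hw, FreeGroup.mk_toWord]

lemma pre_mul_lt {w v : FreeGroup S} {m : S × Bool} (h : Pre w (v * lt m)) :
    Pre w v ∨ w = v * lt m := by
  by_cases hr : FreeGroup.IsReduced (v.toWord ++ [m])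
  · have h1 : (v * lt m).toWord = v.toWord ++ [m] := by
      rw [FreeGroup.toWord_mul, FreeGroup.toWord_mk, FreeGroup.reduce_singleton, hr.reduce_eq]
    unfold Pre at h
    rw [h1, List.prefix_concat_iff, ← h1] at h
    rcases h with h | h
    · exact Or.inr (FreeGroup.toWord_injective h)
    · exact Or.inl h
  · left
    have hv : v ≠ 1 := by
      rintro rfl
      exact hr (by simp)
    obtain ⟨v', m', h1, h2⟩ := exists_parent hv
    have h3 : ¬ (m'.1 = m.1 → m'.2 = m.2) := by
      intro h3
      apply hr
      rw [← h2]
      refine FreeGroup.IsReduced.append_overlap ?_ ?_ (by simp)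
      · rw [h2]; exact FreeGroup.isReduced_toWord
      · simpa using h3
    push Not at h3
    have h4 : lt m' * lt m = 1 := by
      obtain ⟨a, b⟩ := m
      obtain ⟨a', b'⟩ := m'
      simp only at h3
      obtain ⟨rfl, h3⟩ := h3
      have : b' = !b := by cases b <;> cases b' <;> simp_all
      subst this
      rw [FreeGroup.mul_mk, FreeGroup.one_eq_mk]
      apply FreeGroup.reduce.exact
      cases b <;> simp
    rw [h1, mul_assoc, h4, mul_one] at h
    refine h.trans ?_
    unfold Pre
    rw [← h2]; simp

lemma pre_induction {r : FreeGroup S} {p : FreeGroup S → Prop} (h0 : p r)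
    (h1 : ∀ (v : FreeGroup S) (m : S × Bool), Pre r v → Pre v (v * lt m) → p v → p (v * lt m)) :
    ∀ v, Pre r v → p v := by
  have : ∀ n : ℕ, ∀ v : FreeGroup S, v.toWord.length = n → Pre r v → p v := by
    intro n
    induction n with
    | zero =>
      intro v hv hr
      have hv1 : v = 1 := by simpa using hv
      subst hv1
      have : r = 1 := by simpa [Pre] using hr
      rwa [this] at h0
    | succ n ih =>
      intro v hv hr
      by_cases hrv : r = v
      · rwa [← hrv]
      have hv1 : v ≠ 1 := by rintro rfl; simp at hv
      obtain ⟨v', m, e, hw⟩ := exists_parent hv1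
      have hr' : Pre r v' := by
        have := hr
        unfold Pre at this
        rw [← hw, List.prefix_concat_iff, hw] at this
        rcases this with h | h
        · exact absurd (FreeGroup.toWord_injective h) hrv
        · exact h
      rw [e]
      refine h1 v' m hr' ?_ (ih v' ?_ hr')
      · unfold Pre; rw [← e, ← hw]; simp
      · rw [← hw] at hv; simpa using hv
  intro v
  exact this _ v rfl

/-- A finite subtree of the Cayley tree containing `1`. -/
def Closed (P : Finset (FreeGroup S)) : Prop :=
  1 ∈ P ∧ ∀ v ∈ P, ∀ r, Pre r v → r ∈ P

open Classical in
lemma closed_step {P : Finset (FreeGroup S)} (hP : Closed P) {r q : FreeGroup S} (hr : r ∈ P)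
    (hq : q ∈ P) (hrq : ¬ Pre r q) :
    Closed (P.filter (fun v => ¬ Pre r v) ∪
      (P.filter (fun v => Pre r v)).image (fun v => q * r⁻¹ * v)) := by
  constructor
  · simp only [Finset.mem_union, Finset.mem_filter]
    exact Or.inl ⟨hP.1, fun h => hrq (h.trans (one_pre q))⟩
  · intro v hv w hw
    simp only [Finset.mem_union, Finset.mem_filter, Finset.mem_image] at hv
    rcases hv with ⟨hv, hrv⟩ | ⟨v, ⟨hv, hrv⟩, rfl⟩
    · simp only [Finset.mem_union, Finset.mem_filter]
      exact Or.inl ⟨hP.2 v hv w hw, fun h => hrv (h.trans hw)⟩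
    · refine pre_induction (r := r) (p := fun v => v ∈ P → ∀ w, Pre w (q * r⁻¹ * v) → w ∈
        P.filter (fun v => ¬ Pre r v) ∪
        (P.filter (fun v => Pre r v)).image (fun v => q * r⁻¹ * v)) ?_ ?_ v hrv hv w hw
      · intro _ w hw
        rw [inv_mul_cancel_right] at hw
        simp only [Finset.mem_union, Finset.mem_filter]
        exact Or.inl ⟨hP.2 q hq w hw, fun h => hrq (h.trans hw)⟩
      · intro v m hrv hvm ih hvP w hw
        rw [← mul_assoc] at hw
        rcases pre_mul_lt hw with h | h
        · exact ih (hP.2 _ hvP _ hvm) w h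
        · simp only [Finset.mem_union, Finset.mem_filter, Finset.mem_image]
          right
          exact ⟨v * lt m, ⟨hvP, hrv.trans hvm⟩, by rw [h]; group⟩

open Classical in
lemma card_step {P : Finset (FreeGroup S)} {r q : FreeGroup S} (hr : r ∈ P)
    (hq : q ∈ P) (hrq : ¬ Pre r q) :
    (P.filter (fun v => ¬ Pre r v) ∪
      (P.filter (fun v => Pre r v)).image (fun v => q * r⁻¹ * v)).card < P.card := by
  have h1 : P.filter (fun v => ¬ Pre r v) ∪
      (P.filter (fun v => Pre r v)).image (fun v => q * r⁻¹ * v) =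
      P.filter (fun v => ¬ Pre r v) ∪
      ((P.filter (fun v => Pre r v)).erase r).image (fun v => q * r⁻¹ * v) := by
    apply subset_antisymm
    · intro v hv
      simp only [Finset.mem_union, Finset.mem_filter, Finset.mem_image, Finset.mem_erase] at hv ⊢
      rcases hv with hv | ⟨w, hw, rfl⟩
      · exact Or.inl hv
      · by_cases h : w = r
        · subst h; left; simpa using ⟨hq, hrq⟩
        · exact Or.inr ⟨w, ⟨h, hw⟩, rfl⟩
    · intro v hv
      simp only [Finset.mem_union, Finset.mem_filter, Finset.mem_image, Finset.mem_erase] at hv ⊢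
      rcases hv with hv | ⟨w, hw, rfl⟩
      · exact Or.inl hv
      · exact Or.inr ⟨w, hw.2, rfl⟩
  rw [h1]
  have h2 := Finset.card_union_le (P.filter (fun v => ¬ Pre r v))
    (((P.filter (fun v => Pre r v)).erase r).image (fun v => q * r⁻¹ * v))
  have h3 := Finset.card_image_le (s := (P.filter (fun v => Pre r v)).erase r)
    (f := fun v => q * r⁻¹ * v)
  have h4 := Finset.card_erase_lt_of_mem (s := P.filter (fun v => Pre r v)) (a := r)
    (by simp [hr, Pre.refl])
  have h5 := Finset.card_filter_add_card_filter_not (s := P) (fun v => Pre r v)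
  omega

end initial_lemmas

variable {X C : Type} [DecidableEq X] [DecidableEq C] [Fintype X] [Fintype C]

/-- The edge of `f` at `t` is carried by the tree `P`. -/
def Rep (P : Finset (FreeGroup (X ⊕ C))) (f : MulAut (FreeGroup (X ⊕ C))) (t : X ⊕ C) : Prop :=
  ∃ p ∈ P, ∃ q ∈ P, ∃ m, f (of t) = p * lt m * q⁻¹ ∧ ∀ c, t = Sum.inr c → p = q ∧ m = (t, true)

open Classical in
lemma step {P : Finset (FreeGroup (X ⊕ C))} (hP : Closed P) {r q : FreeGroup (X ⊕ C)}
    (hr : r ∈ P) (hq : q ∈ P) (hrq : ¬ Pre r q) (f : MulAut (FreeGroup (X ⊕ C))) (s : X ⊕ C)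
    (δ : ℤ) (hs : f (of s) ^ δ = q * r⁻¹) (hsR : Rep (P.filter (fun v => ¬ Pre r v)) f s)
    (hR : ∀ t, t ≠ s → Rep P f t) :
    ∃ h ∈ G X C, ∃ P', Closed P' ∧ P'.card < P.card ∧ ∀ t, Rep P' (f * h) t := by
  choose! p hp q' hq' m hm hc using hR
  obtain ⟨h, hG, h1, h2⟩ := multi s
    (fun t => if t = s then 0 else if Pre r (p t) then δ else 0)
    (fun t => if t = s then 0 else if Pre r (q' t) then -δ else 0)
    (by
      intro c
      by_cases h : Sum.inr c = s
      · simp [h]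
      · rw [← (hc _ h c rfl).1]
        simp only [h, if_false]
        split_ifs <;> simp)
  refine ⟨h, hG, _, closed_step hP hr hq hrq, card_step hr hq hrq, ?_⟩
  intro t
  by_cases ht : t = s
  · subst ht
    obtain ⟨p0, hp0, q0, hq0, m0, e, hc0⟩ := hsR
    exact ⟨p0, Finset.mem_union_left _ hp0, q0, Finset.mem_union_left _ hq0, m0,
      by rw [MulAut.mul_apply, h2, e], hc0⟩
  · have key : ∀ v ∈ P, (if Pre r v then q * r⁻¹ * v else v) ∈ P.filter (fun v => ¬ Pre r v) ∪
        (P.filter (fun v => Pre r v)).image (fun v => q * r⁻¹ * v) := by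
      intro v hv
      split_ifs with hh
      · exact Finset.mem_union_right _ (Finset.mem_image.2 ⟨v, by simp [hv, hh], rfl⟩)
      · exact Finset.mem_union_left _ (by simp [hv, hh])
    refine ⟨_, key _ (hp t ht), _, key _ (hq' t ht), m t, ?_, ?_⟩
    · rw [MulAut.mul_apply, h1 t ht]
      simp only [ht, if_false, map_mul, map_zpow, hm t ht]
      split_ifs <;> simp only [zpow_neg, hs, zpow_zero] <;> group
    · intro c hcc
      obtain ⟨e1, e2⟩ := hc t ht c hcc
      exact ⟨by rw [e1], e2⟩

end Nls

namespace Nls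
open FreeGroup (of)
set_option linter.unusedSectionVars false

variable {X C : Type} [DecidableEq X] [DecidableEq C] [Fintype X] [Fintype C]

/-- The pair `(P, f)` can be reduced. -/
def Red (P : Finset (FreeGroup (X ⊕ C))) (f : MulAut (FreeGroup (X ⊕ C))) : Prop :=
  ∃ h ∈ G X C, ∃ P', Closed P' ∧ P'.card < P.card ∧ ∀ t, Rep P' (f * h) t

lemma pre_antisymm {S : Type} [DecidableEq S] {r q : FreeGroup S} (h : Pre r q) (h' : Pre q r) :
    r = q :=
  FreeGroup.toWord_injective (h.eq_of_length (le_antisymm h.length_le h'.length_le))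

lemma lt_inv {S : Type} (m : S × Bool) : (lt m)⁻¹ = lt (m.1, !m.2) := by
  simp [FreeGroup.inv_mk, FreeGroup.invRev]

lemma not_pre_parent {S : Type} [DecidableEq S] {v v' : FreeGroup S} {m : S × Bool}
    (h : v'.toWord ++ [m] = v.toWord) : Pre v' v ∧ ¬ Pre v v' := by
  constructor
  · unfold Pre; rw [← h]; simp
  · intro h'
    have := h'.length_le
    rw [← h] at this
    simp at this

lemma red1 {P : Finset (FreeGroup (X ⊕ C))} (hP : Closed P) {r q : FreeGroup (X ⊕ C)}
    (hr : r ∈ P) (hq : q ∈ P) (hrq : r ≠ q) (f : MulAut (FreeGroup (X ⊕ C))) (x : X)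
    (hx : f (of (Sum.inl x)) = r * q⁻¹) (hR : ∀ t, t ≠ Sum.inl x → Rep P f t) : Red P f := by
  classical
  by_cases h : Pre r q
  · have h' : ¬ Pre q r := fun h' => hrq (pre_antisymm h h')
    have hq1 : q ≠ 1 := by rintro rfl; exact h' (one_pre _)
    obtain ⟨v, m, e, hw⟩ := exists_parent hq1
    obtain ⟨h1, h2⟩ := not_pre_parent hw
    refine step hP hq hr h' f (Sum.inl x) 1 (by simpa using hx) ?_ hR
    refine ⟨r, by simp [hr, h'], v, by simp [hP.2 q hq v h1, h2], (m.1, !m.2), ?_, by simp⟩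
    rw [hx, ← lt_inv, e]; group
  · have hr1 : r ≠ 1 := by rintro rfl; exact h (one_pre _)
    obtain ⟨v, m, e, hw⟩ := exists_parent hr1
    obtain ⟨h1, h2⟩ := not_pre_parent hw
    refine step hP hr hq h f (Sum.inl x) (-1) (by simp [hx]) ?_ hR
    refine ⟨v, by simp [hP.2 r hr v h1, h2], q, by simp [hq, h], m, ?_, by simp⟩
    rw [hx, e]

lemma red2 {P : Finset (FreeGroup (X ⊕ C))} (hP : Closed P) {p : FreeGroup (X ⊕ C)}
    (f : MulAut (FreeGroup (X ⊕ C))) (c : C)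
    (hp : p ∈ P) (hp' : p * of (Sum.inr c) ∈ P)
    (hx : f (of (Sum.inr c)) = p * of (Sum.inr c) * p⁻¹) (hR : ∀ t, Rep P f t) : Red P f := by
  classical
  by_cases h : Pre (p * of (Sum.inr c)) p
  · have h' : ¬ Pre p (p * of (Sum.inr c)) := by
      intro h'
      have := pre_antisymm h h'
      simp at this
    refine step hP hp hp' h' f (Sum.inr c) 1 (by simpa using hx) ?_ (fun t _ => hR t)
    refine ⟨p * of (Sum.inr c), by simp [hp', h'], p * of (Sum.inr c), by simp [hp', h'],
      (Sum.inr c, true), ?_, by simp⟩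
    rw [hx]; change _ = p * of (Sum.inr c) * of (Sum.inr c) * _; group
  · refine step hP hp' hp h f (Sum.inr c) (-1) (by simp [hx, mul_assoc]) ?_ (fun t _ => hR t)
    exact ⟨p, by simp [hp, h], p, by simp [hp, h], (Sum.inr c, true), hx, by simp⟩

lemma red_fold {P : Finset (FreeGroup (X ⊕ C))} (hP : Closed P) {r q : FreeGroup (X ⊕ C)}
    (hr : r ∈ P) (hq : q ∈ P) (hrq : r ≠ q) (f : MulAut (FreeGroup (X ⊕ C))) (x : X)
    (s : X ⊕ C) (hs : s ≠ Sum.inl x) (i j : ℤ)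
    (hx : f (of s) ^ i * f (of (Sum.inl x)) * f (of s) ^ j = r * q⁻¹)
    (hR : ∀ t, Rep P f t) : Red P f := by
  obtain ⟨g, hg, h1, h2⟩ := exists_LR x s hs i j
  obtain ⟨h, hh, P', a, b, c⟩ := red1 hP hr hq hrq (f * g) x
    (by rw [MulAut.mul_apply, h1, ← hx]; simp) (by
      intro t ht
      obtain ⟨p, hp, q, hq, m, e, hc⟩ := hR t
      exact ⟨p, hp, q, hq, m, by rw [MulAut.mul_apply, h2 t ht, e], hc⟩)
  exact ⟨g * h, mul_mem hg hh, P', a, b, by simpa [mul_assoc] using c⟩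

/-- Positive version of `Rep`. -/
def RepP (P : Finset (FreeGroup (X ⊕ C))) (f : MulAut (FreeGroup (X ⊕ C))) (t : X ⊕ C) : Prop :=
  ∃ p ∈ P, ∃ q ∈ P, ∃ a, f (of t) = p * of a * q⁻¹ ∧ ∀ c, t = Sum.inr c → p = q ∧ a = t

lemma RepP.rep {P : Finset (FreeGroup (X ⊕ C))} {f : MulAut (FreeGroup (X ⊕ C))} {t : X ⊕ C}
    (h : RepP P f t) : Rep P f t := by
  obtain ⟨p, hp, q, hq, a, e, hc⟩ := h
  exact ⟨p, hp, q, hq, (a, true), e, fun c h => ⟨(hc c h).1, by rw [(hc c h).2]⟩⟩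

lemma multi_inv (Q : Finset X) : ∃ h ∈ G X C,
    (∀ x ∈ Q, h (of (Sum.inl x)) = (of (Sum.inl x))⁻¹) ∧
    (∀ x, x ∉ Q → h (of (Sum.inl x)) = of (Sum.inl x)) ∧
    ∀ c, h (of (Sum.inr c)) = of (Sum.inr c) := by
  induction Q using Finset.induction_on with
  | empty => exact ⟨1, one_mem _, by simp, by simp, by simp⟩
  | insert y Q hy ih =>
    obtain ⟨h, hG, h1, h2, h3⟩ := ih
    obtain ⟨g, hg, g1, g2⟩ := exists_inv_G (C := C) y
    refine ⟨h * g, mul_mem hG hg, ?_, ?_, ?_⟩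
    · intro x hx
      by_cases hxy : x = y
      · subst hxy; simp [g1, h2 x hy]
      · have hx' : x ∈ Q := by simpa [hxy] using hx
        simp [g2 (Sum.inl x) (by simpa using hxy), h1 x hx']
    · intro x hx
      simp only [Finset.mem_insert, not_or] at hx
      simp [g2 (Sum.inl x) (by simpa using hx.1), h2 x hx.2]
    · intro c
      simp [g2 (Sum.inr c) (by simp), h3]

lemma normalise {P : Finset (FreeGroup (X ⊕ C))} {f : MulAut (FreeGroup (X ⊕ C))}
    (h : ∀ t, Rep P f t) : ∃ g ∈ G X C, ∀ t, RepP P (f * g) t := by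
  choose p hp q hq m e hc using h
  obtain ⟨g, hG, h1, h2, h3⟩ := multi_inv (C := C)
    (Finset.univ.filter (fun x => (m (Sum.inl x)).2 = false))
  refine ⟨g, hG, ?_⟩
  rintro (x | c)
  · by_cases hx : (m (Sum.inl x)).2 = false
    · refine ⟨q _, hq (Sum.inl x), p _, hp (Sum.inl x), (m (Sum.inl x)).1, ?_, by simp⟩
      rw [MulAut.mul_apply, h1 x (by simp [hx]), map_inv, e, mul_inv_rev, mul_inv_rev, lt_inv, hx]
      simp [lt, of, mul_assoc]
    · refine ⟨p _, hp (Sum.inl x), q _, hq (Sum.inl x), (m (Sum.inl x)).1, ?_, by simp⟩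
      rw [MulAut.mul_apply, h2 x (by simp [hx]), e]
      have : m (Sum.inl x) = ((m (Sum.inl x)).1, true) := by ext <;> simp_all
      rw [this]; rfl
  · obtain ⟨e1, e2⟩ := hc (Sum.inr c) c rfl
    refine ⟨p _, hp (Sum.inr c), q _, hq (Sum.inr c), Sum.inr c, ?_, fun _ _ => ⟨e1, rfl⟩⟩
    rw [MulAut.mul_apply, h3, e, e2]; rfl

/-- The edges labelled `a` of the graph. -/
def Edge (P : Finset (FreeGroup (X ⊕ C))) (f : MulAut (FreeGroup (X ⊕ C))) (a : X ⊕ C)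
    (p q : FreeGroup (X ⊕ C)) : Prop :=
  p ∈ P ∧ q ∈ P ∧ (q = p * of a ∨
    ∃ t, f (of t) = p * of a * q⁻¹ ∧ ∀ c, t = Sum.inr c → p = q ∧ a = t)

lemma fold_out {P : Finset (FreeGroup (X ⊕ C))} (hP : Closed P) {f : MulAut (FreeGroup (X ⊕ C))}
    (hR : ∀ t, Rep P f t) {a : X ⊕ C} {p q q' : FreeGroup (X ⊕ C)} (h : Edge P f a p q)
    (h' : Edge P f a p q') (hne : q ≠ q') : Red P f := by
  obtain ⟨hp, hq, h⟩ := h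
  obtain ⟨-, hq', h'⟩ := h'
  have tree : ∀ q q', q ∈ P → q' ∈ P → q ≠ q' → q = p * of a →
      (∃ t, f (of t) = p * of a * q'⁻¹ ∧ ∀ c, t = Sum.inr c → p = q' ∧ a = t) → Red P f := by
    rintro q q' hq hq' hne h ⟨t, e, hc⟩
    cases t with
    | inl x => exact red1 hP hq hq' hne f x (by rw [e, h]) (fun t _ => hR t)
    | inr c =>
      obtain ⟨e1, e2⟩ := hc c rfl
      subst e1 e2
      exact red2 hP f c hp (h ▸ hq) e hR
  rcases h with h | h
  · rcases h' with h' | h'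
    · exact absurd (h.trans h'.symm) hne
    · exact tree q q' hq hq' hne h h'
  · rcases h' with h' | h'
    · exact tree q' q hq' hq hne.symm h' h
    · obtain ⟨t, e, hc⟩ := h
      obtain ⟨t', e', hc'⟩ := h'
      have htt : t ≠ t' := by
        rintro rfl
        rw [e] at e'
        exact hne (by simpa using e')
      cases t' with
      | inl x =>
        exact red_fold hP hq hq' hne f x t htt (-1) 0 (by rw [e, e']; group) hR
      | inr c' =>
        cases t with
        | inl x =>
          exact red_fold hP hq' hq hne.symm f x _ htt.symm (-1) 0 (by rw [e, e']; group) hR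
        | inr c =>
          exact absurd ((hc c rfl).2.symm.trans (hc' c' rfl).2) htt

lemma fold_in {P : Finset (FreeGroup (X ⊕ C))} (hP : Closed P) {f : MulAut (FreeGroup (X ⊕ C))}
    (hR : ∀ t, Rep P f t) {a : X ⊕ C} {p q q' : FreeGroup (X ⊕ C)} (h : Edge P f a q p)
    (h' : Edge P f a q' p) (hne : q ≠ q') : Red P f := by
  obtain ⟨hq, hp, h⟩ := h
  obtain ⟨hq', -, h'⟩ := h'
  have tree : ∀ q q', q ∈ P → q' ∈ P → q ≠ q' → p = q * of a →
      (∃ t, f (of t) = q' * of a * p⁻¹ ∧ ∀ c, t = Sum.inr c → q' = p ∧ a = t) → Red P f := by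
    rintro q q' hq hq' hne h ⟨t, e, hc⟩
    cases t with
    | inl x => exact red1 hP hq' hq hne.symm f x (by rw [e, h]; group) (fun t _ => hR t)
    | inr c =>
      obtain ⟨e1, e2⟩ := hc c rfl
      subst e1 e2
      exact red2 hP f c hq (h ▸ hp) (by rw [e, h]; group) hR
  rcases h with h | h
  · rcases h' with h' | h'
    · exact absurd (mul_right_cancel (h.symm.trans h')) hne
    · exact tree q q' hq hq' hne h h'
  · rcases h' with h' | h'
    · exact tree q' q hq' hq hne.symm h' h
    · obtain ⟨t, e, hc⟩ := h
      obtain ⟨t', e', hc'⟩ := h'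
      have htt : t ≠ t' := by
        rintro rfl
        rw [e] at e'
        exact hne (by simpa using e')
      cases t' with
      | inl x =>
        exact red_fold hP hq' hq hne.symm f x t htt 0 (-1) (by rw [e, e']; group) hR
      | inr c' =>
        cases t with
        | inl x =>
          exact red_fold hP hq hq' hne f x _ htt.symm 0 (-1) (by rw [e, e']; group) hR
        | inr c =>
          exact absurd ((hc c rfl).2.symm.trans (hc' c' rfl).2) htt

lemma extend_perm {α : Type} [Fintype α] (R : α → α → Prop)
    (h1 : ∀ p q q', R p q → R p q' → q = q') (h2 : ∀ p q q', R q p → R q' p → q = q') :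
    ∃ σ : Equiv.Perm α, ∀ p q, R p q → σ p = q := by
  classical
  have h : ∀ p, ∃ q, (∃ q', R p q') → R p q := by
    intro p
    by_cases h : ∃ q', R p q'
    · exact ⟨h.choose, fun _ => h.choose_spec⟩
    · exact ⟨p, fun h' => absurd h' h⟩
  choose f hf using h
  obtain ⟨g, hg⟩ := Finset.exists_equiv_extend_of_card_eq (α := α) (t := (Finset.univ : Finset α))
    (s := Finset.univ.filter (fun p => ∃ q, R p q)) (f := f) (by simp) (by simp) (by
      intro p hp q hq hpq
      simp only [Finset.coe_filter, Finset.mem_univ, true_and] at hp hq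
      have e1 := hf p hp
      have e2 := hf q hq
      rw [hpq] at e1
      exact h2 _ _ _ e1 e2)
  refine ⟨g.trans (Equiv.subtypeUnivEquiv (by simp)), ?_⟩
  intro p q hpq
  have := hg p (by simpa using ⟨q, hpq⟩)
  simp only [Equiv.trans_apply, Equiv.subtypeUnivEquiv_apply]
  rw [this]
  exact h1 _ _ _ (hf p ⟨q, hpq⟩) hpq

lemma terminal {P : Finset (FreeGroup (X ⊕ C))} (hP : Closed P) {f : MulAut (FreeGroup (X ⊕ C))}
    (hR : ∀ t, RepP P f t)
    (h1 : ∀ a p q q', Edge P f a p q → Edge P f a p q' → q = q')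
    (h2 : ∀ a p q q', Edge P f a q p → Edge P f a q' p → q = q') (p : FreeGroup (X ⊕ C))
    (hp : p ∈ P) : p = 1 := by
  classical
  have : ∀ a, ∃ σ : Equiv.Perm P, ∀ p q : P, Edge P f a p q → σ p = q := by
    intro a
    apply extend_perm (fun p q : P => Edge P f a p q)
    · intro p q q' h h'; exact Subtype.ext (h1 _ _ _ _ h h')
    · intro p q q' h h'; exact Subtype.ext (h2 _ _ _ _ h h')
  choose σ hσ using this
  let Φ : FreeGroup (X ⊕ C) →* Equiv.Perm P := FreeGroup.lift (fun a => (σ a)⁻¹)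
  let o : P := ⟨1, hP.1⟩
  have hΦ : ∀ a, (Φ (of a))⁻¹ = σ a := by intro a; simp [Φ]
  have key : ∀ p, Pre 1 p → ∀ hp : p ∈ P, (Φ p)⁻¹ o = ⟨p, hp⟩ := by
    apply pre_induction
    · intro _; simp [o]
    · intro v m _ hv ih hp
      have hvP := hP.2 _ hp _ hv
      rw [map_mul, mul_inv_rev, Equiv.Perm.mul_apply, ih hvP]
      obtain ⟨a, b⟩ := m
      cases b
      · have e : lt (a, false) = (of a)⁻¹ := by rw [of, lt_inv]; rfl
        rw [Equiv.Perm.inv_eq_iff_eq]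
        simp only [e, map_inv, hΦ]
        symm
        apply hσ
        exact ⟨hp, hvP, Or.inl (by simp)⟩
      · have e : lt (a, true) = of a := rfl
        simp only [e, hΦ]
        apply hσ
        exact ⟨hvP, hp, Or.inl rfl⟩
  have app : ∀ (τ : Equiv.Perm P) (u : P), τ (τ⁻¹ u) = u := fun τ u => by
    rw [← Equiv.Perm.mul_apply, mul_inv_cancel, Equiv.Perm.one_apply]
  have fixf : ∀ t, Φ (f (of t)) o = o := by
    intro t
    obtain ⟨p, hp, q, hq, a, e, hc⟩ := hR t
    have e1 := key p (one_pre p) hp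
    have e2 := key q (one_pre q) hq
    have e3 := hσ a ⟨p, hp⟩ ⟨q, hq⟩ ⟨hp, hq, Or.inr ⟨t, e, hc⟩⟩
    rw [e, map_mul, map_mul, map_inv, Equiv.Perm.mul_apply, Equiv.Perm.mul_apply, e2, ← e3, ← hΦ a,
      app, ← e1, app]
  have fixall : ∀ w, Φ (f w) o = o := by
    intro w
    induction w using FreeGroup.induction_on with
    | C1 => simp
    | of t => exact fixf t
    | inv_of t h =>
      rw [map_inv, map_inv, Equiv.Perm.inv_eq_iff_eq]; exact h.symm
    | mul x y hx hy => rw [map_mul, map_mul, Equiv.Perm.mul_apply, hy, hx]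
  have h3 := key p (one_pre p) hp
  rw [Equiv.Perm.inv_eq_iff_eq] at h3
  have h4 := fixall (f⁻¹ p)
  rw [MulAut.apply_inv_self] at h4
  have h5 := (Φ p).injective (h4.trans h3)
  have := congrArg Subtype.val h5
  exact this.symm

lemma final {f : MulAut (FreeGroup (X ⊕ C))} (hR : ∀ t, RepP {1} f t) : f ∈ G X C := by
  have h1 : ∀ x, ∃ a, f (of (Sum.inl x)) = of a := by
    intro x
    obtain ⟨p, hp, q, hq, a, e, -⟩ := hR (Sum.inl x)
    simp only [Finset.mem_singleton] at hp hq
    subst hp hq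
    exact ⟨a, by simpa using e⟩
  have h2 : ∀ c, f (of (Sum.inr c)) = of (Sum.inr c) := by
    intro c
    obtain ⟨p, hp, q, hq, a, e, hc⟩ := hR (Sum.inr c)
    simp only [Finset.mem_singleton] at hp hq
    subst hp hq
    rw [(hc c rfl).2] at e
    simpa using e
  have h3 : ∀ x, ∃ y, f (of (Sum.inl x)) = of (Sum.inl y) := by
    intro x
    obtain ⟨a, e⟩ := h1 x
    cases a with
    | inl y => exact ⟨y, e⟩
    | inr c =>
      rw [← h2 c] at e
      have := FreeGroup.of_injective (f.injective e)
      simp at this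
  choose e he using h3
  have hinj : Function.Injective e := by
    intro x y h
    have : f (of (Sum.inl x)) = f (of (Sum.inl y)) := by rw [he, he, h]
    simpa using FreeGroup.of_injective (f.injective this)
  refine Subgroup.subset_closure (Or.inr (Or.inl
    ⟨Equiv.ofBijective e (Finite.injective_iff_bijective.1 hinj), he, h2⟩))

lemma main_aux (n : ℕ) : ∀ (P : Finset (FreeGroup (X ⊕ C))) (f : MulAut (FreeGroup (X ⊕ C))),
    P.card ≤ n → Closed P → (∀ t, Rep P f t) → f ∈ G X C := by
  induction n with
  | zero =>
    intro P f hn hP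
    have : P = ∅ := by simpa using hn
    subst this
    simpa using hP.1
  | succ n ih =>
    intro P f hn hP hR
    obtain ⟨g, hg, hR'⟩ := normalise hR
    have hfg : f * g ∈ G X C → f ∈ G X C := fun h => (mul_mem_cancel_right hg).1 h
    apply hfg
    by_cases hred : Red P (f * g)
    · obtain ⟨h, hh, P', hP', hc, hr⟩ := hred
      exact (mul_mem_cancel_right hh).1 (ih P' _ (by omega) hP' hr)
    · have := terminal hP hR'
        (fun a p q q' h h' => by
          by_contra hne
          exact hred (fold_out hP (fun t => (hR' t).rep) h h' hne))
        (fun a p q q' h h' => by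
          by_contra hne
          exact hred (fold_in hP (fun t => (hR' t).rep) h h' hne))
      have hP1 : P = {1} := by
        ext p
        simp only [Finset.mem_singleton]
        exact ⟨this p, fun h => h ▸ hP.1⟩
      subst hP1
      exact final hR'

/-- The set of prefixes. -/
noncomputable def prefixes {S : Type} [DecidableEq S] (v : FreeGroup S) : Finset (FreeGroup S) :=
  (v.toWord.inits.map FreeGroup.mk).toFinset

lemma mem_prefixes {S : Type} [DecidableEq S] (v r : FreeGroup S) : r ∈ prefixes v ↔ Pre r v := by
  simp only [prefixes, List.mem_toFinset, List.mem_map, List.mem_inits]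
  constructor
  · rintro ⟨w, hw, rfl⟩
    unfold Pre
    rwa [toWord_mk_of_initial hw]
  · intro h
    exact ⟨r.toWord, h, FreeGroup.mk_toWord⟩

theorem mem_G (f : MulAut (FreeGroup (X ⊕ C)))
    (hf : ∀ c, IsConj (of (Sum.inr c)) (f (of (Sum.inr c)))) : f ∈ G X C := by
  have h : ∀ t, ∃ p q m, f (of t) = p * lt m * q⁻¹ ∧ ∀ c, t = Sum.inr c → p = q ∧ m = (t, true) := by
    rintro (x | c)
    · have : f (of (Sum.inl x)) ≠ 1 := by
        intro h
        have := f.map_eq_one_iff.1 h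
        simp at this
      obtain ⟨v, m, e, -⟩ := exists_parent this
      exact ⟨v, 1, m, by simpa using e, by simp⟩
    · obtain ⟨w, hw⟩ := isConj_iff.1 (hf c)
      exact ⟨w, w, (Sum.inr c, true), hw.symm, by simp⟩
  choose p q m e hc using h
  let P : Finset (FreeGroup (X ⊕ C)) :=
    insert 1 (Finset.univ.biUnion (fun t => prefixes (p t) ∪ prefixes (q t)))
  refine main_aux P.card P f le_rfl ?_ ?_
  · refine ⟨by simp [P], ?_⟩
    intro v hv r hr
    simp only [P, Finset.mem_insert, Finset.mem_biUnion, Finset.mem_univ, true_and,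
      Finset.mem_union, mem_prefixes] at hv ⊢
    rcases hv with rfl | ⟨t, h | h⟩
    · left; simpa [Pre] using hr
    · exact Or.inr ⟨t, Or.inl (hr.trans h)⟩
    · exact Or.inr ⟨t, Or.inr (hr.trans h)⟩
  · intro t
    refine ⟨p t, ?_, q t, ?_, m t, e t, hc t⟩
    · simp only [P, Finset.mem_insert, Finset.mem_biUnion, Finset.mem_univ, true_and,
        Finset.mem_union, mem_prefixes]
      exact Or.inr ⟨t, Or.inl (Pre.refl _)⟩
    · simp only [P, Finset.mem_insert, Finset.mem_biUnion, Finset.mem_univ, true_and,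
        Finset.mem_union, mem_prefixes]
      exact Or.inr ⟨t, Or.inr (Pre.refl _)⟩

end Nls

namespace Nls
open FreeGroup (of)
set_option linter.unusedSectionVars false

section conj
variable {S : Type}

lemma map_Fm {g : MulAut (FreeGroup S)} {t : S} {M : Subgroup (FreeGroup S)}
    (h : ∀ s, s ≠ t → g (of s) ∈ M) {w : FreeGroup S} (hw : w ∈ Fm t) : g w ∈ M := by
  induction hw using Subgroup.closure_induction with
  | mem x hx => obtain ⟨s, hs, rfl⟩ := hx; exact h s hs
  | one => simp
  | mul x y _ _ hx hy => rw [map_mul]; exact mul_mem hx hy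
  | inv x _ hx => rw [map_inv]; exact inv_mem hx

lemma IsTw.conj {g h : MulAut (FreeGroup S)} {t t' : S} {a b : FreeGroup S}
    (hh : IsTw h t a b) (hg : g (of t) = of t') (hg' : ∀ s, s ≠ t' → g⁻¹ (of s) ∈ Fm t) :
    IsTw (g * h * g⁻¹) t' (g a) (g b) := by
  refine ⟨?_, fun s hs => ?_⟩
  · have : g⁻¹ (of t') = of t := by rw [← hg, MulAut.inv_apply_self]
    simp only [MulAut.mul_apply, this, hh.1, map_mul, hg]
  · simp only [MulAut.mul_apply]
    rw [hh.fix (hg' s hs), MulAut.apply_inv_self]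

lemma IsTw.inv_mem_Fm {g : MulAut (FreeGroup S)} {s t : S} {a b : FreeGroup S}
    (hg : IsTw g s a b) (ha : a ∈ Fm s) (hb : b ∈ Fm s) (ha' : a ∈ Fm t) (hb' : b ∈ Fm t)
    (r : S) (hr : r ≠ t) : g⁻¹ (of r) ∈ Fm t := by
  have h := hg.inv ha hb
  by_cases hrs : r = s
  · subst hrs
    rw [h.1]
    exact mul_mem (mul_mem (inv_mem ha') (of_mem_Fm hr)) (inv_mem hb')
  · rw [h.2 r hrs]; exact of_mem_Fm hr

lemma IsTw.conj' {g h : MulAut (FreeGroup S)} {s t : S} {a b c d : FreeGroup S}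
    (hg : IsTw g s a b) (hst : t ≠ s) (ha : a ∈ Fm s) (hb : b ∈ Fm s) (ha' : a ∈ Fm t)
    (hb' : b ∈ Fm t) (hh : IsTw h t c d) : IsTw (g * h * g⁻¹) t (g c) (g d) :=
  hh.conj (hg.2 t hst) (hg.inv_mem_Fm ha hb ha' hb')

end conj

variable {X Y Z : Type} [DecidableEq X] [DecidableEq Y] [DecidableEq Z]

/-- The generating set `X ∪ Y ∪ Z`. -/
abbrev Sg (X Y Z : Type) := X ⊕ (Y ⊕ Z)

/-- Inclusion of `X ∪ Z`. -/
def em (Y : Type) (t : X ⊕ Z) : Sg X Y Z := Sum.map id Sum.inr t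

/-- Inclusion of `Y`. -/
def ye (X Z : Type) (y : Y) : Sg X Y Z := Sum.inr (Sum.inl y)

lemma em_inj {t t' : X ⊕ Z} : em Y t = em Y t' ↔ t = t' := by
  cases t <;> cases t' <;> simp [em]

lemma em_ne_ye (t : X ⊕ Z) (y : Y) : em Y t ≠ ye X Z y := by
  cases t <;> simp [em, ye]

lemma ye_ne_em (t : X ⊕ Z) (y : Y) : ye X Z y ≠ em Y t := (em_ne_ye t y).symm

lemma ye_inj {y y' : Y} : ye X Z y = ye X Z y' ↔ y = y' := by simp [ye]

lemma cases_sg (s : Sg X Y Z) : (∃ t, s = em Y t) ∨ ∃ y, s = ye X Z y := by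
  rcases s with x | y | z
  · exact Or.inl ⟨Sum.inl x, rfl⟩
  · exact Or.inr ⟨y, rfl⟩
  · exact Or.inl ⟨Sum.inr z, rfl⟩

/-- The right factor: `1` for `X` and `w⁻¹` for `Z`. -/
def rf {M : Type} [Group M] (t : X ⊕ Z) (w : M) : M := Sum.elim (fun _ => 1) (fun _ => w⁻¹) t

lemma rf_mem {S : Type} {M : Subgroup (FreeGroup S)} (t : X ⊕ Z) {w : FreeGroup S} (hw : w ∈ M) :
    rf t w ∈ M := by
  cases t with
  | inl x => exact one_mem _
  | inr z => exact inv_mem hw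

lemma rf_mul {M : Type} [Group M] (t : X ⊕ Z) (w w' : M) : rf t (w' * w) = rf t w * rf t w' := by
  cases t <;> simp [rf]

lemma rf_inv {M : Type} [Group M] (t : X ⊕ Z) (w : M) : rf t w⁻¹ = (rf t w)⁻¹ := by
  cases t <;> simp [rf]

lemma map_rf {M : Type} [Group M] (g : MulAut M) (t : X ⊕ Z) (w : M) : g (rf t w) = rf t (g w) := by
  cases t <;> simp [rf]

/-- The generators of the kernel. -/
def HSet (X Y Z : Type) : Set (MulAut (FreeGroup (Sg X Y Z))) :=
  {g | (∃ (t : X ⊕ Z) (y : Y), IsTw g (em Y t) (of (ye X Z y)) (rf t (of (ye X Z y)))) ∨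
    (∃ (y : Y) (t : X ⊕ Z), IsTw g (ye X Z y) (of (em Y t)) (of (em Y t))⁻¹)}

/-- The subgroup generated by `HSet`. -/
def H (X Y Z : Type) : Subgroup (MulAut (FreeGroup (Sg X Y Z))) := Subgroup.closure (HSet X Y Z)

/-- The free subgroup on `X ∪ Z`. -/
def FXZ (X Y Z : Type) : Subgroup (FreeGroup (Sg X Y Z)) :=
  Subgroup.closure (Set.range (fun t : X ⊕ Z => of (em Y t)))

lemma em_mem_FXZ (t : X ⊕ Z) : of (em Y t) ∈ FXZ X Y Z := Subgroup.subset_closure ⟨t, rfl⟩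

lemma FXZ_le (y : Y) : FXZ X Y Z ≤ Fm (ye X Z y) := by
  rw [FXZ, Subgroup.closure_le]
  rintro _ ⟨t, rfl⟩
  exact of_mem_Fm (em_ne_ye t y)

lemma h1 (y : Y) (w : FreeGroup (Sg X Y Z)) (hw : w ∈ FXZ X Y Z) :
    ∃ g ∈ H X Y Z, IsTw g (ye X Z y) w w⁻¹ := by
  have aux : w ∈ FXZ X Y Z ∧ ∃ g ∈ H X Y Z, IsTw g (ye X Z y) w w⁻¹ := by
    induction hw using Subgroup.closure_induction with
    | mem x hx =>
      obtain ⟨t, rfl⟩ := hx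
      have hm := of_mem_Fm (em_ne_ye t y)
      have h := isTw_tw (ye X Z y) (of (em Y t)) (of (em Y t))⁻¹ hm (inv_mem hm)
      exact ⟨em_mem_FXZ t, _, Subgroup.subset_closure (Or.inr ⟨y, t, h⟩), h⟩
    | one => exact ⟨one_mem _, 1, one_mem _, by simpa using IsTw.one _⟩
    | mul a b _ _ ha hb =>
      obtain ⟨ha, g, hg, ga⟩ := ha
      obtain ⟨hb, g', hg', gb⟩ := hb
      refine ⟨mul_mem ha hb, g' * g, mul_mem hg' hg, ?_⟩
      have := gb.mul ga (FXZ_le y ha) (inv_mem (FXZ_le y ha))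
      rwa [mul_inv_rev]
    | inv a _ ha =>
      obtain ⟨ha, g, hg, ga⟩ := ha
      exact ⟨inv_mem ha, g⁻¹, inv_mem hg, ga.inv (FXZ_le y ha) (inv_mem (FXZ_le y ha))⟩
  exact aux.2

lemma exists_tau (t : X ⊕ Z) (y : Y) :
    ∃ g ∈ H X Y Z, IsTw g (em Y t) (of (ye X Z y)) (rf t (of (ye X Z y))) := by
  have hm := of_mem_Fm (ye_ne_em t y)
  have h := isTw_tw (em Y t) (of (ye X Z y)) (rf t (of (ye X Z y))) hm (rf_mem t hm)
  exact ⟨_, Subgroup.subset_closure (Or.inl ⟨t, y, h⟩), h⟩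

lemma h2 [Nonempty X] (y y' : Y) (hy : y' ≠ y) :
    ∃ g ∈ H X Y Z, IsTw g (ye X Z y) (of (ye X Z y')) (of (ye X Z y'))⁻¹ := by
  obtain ⟨x⟩ := ‹Nonempty X›
  obtain ⟨L, hL, L1⟩ := exists_tau (Y := Y) (Sum.inl x : X ⊕ Z) y'
  obtain ⟨c, hc, c1⟩ := h1 y _ (em_mem_FXZ (Y := Y) (Sum.inl x : X ⊕ Z))
  have hm : of (ye X Z y') ∈ Fm (ye X Z y) := of_mem_Fm (by simpa [ye_inj] using hy)
  have hm' : of (ye X Z y') ∈ Fm (em Y (Sum.inl x : X ⊕ Z)) := of_mem_Fm (ye_ne_em _ _)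
  have hx : of (em Y (Sum.inl x : X ⊕ Z)) ∈ Fm (ye X Z y) := of_mem_Fm (em_ne_ye _ _)
  have k := L1.conj' (ye_ne_em _ y) hm' (rf_mem _ hm') hm (rf_mem _ hm) c1
  have ci := c1.inv hx (inv_mem hx)
  rw [map_inv, L1.1] at k
  have r : rf (Sum.inl x : X ⊕ Z) (of (ye X Z y')) = 1 := rfl
  rw [r, mul_one] at k
  refine ⟨_, mul_mem (inv_mem hc) (mul_mem (mul_mem hL hc) (inv_mem hL)), ?_⟩
  have := ci.mul k (mul_mem hm hx) (inv_mem (mul_mem hm hx))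
  simpa [mul_assoc] using this

lemma h3 (x : X) (y : Y) :
    ∃ g ∈ H X Y Z, IsTw g (em Y (Sum.inl x : X ⊕ Z)) 1 (of (ye X Z y)) := by
  obtain ⟨L, hL, L1⟩ := exists_tau (Y := Y) (Sum.inl x : X ⊕ Z) y
  obtain ⟨c, hc, c1⟩ := h1 y _ (em_mem_FXZ (Y := Y) (Sum.inl x : X ⊕ Z))
  have hx : of (em Y (Sum.inl x : X ⊕ Z)) ∈ Fm (ye X Z y) := of_mem_Fm (em_ne_ye _ _)
  have ci := c1.inv hx (inv_mem hx)
  have r : rf (Sum.inl x : X ⊕ Z) (of (ye X Z y)) = 1 := rfl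
  rw [r] at L1
  have Ly := L1.2 _ (ye_ne_em (Sum.inl x : X ⊕ Z) y)
  have cx := c1.2 _ (em_ne_ye (Sum.inl x : X ⊕ Z) y)
  refine ⟨_, mul_mem (mul_mem hc hL) (inv_mem hc), ?_, ?_⟩
  · simp only [MulAut.mul_apply, ci.2 _ (em_ne_ye (Sum.inl x : X ⊕ Z) y), L1.1, map_mul, c1.1, cx]
    simp
  · intro s hs
    by_cases hsy : s = ye X Z y
    · subst hsy
      simp only [MulAut.mul_apply, ci.1, map_mul, map_inv, L1.1, Ly, c1.1, cx]
      simp only [map_one]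
      group
    · simp only [MulAut.mul_apply, ci.2 s hsy, L1.2 s hs, c1.2 s hsy]

/-- The transvections at `t` in `H`. -/
def O (t : X ⊕ Z) (w : FreeGroup (Sg X Y Z)) : Prop :=
  w ∈ Fm (em Y t) ∧ ∃ g ∈ H X Y Z, IsTw g (em Y t) w (rf t w)

lemma O_y (t : X ⊕ Z) (y : Y) : O t (of (ye X Z y)) :=
  ⟨of_mem_Fm (ye_ne_em t y), exists_tau t y⟩

lemma O_one (t : X ⊕ Z) : O t (1 : FreeGroup (Sg X Y Z)) :=
  ⟨one_mem _, 1, one_mem _, by cases t <;> simpa [rf] using IsTw.one _⟩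

lemma O.mul {t : X ⊕ Z} {w w' : FreeGroup (Sg X Y Z)} (h : O t w) (h' : O t w') :
    O t (w * w') := by
  obtain ⟨m, g, hg, h⟩ := h
  obtain ⟨m', g', hg', h'⟩ := h'
  refine ⟨mul_mem m m', g' * g, mul_mem hg' hg, ?_⟩
  rw [rf_mul]
  exact h'.mul h m (rf_mem t m)

lemma O.inv {t : X ⊕ Z} {w : FreeGroup (Sg X Y Z)} (h : O t w) : O t w⁻¹ := by
  obtain ⟨m, g, hg, h⟩ := h
  refine ⟨inv_mem m, g⁻¹, inv_mem hg, ?_⟩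
  rw [rf_inv]
  exact h.inv m (rf_mem t m)

lemma O_conj (t v : X ⊕ Z) (y : Y) (hv : v ≠ t) (u : FreeGroup (Sg X Y Z))
    (hu : u = of (em Y v) ∨ u = (of (em Y v))⁻¹) : O t (u * of (ye X Z y) * u⁻¹) := by
  have hv' : of (em Y v) ∈ Fm (em Y t) := of_mem_Fm (by simpa [em_inj] using hv)
  have hut : u ∈ Fm (em Y t) := by
    rcases hu with rfl | rfl
    · exact hv'
    · exact inv_mem hv'
  have hux : u ∈ FXZ X Y Z := by
    rcases hu with rfl | rfl
    · exact em_mem_FXZ v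
    · exact inv_mem (em_mem_FXZ v)
  have huy := FXZ_le y hux
  obtain ⟨c, hc, c1⟩ := h1 y u hux
  obtain ⟨g, hg, g1⟩ := exists_tau (Y := Y) t y
  have := c1.conj' (em_ne_ye t y) huy (inv_mem huy) hut (inv_mem hut) g1
  rw [map_rf, c1.1] at this
  exact ⟨mul_mem (mul_mem hut (of_mem_Fm (ye_ne_em t y))) (inv_mem hut), _,
    mul_mem (mul_mem hc hg) (inv_mem hc), this⟩

/-- Automorphisms fixing `Y` and preserving the free group on `X ∪ Z`. -/
def T' (X Y Z : Type) : Subgroup (MulAut (FreeGroup (Sg X Y Z))) where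
  carrier := {g | (∀ y, g (of (ye X Z y)) = of (ye X Z y)) ∧
    ∀ w, g w ∈ FXZ X Y Z ↔ w ∈ FXZ X Y Z}
  one_mem' := by simp
  mul_mem' := by
    rintro a b ⟨h1, h2⟩ ⟨h3, h4⟩
    exact ⟨fun y => by rw [MulAut.mul_apply, h3, h1], fun w => by rw [MulAut.mul_apply, h2, h4]⟩
  inv_mem' := by
    rintro a ⟨h1, h2⟩
    refine ⟨fun y => ?_, fun w => ?_⟩
    · apply a.injective; rw [MulAut.apply_inv_self, h1]
    · rw [← h2, MulAut.apply_inv_self]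

/-- The generators not involving `Y`. -/
def TSet (X Y Z : Type) : Set (MulAut (FreeGroup (Sg X Y Z))) :=
  {g | (∃ x, IsInv g x) ∨ (∃ e, IsPerm g e) ∨
    (∃ t v : X ⊕ Z, v ≠ t ∧ IsTw g (em Y t) (of (em Y v)) (rf t (of (em Y v))))}

lemma mem_T'_aux {g : MulAut (FreeGroup (Sg X Y Z))}
    (hy : ∀ y, g (of (ye X Z y)) = of (ye X Z y))
    (h : ∀ t, g (of (em Y t)) ∈ FXZ X Y Z) (h' : ∀ t, g⁻¹ (of (em Y t)) ∈ FXZ X Y Z) :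
    g ∈ T' X Y Z := by
  have aux : ∀ f : MulAut (FreeGroup (Sg X Y Z)), (∀ t, f (of (em Y t)) ∈ FXZ X Y Z) →
      ∀ w, w ∈ FXZ X Y Z → f w ∈ FXZ X Y Z := by
    intro f hf w hw
    induction hw using Subgroup.closure_induction with
    | mem x hx => obtain ⟨s, rfl⟩ := hx; exact hf s
    | one => simp
    | mul x y _ _ hx hy => rw [map_mul]; exact mul_mem hx hy
    | inv x _ hx => rw [map_inv]; exact inv_mem hx
  refine ⟨hy, fun w => ⟨fun hw => ?_, aux g h w⟩⟩
  have := aux g⁻¹ h' _ hw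
  rwa [MulAut.inv_apply_self] at this

lemma IsPerm.inv {g : MulAut (FreeGroup (Sg X Y Z))} {e : Equiv.Perm X} (h : IsPerm g e) :
    IsPerm g⁻¹ e⁻¹ := by
  refine ⟨fun x => ?_, fun c => ?_⟩
  · apply g.injective
    rw [MulAut.apply_inv_self, h.1, ← Equiv.Perm.mul_apply, mul_inv_cancel, Equiv.Perm.one_apply]
  · apply g.injective
    rw [MulAut.apply_inv_self, h.2]

lemma IsPerm.em {g : MulAut (FreeGroup (Sg X Y Z))} {e : Equiv.Perm X} (h : IsPerm g e)
    (t : X ⊕ Z) : g (of (em Y t)) = of (em Y (Sum.map e id t)) := by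
  cases t with
  | inl x => exact h.1 x
  | inr z => exact h.2 (Sum.inr z)

lemma IsInv.em {g : MulAut (FreeGroup (Sg X Y Z))} {x : X} (h : IsInv g x)
    (t : X ⊕ Z) (ht : t ≠ Sum.inl x) : g (of (em Y t)) = of (em Y t) :=
  h.2 _ (fun e => ht (em_inj.1 e))

lemma TSet_le : TSet X Y Z ⊆ T' X Y Z := by
  rintro g (⟨x, h⟩ | ⟨e, h⟩ | ⟨t, v, hv, h⟩)
  · have key : ∀ t, g (of (em Y t)) ∈ FXZ X Y Z := by
      intro t
      by_cases ht : t = Sum.inl x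
      · subst ht
        have e : g (of (em Y (Sum.inl x : X ⊕ Z))) = (of (em Y (Sum.inl x : X ⊕ Z)))⁻¹ := h.1
        rw [e]; exact inv_mem (em_mem_FXZ _)
      · rw [h.em t ht]; exact em_mem_FXZ t
    refine mem_T'_aux (fun y => h.2 _ (by simp [ye])) key ?_
    rw [h.inv_eq]; exact key
  · exact mem_T'_aux (fun y => h.2 _) (fun t => by rw [h.em]; exact em_mem_FXZ _)
      (fun t => by rw [h.inv.em]; exact em_mem_FXZ _)
  · have hm : of (em Y v) ∈ Fm (em Y t) := of_mem_Fm (by simpa [em_inj] using hv)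
    have hi := h.inv hm (rf_mem t hm)
    refine mem_T'_aux (fun y => h.2 _ (ye_ne_em _ _)) (fun s => ?_) (fun s => ?_)
    · by_cases hs : em Y s = em Y t
      · rw [hs, h.1]
        exact mul_mem (mul_mem (em_mem_FXZ _) (em_mem_FXZ _)) (rf_mem t (em_mem_FXZ _))
      · rw [h.2 _ hs]; exact em_mem_FXZ _
    · by_cases hs : em Y s = em Y t
      · rw [hs, hi.1]
        exact mul_mem (mul_mem (inv_mem (em_mem_FXZ _)) (em_mem_FXZ _))
          (inv_mem (rf_mem t (em_mem_FXZ _)))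
      · rw [hi.2 _ hs]; exact em_mem_FXZ _

lemma conj_y {g h : MulAut (FreeGroup (Sg X Y Z))} (hg : g ∈ T' X Y Z) {y : Y} {t : X ⊕ Z}
    (hh : IsTw h (ye X Z y) (of (em Y t)) (of (em Y t))⁻¹) : g * h * g⁻¹ ∈ H X Y Z := by
  have hgi : g⁻¹ ∈ T' X Y Z := inv_mem hg
  have k := hh.conj (hg.1 y) (by
    intro s hs
    rcases cases_sg s with ⟨t, rfl⟩ | ⟨y', rfl⟩
    · exact FXZ_le y ((hgi.2 _).2 (em_mem_FXZ t))
    · rw [hgi.1]; exact of_mem_Fm hs)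
  rw [map_inv] at k
  obtain ⟨g', hg', e⟩ := h1 y _ ((hg.2 _).2 (em_mem_FXZ t))
  rw [k.eq e]; exact hg'

lemma conj_tau_inv {g h : MulAut (FreeGroup (Sg X Y Z))} {x : X} (hg : IsInv g x) {t : X ⊕ Z}
    {y : Y} (hh : IsTw h (em Y t) (of (ye X Z y)) (rf t (of (ye X Z y)))) :
    g * h * g⁻¹ ∈ H X Y Z := by
  by_cases ht : t = Sum.inl x
  · subst ht
    have hm := of_mem_Fm (ye_ne_em (Sum.inl x : X ⊕ Z) y)
    have k := hg.conj (hh : IsTw h (Sum.inl x) _ 1) hm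
    obtain ⟨g', hg', e⟩ := h3 (Z := Z) x y
    have e' := e.inv (one_mem _) hm
    rw [inv_one] at e'
    rw [k.eq e']
    exact inv_mem hg'
  · have k := hh.conj (hg.em t ht) (by
      intro s hs
      rw [hg.inv_eq]
      by_cases hsx : s = Sum.inl x
      · subst hsx; rw [hg.1]; exact inv_mem (of_mem_Fm hs)
      · rw [hg.2 s hsx]; exact of_mem_Fm hs)
    have hgy : g (of (ye X Z y)) = of (ye X Z y) := hg.2 _ (by simp [ye])
    rw [map_rf, hgy] at k
    exact Subgroup.subset_closure (Or.inl ⟨t, y, k⟩)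

lemma conj_tau_perm {g h : MulAut (FreeGroup (Sg X Y Z))} {e : Equiv.Perm X} (hg : IsPerm g e)
    {t : X ⊕ Z} {y : Y} (hh : IsTw h (em Y t) (of (ye X Z y)) (rf t (of (ye X Z y)))) :
    g * h * g⁻¹ ∈ H X Y Z := by
  have k := hh.conj (hg.em t) (by
    intro s hs
    rcases cases_sg s with ⟨t', rfl⟩ | ⟨y', rfl⟩
    · rw [hg.inv.em]
      apply of_mem_Fm
      intro h
      apply hs
      rw [em_inj] at h ⊢
      rw [← h]
      cases t' <;> simp
    · rw [show g⁻¹ (of (ye X Z y')) = of (ye X Z y') from hg.inv.2 _]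
      exact of_mem_Fm (ye_ne_em _ _))
  have hgy : g (of (ye X Z y)) = of (ye X Z y) := hg.2 _
  rw [map_rf, hgy] at k
  have hrf : rf t (of (ye X Z y)) = rf (Sum.map e id t) (of (ye X Z y)) := by cases t <;> rfl
  rw [hrf] at k
  exact Subgroup.subset_closure (Or.inl ⟨_, y, k⟩)

lemma conj_tau_tw {g h : MulAut (FreeGroup (Sg X Y Z))} {t' v : X ⊕ Z} (hv : v ≠ t')
    {w : FreeGroup (Sg X Y Z)} (hw : w = of (em Y v) ∨ w = (of (em Y v))⁻¹)
    (hg : IsTw g (em Y t') w (rf t' w))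
    {t : X ⊕ Z} {y : Y} (hh : IsTw h (em Y t) (of (ye X Z y)) (rf t (of (ye X Z y)))) :
    g * h * g⁻¹ ∈ H X Y Z := by
  have hv' : of (em Y v) ∈ Fm (em Y t') := of_mem_Fm (by simpa [em_inj] using hv)
  have hwt : w ∈ Fm (em Y t') := by
    rcases hw with rfl | rfl
    · exact hv'
    · exact inv_mem hv'
  have gi := hg.inv hwt (rf_mem t' hwt)
  have hy : of (ye X Z y) ∈ Fm (em Y t) := of_mem_Fm (ye_ne_em t y)
  have hy' : of (ye X Z y) ∈ Fm (em Y t') := of_mem_Fm (ye_ne_em t' y)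
  have hH : h ∈ H X Y Z := Subgroup.subset_closure (Or.inl ⟨t, y, hh⟩)
  by_cases ht : t = t'
  · subst ht
    have k1 := (hg.mul hh hy (rf_mem t hy)).mul gi (inv_mem hwt) (inv_mem (rf_mem t hwt))
    obtain ⟨-, g', hg', e⟩ := O_conj t v y hv w⁻¹ (by
      rcases hw with rfl | rfl
      · right; rfl
      · left; simp)
    rw [← rf_mul, ← rf_inv, ← rf_mul] at k1
    have e2 : w⁻¹ * of (ye X Z y) * w⁻¹⁻¹ = w⁻¹ * (of (ye X Z y) * w) := by group
    rw [e2] at e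
    rw [k1.eq e]; exact hg'
  · have ht' : em Y t' ≠ em Y t := by simpa [em_inj] using Ne.symm ht
    have k1 := hh.conj' ht' hy (rf_mem t hy) hy' (rf_mem t hy') gi
    rw [← rf_inv, map_rf] at k1
    have hO : O t' (h w⁻¹ * w) := by
      by_cases hvt : v = t
      · subst hvt
        rcases hw with rfl | rfl
        · rw [map_inv, hh.1]
          cases v with
          | inl x =>
            have := (O_conj t' _ y hv _ (Or.inr rfl)).inv
            simpa [rf, mul_assoc] using this
          | inr z =>
            have := (O_y t' y).mul (O_conj t' _ y hv _ (Or.inr rfl)).inv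
            simpa [rf, mul_assoc] using this
        · rw [inv_inv, hh.1]
          cases v with
          | inl x =>
            have := O_y (X := X) (Z := Z) t' y
            simpa [rf, mul_assoc] using this
          | inr z =>
            have := (O_y t' y).mul (O_conj t' _ y hv _ (Or.inl rfl)).inv
            simpa [rf, mul_assoc] using this
      · have : h w = w := by
          have hf := hh.2 (em Y v) (by simpa [em_inj] using hvt)
          rcases hw with rfl | rfl
          · exact hf
          · rw [map_inv, hf]
        rw [map_inv, this, inv_mul_cancel]
        exact O_one t'
    have hhw : h w⁻¹ ∈ Fm (em Y t') := by
      have := mul_mem hO.1 (inv_mem hwt)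
      simpa using this
    have k2 := hg.mul k1 hhw (rf_mem t' hhw)
    rw [← rf_mul] at k2
    obtain ⟨-, g', hg', e⟩ := hO
    have : g * h * g⁻¹ = (g * (h * g⁻¹ * h⁻¹)) * h := by group
    rw [this, k2.eq e]
    exact mul_mem hg' hH

lemma T_norm {g : MulAut (FreeGroup (Sg X Y Z))} (hg : g ∈ Subgroup.closure (TSet X Y Z)) :
    ∀ h ∈ H X Y Z, g * h * g⁻¹ ∈ H X Y Z := by
  have ext : ∀ g : MulAut (FreeGroup (Sg X Y Z)), (∀ h ∈ HSet X Y Z, g * h * g⁻¹ ∈ H X Y Z) →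
      ∀ h ∈ H X Y Z, g * h * g⁻¹ ∈ H X Y Z := by
    intro g hg h hh
    induction hh using Subgroup.closure_induction with
    | mem x hx => exact hg x hx
    | one => simp
    | mul x y _ _ hx hy =>
      have : g * (x * y) * g⁻¹ = (g * x * g⁻¹) * (g * y * g⁻¹) := by group
      rw [this]; exact mul_mem hx hy
    | inv x _ hx =>
      have : g * x⁻¹ * g⁻¹ = (g * x * g⁻¹)⁻¹ := by group
      rw [this]; exact inv_mem hx
  have gens : ∀ g ∈ TSet X Y Z, (∀ h ∈ H X Y Z, g * h * g⁻¹ ∈ H X Y Z) ∧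
      (∀ h ∈ H X Y Z, g⁻¹ * h * g⁻¹⁻¹ ∈ H X Y Z) := by
    intro g hg
    have hT := TSet_le hg
    constructor
    · apply ext
      rintro h (⟨t, y, hh⟩ | ⟨y, t, hh⟩)
      · rcases hg with ⟨x, hg⟩ | ⟨e, hg⟩ | ⟨t', v, hv, hg⟩
        · exact conj_tau_inv hg hh
        · exact conj_tau_perm hg hh
        · exact conj_tau_tw hv (Or.inl rfl) hg hh
      · exact conj_y hT hh
    · apply ext
      rintro h (⟨t, y, hh⟩ | ⟨y, t, hh⟩)
      · rcases hg with ⟨x, hg⟩ | ⟨e, hg⟩ | ⟨t', v, hv, hg⟩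
        · rw [hg.inv_eq]; exact conj_tau_inv hg hh
        · exact conj_tau_perm hg.inv hh
        · have hv' : of (em Y v) ∈ Fm (em Y t') := of_mem_Fm (by simpa [em_inj] using hv)
          have := hg.inv hv' (rf_mem t' hv')
          rw [← rf_inv] at this
          exact conj_tau_tw hv (Or.inr rfl) this hh
      · exact conj_y (inv_mem hT) hh
  have all : (∀ h ∈ H X Y Z, g * h * g⁻¹ ∈ H X Y Z) ∧
      (∀ h ∈ H X Y Z, g⁻¹ * h * g⁻¹⁻¹ ∈ H X Y Z) := by
    induction hg using Subgroup.closure_induction with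
    | mem x hx => exact gens x hx
    | one => simp
    | mul x y _ _ hx hy =>
      constructor
      · intro h hh
        have : x * y * h * (x * y)⁻¹ = x * (y * h * y⁻¹) * x⁻¹ := by group
        rw [this]; exact hx.1 _ (hy.1 _ hh)
      · intro h hh
        have : (x * y)⁻¹ * h * (x * y)⁻¹⁻¹ = y⁻¹ * (x⁻¹ * h * x⁻¹⁻¹) * y⁻¹⁻¹ := by group
        rw [this]; exact hy.2 _ (hx.2 _ hh)
    | inv x _ hx => exact ⟨hx.2, by simpa using hx.1⟩
  exact all.1

lemma decomp [Fintype X] [Fintype Y] [Fintype Z] [Nonempty X]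
    (f : MulAut (FreeGroup (Sg X Y Z)))
    (hf : ∀ c, IsConj (of (Sum.inr c)) (f (of (Sum.inr c)))) :
    ∃ h ∈ H X Y Z, ∃ t ∈ T' X Y Z, f = h * t := by
  suffices ∃ h ∈ H X Y Z, ∃ t ∈ Subgroup.closure (TSet X Y Z), f = h * t by
    obtain ⟨h, hh, t, ht, e⟩ := this
    exact ⟨h, hh, t, (Subgroup.closure_le _).2 TSet_le ht, e⟩
  have hG := mem_G f hf
  clear hf
  have inH : ∀ g ∈ H X Y Z, ∃ h ∈ H X Y Z, ∃ t ∈ Subgroup.closure (TSet X Y Z), g = h * t :=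
    fun g hg => ⟨g, hg, 1, one_mem _, by simp⟩
  have inT : ∀ g ∈ TSet X Y Z, ∃ h ∈ H X Y Z, ∃ t ∈ Subgroup.closure (TSet X Y Z), g = h * t :=
    fun g hg => ⟨1, one_mem _, g, Subgroup.subset_closure hg, by simp⟩
  induction hG using Subgroup.closure_induction with
  | mem g hg =>
    rcases hg with h | h | ⟨x, s, hs, h⟩ | ⟨c, s, hs, h⟩
    · exact inT g (Or.inl h)
    · exact inT g (Or.inr (Or.inl h))
    · rcases cases_sg s with ⟨v, rfl⟩ | ⟨y, rfl⟩
      · exact inT g (Or.inr (Or.inr ⟨Sum.inl x, v, by rintro rfl; exact hs rfl, h⟩))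
      · exact inH g (Subgroup.subset_closure (Or.inl ⟨Sum.inl x, y, h⟩))
    · rcases c with y | z
      · rcases cases_sg s with ⟨v, rfl⟩ | ⟨y', rfl⟩
        · exact inH g (Subgroup.subset_closure (Or.inr ⟨y, v, h⟩))
        · obtain ⟨g', hg', e⟩ := h2 (X := X) (Z := Z) y y' (by rintro rfl; exact hs rfl)
          rw [IsTw.eq h e]
          exact inH g' hg'
      · rcases cases_sg s with ⟨v, rfl⟩ | ⟨y, rfl⟩
        · exact inT g (Or.inr (Or.inr ⟨Sum.inr z, v, by rintro rfl; exact hs rfl, h⟩))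
        · exact inH g (Subgroup.subset_closure (Or.inl ⟨Sum.inr z, y, h⟩))
  | one => exact inH 1 (one_mem _)
  | mul a b _ _ ha hb =>
    obtain ⟨h, hh, t, ht, rfl⟩ := ha
    obtain ⟨h', hh', t', ht', rfl⟩ := hb
    exact ⟨h * (t * h' * t⁻¹), mul_mem hh (T_norm ht _ hh'), t * t', mul_mem ht ht', by group⟩
  | inv a _ ha =>
    obtain ⟨h, hh, t, ht, rfl⟩ := ha
    exact ⟨t⁻¹ * h⁻¹ * t⁻¹⁻¹, T_norm (inv_mem ht) _ (inv_mem hh), t⁻¹, inv_mem ht, by group⟩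

end Nls

namespace Nls
open FreeGroup (of)
set_option linter.unusedSectionVars false

/-- If a group is generated by elements mapping to a basis of a free abelian group, then its
abelianization is that free abelian group. -/
lemma abel_aux {G J : Type} [Group G] [Fintype J] [DecidableEq J] (g : J → G)
    (hg : Subgroup.closure (Set.range g) = ⊤) (φ : G →* (J → Multiplicative ℤ))
    (hφ : ∀ j, φ (g j) = Pi.mulSingle j (Multiplicative.ofAdd 1)) :
    Nonempty (Abelianization G ≃* (J → Multiplicative ℤ)) := by
  let ψ : (J → Multiplicative ℤ) →* Abelianization G :=
    { toFun := fun v => ∏ j, (Abelianization.of (g j)) ^ (Multiplicative.toAdd (v j))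
      map_one' := by simp
      map_mul' := by
        intro a b
        simp [zpow_add, Finset.prod_mul_distrib] }
  have h1 : ψ.comp (Abelianization.lift φ) = MonoidHom.id _ := by
    apply Abelianization.hom_ext
    apply MonoidHom.eq_of_eqOn_top
    rw [← hg]
    apply MonoidHom.eqOn_closure
    rintro _ ⟨j, rfl⟩
    simp only [MonoidHom.comp_apply, Abelianization.lift_apply_of, hφ, MonoidHom.id_apply]
    change ∏ i, _ = _
    rw [Finset.prod_eq_single j]
    · simp
    · intro i _ hi; simp [Pi.mulSingle_eq_of_ne hi]
    · simp
  have h2 : (Abelianization.lift φ).comp ψ = MonoidHom.id _ := by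
    ext v i
    simp only [MonoidHom.comp_apply, MonoidHom.id_apply]
    change Multiplicative.toAdd (Abelianization.lift φ (∏ j, _) i) = _
    rw [map_prod, Finset.prod_apply, Finset.prod_eq_single i]
    · simp [hφ]
    · intro j _ hj; simp [hφ, Pi.mulSingle_eq_of_ne hj.symm]
    · simp
  exact ⟨MonoidHom.toMulEquiv _ _ h1 h2⟩

/-- Homomorphisms to `ℤ` killing a generator kill its centralizer. -/
lemma cent {S : Type} [DecidableEq S] (d : FreeGroup S →* Multiplicative ℤ) (c : S)
    (hd : d (of c) = 1) (v : FreeGroup S) (hv : v * of c = of c * v) : d v = 1 := by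
  have h2 : ∀ m : ℤ, (2 : ℚ) ^ m ≠ 0 := fun m => zpow_ne_zero _ (by norm_num)
  let θ : FreeGroup S →* Equiv.Perm ℚ := FreeGroup.lift fun t =>
    if t = c then Equiv.addRight 1 else Equiv.mulLeft₀ _ (h2 (Multiplicative.toAdd (d (of t))))
  have key : ∀ w, ∃ b, ∀ q, θ w q = (2 : ℚ) ^ (Multiplicative.toAdd (d w)) * q + b := by
    intro w
    induction w using FreeGroup.induction_on with
    | C1 => exact ⟨0, by simp⟩
    | of t =>
      by_cases ht : t = c
      · subst ht; exact ⟨1, fun q => by simp [θ, hd]⟩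
      · exact ⟨0, fun q => by simp [θ, ht]⟩
    | inv_of t ih =>
      obtain ⟨b, hb⟩ := ih
      refine ⟨-((2 : ℚ) ^ (Multiplicative.toAdd (d (of t))))⁻¹ * b, fun q => ?_⟩
      rw [map_inv]
      apply (θ (of t)).injective
      rw [← Equiv.Perm.mul_apply, mul_inv_cancel, Equiv.Perm.one_apply, hb, map_inv, toAdd_inv,
        zpow_neg]
      have := h2 (Multiplicative.toAdd (d (of t)))
      field_simp
      ring
    | mul x y hx hy =>
      obtain ⟨b, hb⟩ := hx
      obtain ⟨b', hb'⟩ := hy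
      refine ⟨(2 : ℚ) ^ (Multiplicative.toAdd (d x)) * b' + b, fun q => ?_⟩
      rw [map_mul, Equiv.Perm.mul_apply, hb', hb, map_mul, toAdd_mul, zpow_add₀ (by norm_num)]
      ring
  obtain ⟨b, hb⟩ := key v
  have hc : ∀ q, θ (of c) q = q + 1 := fun q => by simp [θ]
  have h := congrArg (fun w => θ w 0) hv
  simp only [map_mul, Equiv.Perm.mul_apply, hc, hb] at h
  have h3 : (2 : ℚ) ^ (Multiplicative.toAdd (d v)) = 1 := by linarith
  have h4 : Multiplicative.toAdd (d v) = 0 := by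
    have := zpow_right_injective₀ (a := (2 : ℚ)) (by norm_num) (by norm_num)
    apply this
    simpa using h3
  exact Multiplicative.toAdd.injective (by simpa using h4)

/-- Conjugators are well defined up to homomorphisms killing the generator. -/
lemma conj_wd {S : Type} [DecidableEq S] (d : FreeGroup S →* Multiplicative ℤ) (c : S)
    (hd : d (of c) = 1) (v w : FreeGroup S) (h : v * of c * v⁻¹ = w * of c * w⁻¹) :
    d v = d w := by
  have := cent d c hd (w⁻¹ * v) (by
    have e : w⁻¹ * v * of c = w⁻¹ * (v * of c * v⁻¹) * v := by group
    rw [e, h]; group)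
  rw [map_mul, map_inv, inv_mul_eq_one] at this
  exact this.symm

/-- Exponent sum. -/
def ex {S : Type} [DecidableEq S] (s : S) : FreeGroup S →* Multiplicative ℤ :=
  FreeGroup.lift fun t => if t = s then Multiplicative.ofAdd 1 else 1

lemma ex_self {S : Type} [DecidableEq S] (s : S) : ex s (of s) = Multiplicative.ofAdd 1 := by
  simp [ex]

lemma ex_ne {S : Type} [DecidableEq S] {s t : S} (h : t ≠ s) : ex s (of t) = 1 := by
  simp [ex, h]

variable {X Y Z : Type} [DecidableEq X] [DecidableEq Y] [DecidableEq Z]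

/-- The idempotent endomorphism killing `Y`. -/
def P (X Y Z : Type) : FreeGroup (Sg X Y Z) →* FreeGroup (Sg X Y Z) :=
  FreeGroup.lift (Sum.elim (fun x => of (Sum.inl x))
    (Sum.elim (fun _ => 1) (fun z => of (Sum.inr (Sum.inr z)))))

lemma P_em (t : X ⊕ Z) : P X Y Z (of (em Y t)) = of (em Y t) := by
  cases t <;> simp [P, em]

lemma P_ye (y : Y) : P X Y Z (of (ye X Z y)) = 1 := by simp [P, ye]

lemma P_factor {M : Type} [Group M] (d : FreeGroup (Sg X Y Z) →* M)
    (hd : ∀ y, d (of (ye X Z y)) = 1) (w : FreeGroup (Sg X Y Z)) : d (P X Y Z w) = d w := by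
  have : d.comp (P X Y Z) = d := by
    apply FreeGroup.ext_hom
    intro s
    rcases cases_sg s with ⟨t, rfl⟩ | ⟨y, rfl⟩
    · simp [P_em]
    · simp [P_ye, hd]
  exact DFunLike.congr_fun this w

lemma P_FXZ {w : FreeGroup (Sg X Y Z)} (hw : w ∈ FXZ X Y Z) : P X Y Z w = w := by
  induction hw using Subgroup.closure_induction with
  | mem x hx => obtain ⟨t, rfl⟩ := hx; exact P_em t
  | one => simp
  | mul x y _ _ hx hy => rw [map_mul, hx, hy]
  | inv x _ hx => rw [map_inv, hx]

/-- The kernel `K`. -/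
def K' (X Y Z : Type) : Subgroup (MulAut (FreeGroup (Sg X Y Z))) where
  carrier := {f | (∀ c, IsConj (of (Sum.inr c)) (f (of (Sum.inr c)))) ∧
    ∀ w, P X Y Z (f w) = P X Y Z w}
  one_mem' := ⟨fun c => by rw [MulAut.one_apply], fun w => by simp⟩
  mul_mem' := by
    intro f g hf hg
    refine ⟨fun s => ?_, fun w => ?_⟩
    · rw [MulAut.mul_apply]
      exact (hf.1 s).trans (f.toMonoidHom.map_isConj (hg.1 s))
    · rw [MulAut.mul_apply]
      exact (hf.2 (g w)).trans (hg.2 w)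
  inv_mem' := by
    intro f hf
    refine ⟨fun s => ?_, fun w => ?_⟩
    · have h := (f⁻¹ : MulAut (FreeGroup (Sg X Y Z))).toMonoidHom.map_isConj (hf.1 s)
      simp only [MulEquiv.toMonoidHom_eq_coe, MonoidHom.coe_coe] at h
      rw [MulAut.inv_apply_self] at h
      exact h.symm
    · have h := hf.2 ((f⁻¹ : MulAut (FreeGroup (Sg X Y Z))) w)
      rw [MulAut.apply_inv_self] at h
      exact h.symm

lemma IsTw.P_eq {g : MulAut (FreeGroup (Sg X Y Z))} {t : Sg X Y Z} {a b : FreeGroup (Sg X Y Z)}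
    (h : IsTw g t a b) (h' : P X Y Z (a * of t * b) = P X Y Z (of t)) (w : FreeGroup (Sg X Y Z)) :
    P X Y Z (g w) = P X Y Z w := by
  have : (P X Y Z).comp g.toMonoidHom = P X Y Z := by
    apply FreeGroup.ext_hom
    intro s
    change P X Y Z (g (of s)) = _
    by_cases hs : s = t
    · subst hs; rw [h.1, h']
    · rw [h.2 s hs]
  exact DFunLike.congr_fun this w

lemma HSet_K : HSet X Y Z ⊆ K' X Y Z := by
  rintro g (⟨t, y, h⟩ | ⟨y, t, h⟩)
  · refine ⟨fun c => ?_, h.P_eq ?_⟩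
    · by_cases hc : (Sum.inr c : Sg X Y Z) = em Y t
      · cases t with
        | inl x => simp [em] at hc
        | inr z =>
          rw [hc, h.1]
          exact isConj_iff.2 ⟨of (ye X Z y), rfl⟩
      · rw [h.2 _ hc]
    · cases t <;> simp [rf, P_ye]
  · refine ⟨fun c => ?_, h.P_eq ?_⟩
    · by_cases hc : (Sum.inr c : Sg X Y Z) = ye X Z y
      · rw [hc, h.1]
        exact isConj_iff.2 ⟨_, rfl⟩
      · rw [h.2 _ hc]
    · simp [P_ye]

lemma K_le_H [Fintype X] [Fintype Y] [Fintype Z] [Nonempty X] : K' X Y Z ≤ H X Y Z := by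
  intro f hf
  obtain ⟨h, hh, t, ht, rfl⟩ := decomp f hf.1
  have hK : h ∈ K' X Y Z := (Subgroup.closure_le _).2 HSet_K hh
  have htK : t ∈ K' X Y Z := by
    have := mul_mem (inv_mem hK) hf
    simpa using this
  have : t = 1 := by
    apply aut_ext
    intro s
    rw [MulAut.one_apply]
    rcases cases_sg s with ⟨s, rfl⟩ | ⟨y, rfl⟩
    · have h1 := P_FXZ ((ht.2 _).2 (em_mem_FXZ s))
      rw [← h1, htK.2, P_em]
    · exact ht.1 y
  rw [this, mul_one]
  exact hh

/-- The conjugator. -/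
noncomputable def cj (f : K' X Y Z) (c : Y ⊕ Z) : FreeGroup (Sg X Y Z) :=
  (isConj_iff.1 (f.2.1 c)).choose

lemma cj_spec (f : K' X Y Z) (c : Y ⊕ Z) :
    f.1 (of (Sum.inr c)) = cj f c * of (Sum.inr c) * (cj f c)⁻¹ :=
  (isConj_iff.1 (f.2.1 c)).choose_spec.symm

/-- The deviation of the `y`-exponent. -/
def dv (f : K' X Y Z) (y : Y) : FreeGroup (Sg X Y Z) →* Multiplicative ℤ :=
  ((ex (ye X Z y)).comp f.1.toMonoidHom) / ex (ye X Z y)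

lemma dv_apply (f : K' X Y Z) (y : Y) (w : FreeGroup (Sg X Y Z)) :
    dv f y w = ex (ye X Z y) (f.1 w) / ex (ye X Z y) w := rfl

lemma dv_inr (f : K' X Y Z) (y : Y) (c : Y ⊕ Z) : dv f y (of (Sum.inr c)) = 1 := by
  rw [dv_apply, cj_spec]
  simp

lemma dv_ye (f : K' X Y Z) (y y' : Y) : dv f y (of (ye X Z y')) = 1 := dv_inr f y _

lemma dv_congr (f : K' X Y Z) (y : Y) {v w : FreeGroup (Sg X Y Z)} (h : P X Y Z v = P X Y Z w) :
    dv f y v = dv f y w := by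
  rw [← P_factor _ (dv_ye f y) v, h, P_factor _ (dv_ye f y)]

lemma ex_em (f : K' X Y Z) (t : X ⊕ Z) (w : FreeGroup (Sg X Y Z)) :
    ex (em Y t) (f.1 w) = ex (em Y t) w := by
  have : ∀ y, ex (em Y t) (of (ye X Z y)) = 1 := fun y => ex_ne (ye_ne_em t y)
  rw [← P_factor _ this, f.2.2, P_factor _ this]

lemma cj_mul (f g : K' X Y Z) (c : Y ⊕ Z) (d : FreeGroup (Sg X Y Z) →* Multiplicative ℤ)
    (hd : d (of (Sum.inr c)) = 1) : d (cj (f * g) c) = d (f.1 (cj g c)) * d (cj f c) := by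
  rw [← map_mul]
  apply conj_wd d _ hd
  rw [← cj_spec, Subgroup.coe_mul, MulAut.mul_apply, cj_spec g, map_mul, map_mul, cj_spec f,
    map_inv]
  group

lemma dv_cj (f g : K' X Y Z) (y : Y) (z : Z) : dv f y (cj g (Sum.inr z)) = 1 := by
  rw [← P_factor _ (dv_ye f y)]
  apply cent _ (Sum.inr (Sum.inr z)) (dv_inr f y _)
  have h := g.2.2 (of (Sum.inr (Sum.inr z)))
  have e : P X Y Z (of (Sum.inr (Sum.inr z))) = of (Sum.inr (Sum.inr z)) :=
    P_em (Sum.inr z : X ⊕ Z)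
  rw [cj_spec, map_mul, map_mul, map_inv, e] at h
  exact mul_inv_eq_iff_eq_mul.1 h

/-- The index type of the generators. -/
abbrev Jt (X Y Z : Type) := ((X ⊕ Z) × Y) ⊕ ((X ⊕ Z) × Y)

/-- The coordinates of the abelianization map. -/
noncomputable def co (f : K' X Y Z) : Jt X Y Z → Multiplicative ℤ
  | Sum.inl (Sum.inl x, y) => ex (ye X Z y) (f.1 (of (em Y (Sum.inl x : X ⊕ Z))))
  | Sum.inl (Sum.inr z, y) => ex (ye X Z y) (cj f (Sum.inr z))
  | Sum.inr (t, y) => ex (em Y t) (cj f (Sum.inl y))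

lemma co_mul (f g : K' X Y Z) : co (f * g) = co f * co g := by
  funext j
  rw [Pi.mul_apply]
  rcases j with ⟨x | z, y⟩ | ⟨t, y⟩
  · simp only [co]
    have h := dv_congr f y (g.2.2 (of (em Y (Sum.inl x : X ⊕ Z))))
    rw [dv_apply, dv_apply, ex_ne (em_ne_ye _ y), div_one, div_eq_iff_eq_mul] at h
    exact h
  · simp only [co]
    have h := dv_cj f g y z
    rw [dv_apply, div_eq_one] at h
    rw [cj_mul _ _ _ _ (ex_ne (by simp [ye])), h, mul_comm]
  · simp only [co]
    rw [cj_mul _ _ _ _ (ex_ne (ye_ne_em t y)), ex_em, mul_comm]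

/-- The abelianization map. -/
noncomputable def coHom (X Y Z : Type) [DecidableEq X] [DecidableEq Y] [DecidableEq Z] :
    K' X Y Z →* (Jt X Y Z → Multiplicative ℤ) :=
  MonoidHom.mk' co co_mul

/-- The generators. -/
def gn (j : Jt X Y Z) : MulAut (FreeGroup (Sg X Y Z)) :=
  match j with
  | Sum.inl (t, y) => tw (em Y t) (of (ye X Z y)) (rf t (of (ye X Z y)))
      (of_mem_Fm (ye_ne_em t y)) (rf_mem t (of_mem_Fm (ye_ne_em t y)))
  | Sum.inr (t, y) => tw (ye X Z y) (of (em Y t)) (of (em Y t))⁻¹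
      (of_mem_Fm (em_ne_ye t y)) (inv_mem (of_mem_Fm (em_ne_ye t y)))

lemma gn_inl (t : X ⊕ Z) (y : Y) : IsTw (gn (Sum.inl (t, y))) (em Y t) (of (ye X Z y))
    (rf t (of (ye X Z y))) := isTw_tw _ _ _ (of_mem_Fm (ye_ne_em t y))
      (rf_mem t (of_mem_Fm (ye_ne_em t y)))

lemma gn_inr (t : X ⊕ Z) (y : Y) : IsTw (gn (Sum.inr (t, y))) (ye X Z y) (of (em Y t))
    (of (em Y t))⁻¹ := isTw_tw _ _ _ (of_mem_Fm (em_ne_ye t y))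
      (inv_mem (of_mem_Fm (em_ne_ye t y)))

lemma gn_H (j : Jt X Y Z) : gn j ∈ HSet X Y Z := by
  rcases j with ⟨t, y⟩ | ⟨t, y⟩
  · exact Or.inl ⟨t, y, gn_inl t y⟩
  · exact Or.inr ⟨y, t, gn_inr t y⟩

/-- The generators as elements of the kernel. -/
def gK (j : Jt X Y Z) : K' X Y Z := ⟨gn j, HSet_K (gn_H j)⟩

lemma gK_closure [Fintype X] [Fintype Y] [Fintype Z] [Nonempty X] :
    Subgroup.closure (Set.range (gK (X := X) (Y := Y) (Z := Z))) = ⊤ := by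
  rw [eq_top_iff]
  rintro ⟨f, hf⟩ -
  have h : f ∈ (Subgroup.closure (Set.range (gK (X := X) (Y := Y) (Z := Z)))).map
      (K' X Y Z).subtype := by
    have h := K_le_H hf
    rw [MonoidHom.map_closure]
    refine Subgroup.closure_mono ?_ h
    rintro g (⟨t, y, h⟩ | ⟨y, t, h⟩)
    · exact ⟨_, ⟨Sum.inl (t, y), rfl⟩, (gn_inl t y).eq h⟩
    · exact ⟨_, ⟨Sum.inr (t, y), rfl⟩, (gn_inr t y).eq h⟩
  obtain ⟨g, hg, e⟩ := h
  have : g = ⟨f, hf⟩ := Subtype.ext e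
  rwa [← this]

lemma cj_eq (f : K' X Y Z) (c : Y ⊕ Z) (d : FreeGroup (Sg X Y Z) →* Multiplicative ℤ)
    (hd : d (of (Sum.inr c)) = 1) {w : FreeGroup (Sg X Y Z)}
    (h : f.1 (of (Sum.inr c)) = w * of (Sum.inr c) * w⁻¹) : d (cj f c) = d w := by
  apply conj_wd d _ hd
  rw [← cj_spec, h]

lemma cj_one (f : K' X Y Z) (c : Y ⊕ Z) (d : FreeGroup (Sg X Y Z) →* Multiplicative ℤ)
    (hd : d (of (Sum.inr c)) = 1)
    (h : f.1 (of (Sum.inr c)) = of (Sum.inr c)) : d (cj f c) = 1 := by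
  rw [cj_eq f c d hd (w := 1) (by simpa using h), map_one]

lemma ms_self {J : Type} [DecidableEq J] (j : J) :
    (Pi.mulSingle j (Multiplicative.ofAdd (1:ℤ)) : J → Multiplicative ℤ) j
      = Multiplicative.ofAdd 1 := by simp

lemma ms_ne {J : Type} [DecidableEq J] {i j : J} (h : i ≠ j) :
    (Pi.mulSingle j (Multiplicative.ofAdd (1:ℤ)) : J → Multiplicative ℤ) i = 1 :=
  Pi.mulSingle_eq_of_ne h _

lemma co_gK (j : Jt X Y Z) : coHom X Y Z (gK j) = Pi.mulSingle j (Multiplicative.ofAdd 1) := by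
  funext i
  change co (gK j) i = _
  rcases j with ⟨t, y⟩ | ⟨t, y⟩
  · have hg : IsTw (gK (Sum.inl (t, y))).1 _ _ _ := gn_inl t y
    rcases i with ⟨x' | z', y'⟩ | ⟨t', y'⟩
    · simp only [co]
      by_cases ht : Sum.inl x' = t
      · subst ht
        rw [hg.1, map_mul, map_mul, ex_ne (em_ne_ye _ _)]
        by_cases hy : y = y'
        · subst hy; rw [ms_self, ex_self]; simp [rf]
        · rw [ms_ne (by simpa using Ne.symm hy), ex_ne (by simpa [ye_inj] using hy)]; simp [rf]
      · rw [hg.2 _ (by simpa [em_inj] using ht), ms_ne (by simp [ht]), ex_ne (em_ne_ye _ _)]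
    · simp only [co]
      have h1 : ex (ye X Z y') (of (Sum.inr (Sum.inr z'))) = 1 := ex_ne (by simp [ye])
      by_cases ht : Sum.inr z' = t
      · subst ht
        rw [cj_eq _ _ _ h1 hg.1]
        by_cases hy : y = y'
        · subst hy; rw [ms_self, ex_self]
        · rw [ms_ne (by simpa using Ne.symm hy), ex_ne (by simpa [ye_inj] using hy)]
      · rw [cj_one _ _ _ h1, ms_ne (by simp [ht])]
        exact hg.2 (em Y (Sum.inr z')) (by simpa [em_inj] using ht)
    · simp only [co]
      rw [cj_one _ _ _ (ex_ne (ye_ne_em _ _)), ms_ne (by simp)]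
      exact hg.2 _ (ye_ne_em t y')
  · have hg : IsTw (gK (Sum.inr (t, y))).1 _ _ _ := gn_inr t y
    rcases i with ⟨x' | z', y'⟩ | ⟨t', y'⟩
    · simp only [co]
      rw [hg.2 _ (em_ne_ye _ _), ms_ne (by simp), ex_ne (em_ne_ye _ _)]
    · simp only [co]
      rw [cj_one _ _ _ (ex_ne (by simp [ye])), ms_ne (by simp)]
      exact hg.2 _ (em_ne_ye (Sum.inr z') y)
    · simp only [co]
      have h1 : ex (em Y t') (of (Sum.inr (Sum.inl y'))) = 1 := ex_ne (ye_ne_em t' y')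
      by_cases hy : y' = y
      · subst hy
        rw [cj_eq _ _ _ h1 hg.1]
        by_cases ht : t = t'
        · subst ht; rw [ms_self, ex_self]
        · rw [ms_ne (by simpa using Ne.symm ht), ex_ne (by simpa [em_inj] using ht)]
      · rw [cj_one _ _ _ h1, ms_ne (by simp [hy])]
        exact hg.2 (ye X Z y') (by simpa [ye_inj] using hy)

lemma main [Fintype X] [Fintype Y] [Fintype Z] [Nonempty X] :
    Nonempty (Abelianization (K' X Y Z) ≃* (Jt X Y Z → Multiplicative ℤ)) :=
  abel_aux gK gK_closure (coHom X Y Z) co_gK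

/-- Reindexing. -/
def reidx {J I : Type} (e : I ≃ J) : (J → Multiplicative ℤ) ≃* Multiplicative (I → ℤ) where
  toFun v := Multiplicative.ofAdd fun i => Multiplicative.toAdd (v (e i))
  invFun v := fun j => Multiplicative.ofAdd (Multiplicative.toAdd v (e.symm j))
  left_inv v := by funext j; simp
  right_inv v := by apply Multiplicative.toAdd.injective; funext j; simp
  map_mul' _ _ := rfl

end Nls

namespace Birman

lemma factor_P {n k l : ℕ} (w : FG n k l) :
    FreeGroup.map (fun s : Gen n 0 l => (Sum.map id (Sum.map Fin.elim0 id) s : Gen n k l))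
      (proj n k l w) = Nls.P (Fin n) (Fin k) (Fin l) w := by
  have : (FreeGroup.map (fun s : Gen n 0 l =>
      (Sum.map id (Sum.map Fin.elim0 id) s : Gen n k l))).comp (proj n k l)
        = Nls.P (Fin n) (Fin k) (Fin l) := by
    apply FreeGroup.ext_hom
    rintro (x | y | z) <;> simp [proj, Nls.P]
  exact DFunLike.congr_fun this w

lemma proj_P {n k l : ℕ} (w : FG n k l) :
    proj n k l (Nls.P (Fin n) (Fin k) (Fin l) w) = proj n k l w :=
  Nls.P_factor (proj n k l) (fun y => by simp [proj, Nls.ye]) w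

lemma K_eq (n k l : ℕ) : K n k l = Nls.K' (Fin n) (Fin k) (Fin l) := by
  ext f
  constructor
  · rintro ⟨h1, h2⟩
    exact ⟨h1, fun w => by rw [← factor_P, h2 w, factor_P]⟩
  · rintro ⟨h1, h2⟩
    exact ⟨h1, fun w => by rw [← proj_P, h2 w, proj_P]⟩

end Birman

namespace Birman

/-- **Theorem D, case `n ≥ 1`.**  For `n ≥ 1`, `k ≥ 1` and `l ≥ 0`, the abelianization
`H_1(K_{n,k,l}; ℤ)` of `K_{n,k,l}` is free abelian of rank `2kn + 2kl`. -/
theorem abelianization_K_n_pos (n k l : ℕ) (hn : 1 ≤ n) (hk : 1 ≤ k) :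
    Nonempty (Abelianization ↥(K n k l) ≃* Multiplicative (Fin (2*k*n + 2*k*l) → ℤ)) := by
  have : Nonempty (Fin n) := ⟨⟨0, hn⟩⟩
  rw [K_eq]
  obtain ⟨e⟩ := Nls.main (X := Fin n) (Y := Fin k) (Z := Fin l)
  have hc : Fintype.card (Fin (2*k*n + 2*k*l)) = Fintype.card (Nls.Jt (Fin n) (Fin k) (Fin l)) := by
    simp only [Nls.Jt, Fintype.card_sum, Fintype.card_prod, Fintype.card_fin]
    ring
  exact ⟨e.trans (Nls.reidx (Fintype.equivOfCardEq hc))⟩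

end Birman
end
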